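/- Let n ≥ 2. There exists ε > 0 with the following property. Let u₀ : S¹ → S^{n−1} satisfy ‖u₀‖_{Ḣ^{1/2}} ≤ ε and let u be an energy-class solution of the half-harmonic gradient flow with initial datum u₀ satisfying ‖u(t,·)‖_{Ḣ^{1/2}} ≤ ‖u₀‖_{Ḣ^{1/2}} for a.e. t ≥ 0. Then there exist a sequence of times t_k → ∞ and a measurable map u_∞ : S¹ → S^{n−1} with Σ_{m∈ℤ}(1+m²)|û_∞(m)|² < ∞ such that ‖u(t_k,·) − u_∞‖_{L²(S¹)} → 0, sup_k Σ_{m∈ℤ}(1+m²)|û(t_k,·)(m)|² < ∞ (so u(t_k,·) converges weakly in H¹(S¹) to u_∞), and u_∞ is a weakly half-harmonic map into S^{n−1}: for every φ ∈ C^∞(S¹;ℝⁿ), ∫_{S¹}∫_{S¹} d_{1/2}u_∞(x,y)·d_{1/2}φ(x,y) (dy dx/|x−y|) = ∫_{S¹} |d_{1/2}u_∞|²(x) u_∞(x)·φ(x) dx. -/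

import Mathlib

open MeasureTheory Real Filter
open scoped BigOperators ENNReal Real Topology

noncomputable section

/-- Chord distance on `S¹ ≃ ℝ/2πℤ`: `|x-y| = 2|sin((x-y)/2)|`. -/
def cd (x y : ℝ) : ℝ := 2 * |Real.sin ((x - y) / 2)|

/-- Fundamental domain for the circle `S¹ ≃ ℝ/2πℤ`. -/
def circ : Set ℝ := Set.Ioc (-π) π

/-- `k`-th Fourier coefficient of a `2π`-periodic function `ℝ → ℂ`. -/
def fc (f : ℝ → ℂ) (k : ℤ) : ℂ :=
  ((1 / (2 * π) : ℝ) : ℂ) * ∫ x in circ, f x * Complex.exp (-(Complex.I * (k : ℂ) * (x : ℂ)))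

/-- Fourier coefficient of a real-valued function. -/
def fcR (f : ℝ → ℝ) (k : ℤ) : ℂ := fc (fun x => (f x : ℂ)) k

/-- `ℝⁿ` as a Euclidean space. -/
abbrev E (n : ℕ) := EuclideanSpace ℝ (Fin n)

/-- Componentwise Fourier coefficients of a vector-valued map. -/
def fcV {n : ℕ} (u : ℝ → E n) (k : ℤ) (i : Fin n) : ℂ := fcR (fun x => u x i) k

/-- Squared homogeneous `Ḣ^{1/2}` seminorm: `∑_k |k| |û(k)|²` (valued in `[0,∞]`). -/
def hHalf {n : ℕ} (u : ℝ → E n) : ℝ≥0∞ :=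
  ∑' k : ℤ, (k.natAbs : ℝ≥0∞) * ∑ i, (‖fcV u k i‖₊ : ℝ≥0∞) ^ 2

/-- Squared inhomogeneous `H^s` norm: `∑_k (1+k²)^s |û(k)|²` (valued in `[0,∞]`). -/
def hSob {n : ℕ} (s : ℝ) (u : ℝ → E n) : ℝ≥0∞ :=
  ∑' k : ℤ, ENNReal.ofReal ((1 + (k : ℝ) ^ 2) ^ s) * ∑ i, (‖fcV u k i‖₊ : ℝ≥0∞) ^ 2

/-- Squared homogeneous `Ḣ^{1/2}` seminorm of a scalar function. -/
def hHalfR (f : ℝ → ℝ) : ℝ≥0∞ :=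
  ∑' k : ℤ, (k.natAbs : ℝ≥0∞) * (‖fcR f k‖₊ : ℝ≥0∞) ^ 2

/-- Squared inhomogeneous `H^s` norm of a scalar function. -/
def hSobR (s : ℝ) (f : ℝ → ℝ) : ℝ≥0∞ :=
  ∑' k : ℤ, ENNReal.ofReal ((1 + (k : ℝ) ^ 2) ^ s) * (‖fcR f k‖₊ : ℝ≥0∞) ^ 2

/-- `|d_{1/2}u|²(x) = ∫_{S¹} |u(x)-u(y)|²/|x-y|² dy`. -/
def gagl {n : ℕ} (u : ℝ → E n) (x : ℝ) : ℝ :=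
  ∫ y in circ, (∑ i, (u x i - u y i) ^ 2) / cd x y ^ 2

/-- `∫_{S¹}∫_{S¹} d_{1/2}u(x,y)·d_{1/2}φ(x,y) dy dx/|x-y|`. -/
def pairing {n : ℕ} (u φ : ℝ → E n) : ℝ :=
  ∫ x in circ, ∫ y in circ, (∑ i, (u x i - u y i) * (φ x i - φ y i)) / cd x y ^ 2

/-- The product measure on `(0,∞) × S¹`. -/
def STmeasure : Measure (ℝ × ℝ) :=
  (volume.restrict (Set.Ioi (0 : ℝ))).prod (volume.restrict circ)

/-- Smooth test functions on `(0,∞) × S¹`, compactly supported in time. -/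
structure IsSTTest (n : ℕ) (φ : ℝ → ℝ → E n) : Prop where
  smooth : ContDiff ℝ (⊤ : ℕ∞) (fun p : ℝ × ℝ => φ p.1 p.2)
  periodic : ∀ t, Function.Periodic (φ t) (2 * π)
  suppTime : ∃ a b : ℝ, 0 < a ∧ ∀ t, t ∉ Set.Icc a b → ∀ x, φ t x = 0

/-- Energy-class solution of the half-harmonic gradient flow, with explicit
weak time derivative `w`. -/
structure IsEnergySolAux (n : ℕ) (u₀ : ℝ → E n) (u w : ℝ → ℝ → E n) : Prop where
  meas : Measurable (Function.uncurry u)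
  periodic : ∀ t, Function.Periodic (u t) (2 * π)
  sphere : ∀ᵐ p ∂STmeasure, ‖u p.1 p.2‖ = 1
  energyBdd : ∃ M : ℝ≥0∞, M < ⊤ ∧
    ∀ᵐ t ∂(volume.restrict (Set.Ioi (0 : ℝ))), hHalf (u t) ≤ M
  wMeas : Measurable (Function.uncurry w)
  wL2 : (∫⁻ t in Set.Ioi (0 : ℝ), ∫⁻ x in circ, (‖w t x‖₊ : ℝ≥0∞) ^ 2) < ⊤
  weakDeriv : ∀ φ : ℝ → ℝ → E n, IsSTTest n φ →
    (∫ t in Set.Ioi (0 : ℝ), ∫ x in circ, ∑ i, u t x i * deriv (fun s => φ s x i) t)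
      = - ∫ t in Set.Ioi (0 : ℝ), ∫ x in circ, ∑ i, w t x i * φ t x i
  flow : ∀ φ : ℝ → ℝ → E n, IsSTTest n φ →
    (∫ t in Set.Ioi (0 : ℝ), ∫ x in circ, ∑ i, w t x i * φ t x i)
      + (∫ t in Set.Ioi (0 : ℝ), pairing (u t) (φ t))
      = ∫ t in Set.Ioi (0 : ℝ), ∫ x in circ, gagl (u t) x * ∑ i, u t x i * φ t x i
  init : Tendsto (fun t => ∫⁻ x in circ, (‖u t x - u₀ x‖₊ : ℝ≥0∞) ^ 2)
      (nhdsWithin 0 (Set.Ioi 0)) (nhds 0)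

/-- Energy-class solution of the half-harmonic gradient flow. -/
def IsEnergySol (n : ℕ) (u₀ : ℝ → E n) (u : ℝ → ℝ → E n) : Prop :=
  ∃ w, IsEnergySolAux n u₀ u w

/-- Energy decay: `‖u(t,·)‖_{Ḣ^{1/2}} ≤ ‖u₀‖_{Ḣ^{1/2}}` for a.e. `t ≥ 0`. -/
def EnergyDecay {n : ℕ} (u₀ : ℝ → E n) (u : ℝ → ℝ → E n) : Prop :=
  ∀ᵐ t ∂(volume.restrict (Set.Ioi (0 : ℝ))), hHalf (u t) ≤ hHalf u₀

/-- Fractional Laplacian `(-Δ)^s` of a `2π`-periodic function, via Fourier series. -/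
def fracLapC (s : ℝ) (f : ℝ → ℂ) (x : ℝ) : ℂ :=
  ∑' k : ℤ, (((k.natAbs : ℝ) ^ s : ℝ) : ℂ) * fc f k * Complex.exp (Complex.I * (k : ℂ) * (x : ℂ))

/-- Fractional Laplacian of a real-valued function. -/
def fracLapR (s : ℝ) (f : ℝ → ℝ) (x : ℝ) : ℝ := (fracLapC s (fun y => (f y : ℂ)) x).re

/-- Half-Laplacian of a vector-valued map. -/
def halfLap {n : ℕ} (u : ℝ → E n) (x : ℝ) : E n :=
  (EuclideanSpace.equiv (Fin n) ℝ).symm fun i => fracLapR 1 (fun y => u y i) x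

/-- The integral `C(j,k) = ∫_{-π}^{π} (e^{ijh}-1)(e^{ikh}-1)/(4sin²(h/2)) dh`. -/
def Cjk (j k : ℤ) : ℂ :=
  ∫ h in circ, (Complex.exp (Complex.I * (j : ℂ) * (h : ℂ)) - 1)
      * (Complex.exp (Complex.I * (k : ℂ) * (h : ℂ)) - 1)
      / ((4 * Real.sin (h / 2) ^ 2 : ℝ) : ℂ)

/-- A real trigonometric polynomial: the function equals a finite Fourier sum. -/
def IsTrigPoly (u : ℝ → ℝ) : Prop :=
  ∃ s : Finset ℤ, ∀ x : ℝ,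
    (u x : ℂ) = ∑ k ∈ s, fcR u k * Complex.exp (Complex.I * (k : ℂ) * (x : ℂ))

/-- `d_{1/2}u · d_{1/2}v` as a (complex-valued) function on the circle. -/
def d12prod (u v : ℝ → ℝ) (x : ℝ) : ℂ :=
  ((∫ y in circ, (u x - u y) * (v x - v y) / cd x y ^ 2 : ℝ) : ℂ)

/-- Stereographic projection of `S¹ ∖ {-i}`. -/
def stproj (θ : ℝ) : ℝ := Real.cos θ / (1 + Real.sin θ)

section Discrete

lemma sum_inv_sqrt_natAbs_le (L : ℕ) :
    ∑ j ∈ Finset.Icc (-(L : ℤ)) L, 1 / √(j.natAbs : ℝ) ≤ 4 * √(L : ℝ) := by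
  induction L with
  | zero => simp
  | succ L ih =>
    have hset : Finset.Icc (-((L + 1 : ℕ) : ℤ)) ((L + 1 : ℕ) : ℤ)
        = insert (-((L + 1 : ℕ) : ℤ)) (insert ((L + 1 : ℕ) : ℤ) (Finset.Icc (-(L : ℤ)) L)) := by
      ext j
      simp only [Finset.mem_Icc, Finset.mem_insert]
      omega
    rw [hset, Finset.sum_insert, Finset.sum_insert]
    · have h1 : (-((L + 1 : ℕ) : ℤ)).natAbs = L + 1 := by omega
      have h2 : (((L + 1 : ℕ) : ℤ)).natAbs = L + 1 := by omega
      rw [h1, h2]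
      have hb : 0 < √((L + 1 : ℕ) : ℝ) := Real.sqrt_pos.2 (by positivity)
      have ha : 0 ≤ √(L : ℝ) := Real.sqrt_nonneg _
      have hb2 : √((L + 1 : ℕ) : ℝ) ^ 2 = L + 1 := by
        rw [Real.sq_sqrt (by positivity)]; push_cast; ring
      have ha2 : √(L : ℝ) ^ 2 = L := Real.sq_sqrt (by positivity)
      have hab : √(L : ℝ) ≤ √((L + 1 : ℕ) : ℝ) := Real.sqrt_le_sqrt (by push_cast; linarith)
      have hkey : 1 / √((L + 1 : ℕ) : ℝ) ≤ 2 * (√((L + 1 : ℕ) : ℝ) - √(L : ℝ)) := by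
        rw [div_le_iff₀ hb]
        nlinarith
      linarith
    · simp only [Finset.mem_Icc]; omega
    · simp only [Finset.mem_Icc, Finset.mem_insert]; omega

lemma sum_low_sq_le (s : Finset ℤ) (a : ℤ → ℝ) (h0 : a 0 = 0) (L : ℕ) :
    (∑ j ∈ s with j.natAbs ≤ L, a j) ^ 2
      ≤ 4 * √(L : ℝ) * ∑ j ∈ s, √(j.natAbs : ℝ) * a j ^ 2 := by
  have h1 : (∑ j ∈ s with j.natAbs ≤ L, a j) ^ 2
      ≤ (∑ j ∈ s with j.natAbs ≤ L, 1 / √(j.natAbs : ℝ))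
        * ∑ j ∈ s with j.natAbs ≤ L, √(j.natAbs : ℝ) * a j ^ 2 := by
    apply Finset.sum_sq_le_sum_mul_sum_of_sq_le_mul
    · intros; positivity
    · intros; positivity
    · intro j _
      rcases eq_or_ne j 0 with rfl | hj
      · simp [h0]
      · have : 0 < √(j.natAbs : ℝ) := Real.sqrt_pos.2 (by
          have := Int.natAbs_pos.2 hj
          exact_mod_cast this)
        exact le_of_eq (by field_simp)
  refine h1.trans ?_
  gcongr
  · refine le_trans ?_ (sum_inv_sqrt_natAbs_le L)
    apply Finset.sum_le_sum_of_subset_of_nonneg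
    · intro j
      simp only [Finset.mem_filter, Finset.mem_Icc]
      omega
    · intros; positivity
  · exact Finset.filter_subset _ _

/-- The part of the quadrilinear sum in which `l` and `m` dominate `j` and `k`. -/
lemma quad_top_le (s : Finset ℤ) (a : ℤ → ℝ) (ha : ∀ k, 0 ≤ a k) (h0 : a 0 = 0) :
    ∑ j ∈ s, ∑ k ∈ s, ∑ l ∈ s, ∑ m ∈ s,
        (if j + k + l + m = 0 ∧ max j.natAbs k.natAbs ≤ min l.natAbs m.natAbs
          then a j * a k * a l * a m else 0)
      ≤ 4 * (∑ j ∈ s, √(j.natAbs : ℝ) * a j ^ 2) ^ 2 := by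
  have hinner : ∀ j k : ℤ, ∑ l ∈ s, ∑ m ∈ s,
        (if j + k + l + m = 0 ∧ max j.natAbs k.natAbs ≤ min l.natAbs m.natAbs
          then a j * a k * a l * a m else 0)
      ≤ a j * a k * ∑ l ∈ s, if max j.natAbs k.natAbs ≤ l.natAbs then a l ^ 2 else 0 := by
    intro j k
    have hjk : 0 ≤ a j * a k := mul_nonneg (ha _) (ha _)
    have hterm : ∀ l m : ℤ,
        (if j + k + l + m = 0 ∧ max j.natAbs k.natAbs ≤ min l.natAbs m.natAbs
          then a j * a k * a l * a m else 0)
        ≤ a j * a k * ((if m = -j - k - l then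
            (if max j.natAbs k.natAbs ≤ l.natAbs then a l ^ 2 else 0) else 0) / 2
          + (if l = -j - k - m then
            (if max j.natAbs k.natAbs ≤ m.natAbs then a m ^ 2 else 0) else 0) / 2) := by
      intro l m
      by_cases h : j + k + l + m = 0
      · have h1 : m = -j - k - l := by omega
        have h2 : l = -j - k - m := by omega
        rw [if_pos h1, if_pos h2]
        by_cases h3 : max j.natAbs k.natAbs ≤ min l.natAbs m.natAbs
        · rw [if_pos ⟨h, h3⟩, if_pos (le_trans h3 (min_le_left _ _)),
            if_pos (le_trans h3 (min_le_right _ _))]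
          have := two_mul_le_add_sq (a l) (a m)
          nlinarith
        · rw [if_neg (fun h' => h3 h'.2)]
          apply mul_nonneg hjk
          apply add_nonneg <;> split_ifs <;> positivity
      · rw [if_neg (fun h' => h h'.1)]
        apply mul_nonneg hjk
        apply add_nonneg <;> split_ifs <;> positivity
    refine (Finset.sum_le_sum fun l _ => Finset.sum_le_sum fun m _ => hterm l m).trans ?_
    simp_rw [← Finset.mul_sum]
    refine mul_le_mul_of_nonneg_left ?_ hjk
    simp_rw [Finset.sum_add_distrib, ← Finset.sum_div]
    have hone : ∀ l : ℤ, ∑ m ∈ s, (if m = -j - k - l then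
          (if max j.natAbs k.natAbs ≤ l.natAbs then a l ^ 2 else 0) else 0)
        ≤ (if max j.natAbs k.natAbs ≤ l.natAbs then a l ^ 2 else 0) := by
      intro l
      rw [Finset.sum_ite_eq']
      split_ifs <;> first | positivity | exact le_rfl
    have h1 : ∑ l ∈ s, ∑ m ∈ s, (if m = -j - k - l then
          (if max j.natAbs k.natAbs ≤ l.natAbs then a l ^ 2 else 0) else 0)
        ≤ ∑ l ∈ s, (if max j.natAbs k.natAbs ≤ l.natAbs then a l ^ 2 else 0) :=
      Finset.sum_le_sum fun l _ => hone l
    have h2 : ∑ l ∈ s, ∑ m ∈ s, (if l = -j - k - m then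
          (if max j.natAbs k.natAbs ≤ m.natAbs then a m ^ 2 else 0) else 0)
        ≤ ∑ l ∈ s, (if max j.natAbs k.natAbs ≤ l.natAbs then a l ^ 2 else 0) := by
      rw [Finset.sum_comm]
      exact Finset.sum_le_sum fun l _ => hone l
    linarith
  refine (Finset.sum_le_sum fun j _ => Finset.sum_le_sum fun k _ => hinner j k).trans ?_
  set B := ∑ j ∈ s, √(j.natAbs : ℝ) * a j ^ 2 with hB
  have hre : ∑ j ∈ s, ∑ k ∈ s,
        a j * a k * ∑ l ∈ s, (if max j.natAbs k.natAbs ≤ l.natAbs then a l ^ 2 else 0)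
      = ∑ l ∈ s, a l ^ 2 * (∑ j ∈ s with j.natAbs ≤ l.natAbs, a j) ^ 2 := by
    simp_rw [Finset.mul_sum]
    rw [Finset.sum_congr rfl fun j _ => Finset.sum_comm, Finset.sum_comm]
    refine Finset.sum_congr rfl fun l _ => ?_
    rw [sq (∑ j ∈ s with _, a j), Finset.sum_mul_sum, Finset.sum_filter, Finset.mul_sum]
    refine Finset.sum_congr rfl fun j _ => ?_
    by_cases hj : j.natAbs ≤ l.natAbs
    · rw [if_pos hj, Finset.sum_filter, Finset.mul_sum]
      refine Finset.sum_congr rfl fun k _ => ?_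
      by_cases hk : k.natAbs ≤ l.natAbs
      · rw [if_pos hk, if_pos (max_le hj hk)]; ring
      · rw [if_neg hk, if_neg (fun h => hk (le_trans (le_max_right _ _) h))]; ring
    · rw [if_neg hj, mul_zero]
      refine Finset.sum_eq_zero fun k _ => ?_
      rw [if_neg (fun h => hj (le_trans (le_max_left _ _) h)), mul_zero]
  rw [hre]
  calc ∑ l ∈ s, a l ^ 2 * (∑ j ∈ s with j.natAbs ≤ l.natAbs, a j) ^ 2
      ≤ ∑ l ∈ s, a l ^ 2 * (4 * √(l.natAbs : ℝ) * B) := by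
        refine Finset.sum_le_sum fun l _ => ?_
        exact mul_le_mul_of_nonneg_left (sum_low_sq_le s a h0 _) (sq_nonneg _)
    _ = 4 * B ^ 2 := by
        rw [sq B]
        nth_rewrite 2 [hB]
        rw [Finset.sum_mul, Finset.mul_sum]
        exact Finset.sum_congr rfl fun l _ => by ring

/-- Discrete form of the embedding `H^{1/4} ⊂ L⁴`. -/
lemma quad_sum_le (s : Finset ℤ) (a : ℤ → ℝ) (ha : ∀ k, 0 ≤ a k) (h0 : a 0 = 0) :
    ∑ j ∈ s, ∑ k ∈ s, ∑ l ∈ s, ∑ m ∈ s,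
        (if j + k + l + m = 0 then a j * a k * a l * a m else 0)
      ≤ 24 * (∑ j ∈ s, √(j.natAbs : ℝ) * a j ^ 2) ^ 2 := by
  set T : ℤ → ℤ → ℤ → ℤ → ℝ := fun j k l m =>
    if j + k + l + m = 0 ∧ max j.natAbs k.natAbs ≤ min l.natAbs m.natAbs
          then a j * a k * a l * a m else 0 with hT
  have hT0 : ∀ j k l m, 0 ≤ T j k l m := by
    intro j k l m
    simp only [hT]
    have := ha j; have := ha k; have := ha l; have := ha m
    split_ifs <;> positivity
  have htop := quad_top_le s a ha h0
  have hTval : ∀ j k l m x y z t : ℤ, x + y + z + t = 0 →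
      max x.natAbs y.natAbs ≤ min z.natAbs t.natAbs →
      a x * a y * a z * a t = a j * a k * a l * a m →
      a j * a k * a l * a m = T x y z t := by
    intro j k l m x y z t h1 h2 h3
    simp only [hT]
    rw [if_pos ⟨h1, h2⟩, h3]
  have hle : ∀ j k l m : ℤ, (if j + k + l + m = 0 then a j * a k * a l * a m else 0)
      ≤ T j k l m + T j l k m + T j m k l + T k l j m + T k m j l + T l m j k := by
    intro j k l m
    have e1 := hT0 j k l m; have e2 := hT0 j l k m; have e3 := hT0 j m k l
    have e4 := hT0 k l j m; have e5 := hT0 k m j l; have e6 := hT0 l m j k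
    split_ifs with h
    · have hcases : max j.natAbs k.natAbs ≤ min l.natAbs m.natAbs
          ∨ max j.natAbs l.natAbs ≤ min k.natAbs m.natAbs
          ∨ max j.natAbs m.natAbs ≤ min k.natAbs l.natAbs
          ∨ max k.natAbs l.natAbs ≤ min j.natAbs m.natAbs
          ∨ max k.natAbs m.natAbs ≤ min j.natAbs l.natAbs
          ∨ max l.natAbs m.natAbs ≤ min j.natAbs k.natAbs := by
        generalize j.natAbs = p
        generalize k.natAbs = q
        generalize l.natAbs = r
        generalize m.natAbs = t
        omega
      rcases hcases with h' | h' | h' | h' | h' | h'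
      · have := hTval j k l m j k l m (by omega) h' (by ring); linarith
      · have := hTval j k l m j l k m (by omega) h' (by ring); linarith
      · have := hTval j k l m j m k l (by omega) h' (by ring); linarith
      · have := hTval j k l m k l j m (by omega) h' (by ring); linarith
      · have := hTval j k l m k m j l (by omega) h' (by ring); linarith
      · have := hTval j k l m l m j k (by omega) h' (by ring); linarith
    · linarith
  refine (Finset.sum_le_sum fun j _ => Finset.sum_le_sum fun k _ => Finset.sum_le_sum fun l _ =>
    Finset.sum_le_sum fun m _ => hle j k l m).trans ?_
  simp_rw [Finset.sum_add_distrib]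
  have s12 : ∀ F : ℤ → ℤ → ℤ → ℤ → ℝ,
      ∑ j ∈ s, ∑ k ∈ s, ∑ l ∈ s, ∑ m ∈ s, F j k l m
        = ∑ j ∈ s, ∑ k ∈ s, ∑ l ∈ s, ∑ m ∈ s, F k j l m := fun F => Finset.sum_comm
  have s23 : ∀ F : ℤ → ℤ → ℤ → ℤ → ℝ,
      ∑ j ∈ s, ∑ k ∈ s, ∑ l ∈ s, ∑ m ∈ s, F j k l m
        = ∑ j ∈ s, ∑ k ∈ s, ∑ l ∈ s, ∑ m ∈ s, F j l k m :=
    fun F => Finset.sum_congr rfl fun j _ => Finset.sum_comm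
  have s34 : ∀ F : ℤ → ℤ → ℤ → ℤ → ℝ,
      ∑ j ∈ s, ∑ k ∈ s, ∑ l ∈ s, ∑ m ∈ s, F j k l m
        = ∑ j ∈ s, ∑ k ∈ s, ∑ l ∈ s, ∑ m ∈ s, F j k m l :=
    fun F => Finset.sum_congr rfl fun j _ => Finset.sum_congr rfl fun k _ => Finset.sum_comm
  have r2 := s23 (fun j k l m => T j l k m)
  have r3 := (s34 (fun j k l m => T j m k l)).trans (s23 (fun j k l m => T j l k m))
  have r4 := (s12 (fun j k l m => T k l j m)).trans (s23 (fun j k l m => T j l k m))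
  have r5 := ((s34 (fun j k l m => T k m j l)).trans (s12 (fun j k l m => T k l j m))).trans
    (s23 (fun j k l m => T j l k m))
  have r6 := (((s23 (fun j k l m => T l m j k)).trans (s34 (fun j k l m => T k m j l))).trans
    (s12 (fun j k l m => T k l j m))).trans (s23 (fun j k l m => T j l k m))
  rw [r2, r3, r4, r5, r6]
  simp only [hT] at htop ⊢
  linarith

end Discrete

section CauchySchwarz

variable {α : Type*} [MeasurableSpace α] {μ : Measure α}

lemma lintegral_mul_sq_le {f g : α → ℝ≥0∞} (hf : AEMeasurable f μ) (hg : AEMeasurable g μ) :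
    (∫⁻ x, f x * g x ∂μ) ^ 2 ≤ (∫⁻ x, f x ^ 2 ∂μ) * ∫⁻ x, g x ^ 2 ∂μ := by
  have h := ENNReal.lintegral_mul_le_Lp_mul_Lq μ (p := 2) (q := 2)
    (Real.HolderConjugate.two_two) hf hg
  have h2 := pow_le_pow_left' h 2
  refine h2.trans (le_of_eq ?_)
  rw [mul_pow, ← ENNReal.rpow_natCast, ← ENNReal.rpow_natCast, ← ENNReal.rpow_mul,
    ← ENNReal.rpow_mul]
  norm_num

lemma norm_integral_mul_sq_le {f g : α → ℝ} (hf : AEMeasurable f μ) (hg : AEMeasurable g μ) :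
    ‖∫ x, f x * g x ∂μ‖ₑ ^ 2 ≤ (∫⁻ x, ‖f x‖ₑ ^ 2 ∂μ) * ∫⁻ x, ‖g x‖ₑ ^ 2 ∂μ := by
  refine le_trans ?_ (lintegral_mul_sq_le hf.enorm hg.enorm)
  refine pow_le_pow_left' ((enorm_integral_le_lintegral_enorm _).trans (le_of_eq ?_)) 2
  simp_rw [enorm_mul]

end CauchySchwarz

section Trig

/-- Lebesgue measure on the fundamental domain of the circle. -/
abbrev circMeasure : Measure ℝ := volume.restrict circ

/-- The character `x ↦ e^{ikx}`. -/
def ee (k : ℤ) (x : ℝ) : ℂ := Complex.exp (Complex.I * (k : ℂ) * (x : ℂ))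

instance : IsFiniteMeasure circMeasure :=
  ⟨by simp [circ, Real.volume_Ioc]⟩

lemma circMeasure_real_univ : circMeasure.real Set.univ = 2 * π := by
  rw [measureReal_def, Measure.restrict_apply_univ, circ, Real.volume_Ioc,
    ENNReal.toReal_ofReal (by linarith [Real.pi_pos])]
  ring

lemma circMeasure_univ : circMeasure Set.univ = ENNReal.ofReal (2 * π) := by
  rw [Measure.restrict_apply_univ, circ, Real.volume_Ioc]
  congr 1
  ring

lemma ee_mul (j k : ℤ) (x : ℝ) : ee j x * ee k x = ee (j + k) x := by
  simp only [ee, ← Complex.exp_add]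
  congr 1
  push_cast
  ring

@[simp] lemma ee_zero (x : ℝ) : ee 0 x = 1 := by simp [ee]

lemma ee_arg_add (k : ℤ) (x h : ℝ) : ee k (x + h) = ee k x * ee k h := by
  simp only [ee, ← Complex.exp_add]
  congr 1
  push_cast
  ring

@[simp] lemma ee_arg_zero (k : ℤ) : ee k 0 = 1 := by simp [ee]

lemma ee_eq (k : ℤ) (x : ℝ) : ee k x = Real.cos (k * x) + Real.sin (k * x) * Complex.I := by
  simp only [ee]
  rw [show Complex.I * (k : ℂ) * (x : ℂ) = ((k * x : ℝ) : ℂ) * Complex.I by push_cast; ring,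
    Complex.exp_mul_I]
  push_cast
  rfl

@[simp] lemma norm_ee (k : ℤ) (x : ℝ) : ‖ee k x‖ = 1 := by
  simp only [ee]
  rw [show Complex.I * (k : ℂ) * (x : ℂ) = ((k * x : ℝ) : ℂ) * Complex.I by push_cast; ring,
    Complex.norm_exp_ofReal_mul_I]

@[fun_prop] lemma continuous_ee (k : ℤ) : Continuous (ee k) := by
  unfold ee
  fun_prop

@[fun_prop] lemma measurable_ee (k : ℤ) : Measurable (ee k) := (continuous_ee k).measurable

lemma conj_ee (k : ℤ) (x : ℝ) : (starRingEnd ℂ) (ee k x) = ee (-k) x := by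
  simp only [ee, ← Complex.exp_conj]
  congr 1
  simp

lemma ee_periodic (k : ℤ) : Function.Periodic (ee k) (2 * π) := by
  intro x
  simp only [ee]
  rw [show Complex.I * (k : ℂ) * ((x + 2 * π : ℝ) : ℂ)
      = Complex.I * (k : ℂ) * (x : ℂ) + k * (2 * π * Complex.I) by push_cast; ring]
  exact Complex.exp_periodic.int_mul k _

lemma fcR_eq (f : ℝ → ℝ) (k : ℤ) :
    fcR f k = ((1 / (2 * π) : ℝ) : ℂ) * ∫ x in circ, (f x : ℂ) * ee (-k) x := by
  simp only [fcR, fc, ee]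
  congr 2
  ext x
  congr 2
  push_cast
  ring

lemma integral_circ {F : Type*} [NormedAddCommGroup F] [NormedSpace ℝ F] (g : ℝ → F) :
    ∫ x in circ, g x = ∫ x in (-π)..π, g x := by
  rw [intervalIntegral.integral_of_le (by linarith [Real.pi_pos]), circ]

lemma integral_ee (k : ℤ) : ∫ x in circ, ee k x = if k = 0 then (2 * π : ℂ) else 0 := by
  split_ifs with h
  · subst h
    simp only [ee_zero]
    rw [integral_const]
    have := circMeasure_real_univ
    rw [this]
    simp
  · rw [integral_circ]
    unfold ee
    rw [integral_exp_mul_complex (by simpa using h)]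
    have h1 := ee_periodic k (-π)
    simp only [ee] at h1
    rw [show (-π + 2 * π : ℝ) = π by ring] at h1
    rw [h1, sub_self, zero_div]

lemma integrable_of_continuous {F : Type*} [NormedAddCommGroup F] {g : ℝ → F}
    (hg : Continuous g) : Integrable g circMeasure :=
  (hg.integrableOn_Icc (a := -π) (b := π)).mono_set Set.Ioc_subset_Icc_self

lemma integral_shift {F : Type*} [NormedAddCommGroup F] [NormedSpace ℝ F] {g : ℝ → F}
    (hg : Function.Periodic g (2 * π)) (x : ℝ) :
    ∫ y in circ, g y = ∫ h in circ, g (x + h) := by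
  rw [integral_circ, integral_circ, intervalIntegral.integral_comp_add_left]
  have := hg.intervalIntegral_add_eq (-π) (x + -π)
  rw [show -π + 2 * π = π by ring, show x + -π + 2 * π = x + π by ring] at this
  exact this

lemma cd_nonneg (x y : ℝ) : 0 ≤ cd x y := by unfold cd; positivity

lemma cd_comm (x y : ℝ) : cd x y = cd y x := by
  unfold cd
  rw [show (x - y) / 2 = -((y - x) / 2) by ring, Real.sin_neg, abs_neg]

@[fun_prop] lemma continuous_cd : Continuous fun p : ℝ × ℝ => cd p.1 p.2 := by
  unfold cd
  fun_prop

lemma cd_periodic (x : ℝ) : Function.Periodic (fun y => cd x y) (2 * π) := by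
  intro y
  simp only [cd]
  rw [show (x - (y + 2 * π)) / 2 = (x - y) / 2 - π by ring, Real.sin_sub_pi, abs_neg]

lemma cd_shift (x h : ℝ) : cd x (x + h) = cd 0 h := by
  simp [cd]

lemma norm_ee_one_sub (x y : ℝ) : ‖ee 1 x - ee 1 y‖ = cd x y := by
  have h0 : 0 ≤ cd x y := cd_nonneg x y
  rw [← abs_of_nonneg (norm_nonneg (ee 1 x - ee 1 y)), ← abs_of_nonneg h0, ← sq_eq_sq_iff_abs_eq_abs,
    Complex.sq_norm, Complex.normSq_apply, ee_eq, ee_eq]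
  simp only [cd, mul_pow, sq_abs]
  rw [Real.sin_sq_eq_half_sub]
  simp only [Complex.add_re, Complex.sub_re, Complex.add_im, Complex.sub_im, Complex.mul_re,
    Complex.mul_im, Complex.ofReal_re, Complex.ofReal_im, Complex.I_re, Complex.I_im,
    Int.cast_one, one_mul]
  have h1 := Real.cos_sub x y
  rw [show 2 * ((x - y) / 2) = x - y by ring, h1]
  nlinarith [Real.sin_sq_add_cos_sq x, Real.sin_sq_add_cos_sq y]

lemma ee_natCast (n : ℕ) (x : ℝ) : ee n x = ee 1 x ^ n := by
  simp only [ee, ← Complex.exp_nat_mul]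
  congr 1
  push_cast
  ring

lemma norm_ee_neg_sub (k : ℤ) (x y : ℝ) : ‖ee (-k) x - ee (-k) y‖ = ‖ee k x - ee k y‖ := by
  rw [← conj_ee, ← conj_ee, ← map_sub, RCLike.norm_conj]

lemma norm_ee_natAbs_sub (k : ℤ) (x y : ℝ) :
    ‖ee (k.natAbs : ℤ) x - ee (k.natAbs : ℤ) y‖ = ‖ee k x - ee k y‖ := by
  rcases Int.natAbs_eq k with h | h
  · rw [← h]
  · conv_rhs => rw [h]
    rw [norm_ee_neg_sub]

lemma norm_ee_sub_le (k : ℤ) (x y : ℝ) : ‖ee k x - ee k y‖ ≤ k.natAbs * cd x y := by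
  rw [← norm_ee_natAbs_sub]
  generalize k.natAbs = n
  induction n with
  | zero => simp
  | succ n ih =>
    have : ee ((n + 1 : ℕ) : ℤ) x - ee ((n + 1 : ℕ) : ℤ) y
        = (ee (n : ℤ) x - ee (n : ℤ) y) * ee 1 x + ee (n : ℤ) y * (ee 1 x - ee 1 y) := by
      simp only [ee_natCast, pow_succ]
      ring
    rw [this]
    refine (norm_add_le _ _).trans ?_
    rw [norm_mul, norm_mul, norm_ee, norm_ee, norm_ee_one_sub]
    push_cast
    linarith

/-- Finite Parseval identity. -/
lemma integral_norm_sq_sum_ee (s : Finset ℤ) (c : ℤ → ℂ) :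
    ∫ x in circ, ‖∑ k ∈ s, c k * ee k x‖ ^ 2 = 2 * π * ∑ k ∈ s, ‖c k‖ ^ 2 := by
  have h : ((∫ x in circ, ‖∑ k ∈ s, c k * ee k x‖ ^ 2 : ℝ) : ℂ)
      = ((2 * π * ∑ k ∈ s, ‖c k‖ ^ 2 : ℝ) : ℂ) := by
    rw [← integral_complex_ofReal]
    have h1 : ∀ x : ℝ, ((‖∑ k ∈ s, c k * ee k x‖ ^ 2 : ℝ) : ℂ)
        = ∑ j ∈ s, ∑ k ∈ s, c j * (starRingEnd ℂ) (c k) * ee (j - k) x := by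
      intro x
      push_cast
      rw [← Complex.mul_conj', map_sum, Finset.sum_mul_sum]
      refine Finset.sum_congr rfl fun j _ => Finset.sum_congr rfl fun k _ => ?_
      rw [map_mul, conj_ee, sub_eq_add_neg, ← ee_mul]
      ring
    simp_rw [h1]
    rw [integral_finsetSum _ fun j _ => integrable_of_continuous (by fun_prop)]
    have h2 : ∀ j ∈ s, ∫ x in circ, ∑ k ∈ s, c j * (starRingEnd ℂ) (c k) * ee (j - k) x
        = 2 * π * ((‖c j‖ ^ 2 : ℝ) : ℂ) := by
      intro j hj
      rw [integral_finsetSum _ fun k _ => integrable_of_continuous (by fun_prop)]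
      simp_rw [integral_const_mul, integral_ee]
      rw [Finset.sum_eq_single j]
      · rw [if_pos (sub_self j), Complex.mul_conj']
        push_cast
        ring
      · intro k _ hk
        rw [if_neg (by omega), mul_zero]
      · exact fun h => absurd hj h
    rw [Finset.sum_congr rfl h2, ← Finset.mul_sum]
    push_cast
    rfl
  exact_mod_cast h

lemma cd_zero_ne {h : ℝ} (hh : h ∈ circ) (h0 : h ≠ 0) : cd 0 h ≠ 0 := by
  obtain ⟨h1, h2⟩ := hh
  simp only [cd, zero_sub, ne_eq, mul_eq_zero, OfNat.ofNat_ne_zero, abs_eq_zero, false_or]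
  have : -h / 2 = -(h / 2) := by ring
  rw [this, Real.sin_neg, neg_eq_zero]
  intro hs
  rw [Real.sin_eq_zero_iff_of_lt_of_lt (by linarith [Real.pi_pos]) (by linarith [Real.pi_pos])] at hs
  exact h0 (by linarith)

lemma integral_one_sub_ee (k : ℤ) :
    ∫ h in circ, ‖ee k 0 - ee k h‖ ^ 2 / cd 0 h ^ 2 = 2 * π * k.natAbs := by
  simp_rw [← norm_ee_natAbs_sub k]
  generalize k.natAbs = n
  have hae : (fun h => ‖ee (n : ℤ) 0 - ee (n : ℤ) h‖ ^ 2 / cd 0 h ^ 2)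
      =ᵐ[circMeasure] fun h => ‖∑ k ∈ Finset.Ico (0 : ℤ) n, (1 : ℂ) * ee k h‖ ^ 2 := by
    have h0 : ∀ᵐ h ∂circMeasure, h ≠ 0 := ae_restrict_of_ae (Measure.ae_ne volume 0)
    filter_upwards [h0, ae_restrict_mem measurableSet_Ioc] with h hh hc
    have hcd := cd_zero_ne hc hh
    rw [div_eq_iff (pow_ne_zero 2 hcd), ← norm_ee_one_sub, ← mul_pow, ← norm_mul]
    congr 2
    have : ∑ k ∈ Finset.Ico (0 : ℤ) n, (1 : ℂ) * ee k h = ∑ l ∈ Finset.range n, ee 1 h ^ l := by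
      simp_rw [one_mul]
      refine (Finset.sum_bij (fun (l : ℕ) _ => (l : ℤ)) ?_ ?_ ?_ ?_).symm
      · intro l hl
        simpa using hl
      · intro a _ b _ hab
        exact_mod_cast hab
      · intro b hb
        rw [Finset.mem_Ico] at hb
        exact ⟨b.toNat, by rw [Finset.mem_range]; omega, by omega⟩
      · intro l _
        rw [ee_natCast]
    rw [this, ee_arg_zero, ee_arg_zero, geom_sum_mul_neg, ee_natCast]
  rw [integral_congr_ae hae, integral_norm_sq_sum_ee]
  simp

/-- `∫ (1 - e^{ijh}) (1 - e^{ikh}) / |h|² dh`. -/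
def kerA (j k : ℤ) : ℂ :=
  ∫ h in circ, (ee j 0 - ee j h) * (ee k 0 - ee k h) / ((cd 0 h ^ 2 : ℝ) : ℂ)

lemma norm_ee_sub_div_le (k : ℤ) (x y : ℝ) : ‖ee k x - ee k y‖ / cd x y ≤ k.natAbs := by
  rcases (cd_nonneg x y).eq_or_lt with h | h
  · rw [← h]; simp
  · rw [div_le_iff₀ h]; exact norm_ee_sub_le k x y

lemma memLp_ee_sub_div (k : ℤ) :
    MemLp (fun h => ‖ee k 0 - ee k h‖ / cd 0 h) 2 circMeasure := by
  refine MemLp.of_bound (C := k.natAbs) ?_ ?_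
  · refine Measurable.aestronglyMeasurable ?_
    unfold cd
    fun_prop
  · refine ae_of_all _ fun h => ?_
    rw [Real.norm_of_nonneg (div_nonneg (norm_nonneg _) (cd_nonneg _ _))]
    exact norm_ee_sub_div_le k 0 h

lemma norm_kerA_le (j k : ℤ) :
    ‖kerA j k‖ ≤ √(2 * π * j.natAbs) * √(2 * π * k.natAbs) := by
  have hval : ∀ k : ℤ, ∫ h in circ, ‖(‖ee k 0 - ee k h‖ / cd 0 h)‖ ^ 2 = 2 * π * k.natAbs := by
    intro k
    rw [← integral_one_sub_ee]
    congr 1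
    ext h
    rw [Real.norm_eq_abs, sq_abs, div_pow]
  have h1 : ‖kerA j k‖ ≤ ∫ h in circ, ‖(‖ee j 0 - ee j h‖ / cd 0 h)‖ * ‖(‖ee k 0 - ee k h‖ / cd 0 h)‖ := by
    refine (norm_integral_le_integral_norm _).trans (le_of_eq ?_)
    congr 1
    ext h
    rw [norm_div, norm_mul, Complex.norm_real, norm_div, norm_div, norm_norm, norm_norm, norm_pow]
    ring
  refine h1.trans ?_
  have h2 := integral_mul_norm_le_Lp_mul_Lq (μ := circMeasure) Real.HolderConjugate.two_two
    (f := fun h => ‖ee j 0 - ee j h‖ / cd 0 h) (g := fun h => ‖ee k 0 - ee k h‖ / cd 0 h)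
    (by simpa using memLp_ee_sub_div j) (by simpa using memLp_ee_sub_div k)
  refine h2.trans (le_of_eq ?_)
  rw [Real.sqrt_eq_rpow, Real.sqrt_eq_rpow]
  simp_rw [Real.rpow_two]
  rw [hval, hval]

lemma measurable_cd_right (x : ℝ) : Measurable (cd x) :=
  (continuous_cd.comp (Continuous.prodMk_right x)).measurable

lemma integrable_ee_sub_mul (j k : ℤ) (x : ℝ) :
    Integrable (fun y => (ee j x - ee j y) * (ee k x - ee k y) / ((cd x y ^ 2 : ℝ) : ℂ))
      circMeasure := by
  refine Integrable.of_bound (C := j.natAbs * k.natAbs) ?_ ?_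
  · refine Measurable.aestronglyMeasurable ?_
    have := measurable_cd_right x
    fun_prop
  · refine ae_of_all _ fun y => ?_
    rw [norm_div, norm_mul, Complex.norm_real, norm_pow, Real.norm_of_nonneg (cd_nonneg x y), sq,
      mul_div_mul_comm]
    gcongr
    · exact div_nonneg (norm_nonneg _) (cd_nonneg _ _)
    · exact norm_ee_sub_div_le j x y
    · exact norm_ee_sub_div_le k x y

lemma integral_ee_sub_mul (j k : ℤ) (x : ℝ) :
    ∫ y in circ, (ee j x - ee j y) * (ee k x - ee k y) / ((cd x y ^ 2 : ℝ) : ℂ)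
      = ee (j + k) x * kerA j k := by
  rw [integral_shift (x := x), kerA, ← integral_const_mul]
  · congr 1
    ext h
    rw [cd_shift, ee_arg_add, ee_arg_add, ← ee_mul, ee_arg_zero, ee_arg_zero]
    ring
  · intro y
    have h1 := ee_periodic j y
    have h2 := ee_periodic k y
    have h3 := cd_periodic x y
    simp only at h3
    simp only [h1, h2, h3]

end Trig

section Fourier

/-- Bounded measurable `2π`-periodic functions. -/
structure BddPer (f : ℝ → ℝ) : Prop where
  meas : Measurable f
  per : Function.Periodic f (2 * π)
  bdd : ∃ C : ℝ, ∀ x, |f x| ≤ C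

lemma BddPer.integrable {f : ℝ → ℝ} (hf : BddPer f) : Integrable f circMeasure := by
  obtain ⟨C, hC⟩ := hf.bdd
  exact Integrable.of_bound hf.meas.aestronglyMeasurable C (ae_of_all _ hC)

lemma BddPer.add {f g : ℝ → ℝ} (hf : BddPer f) (hg : BddPer g) : BddPer (fun x => f x + g x) := by
  obtain ⟨C, hC⟩ := hf.bdd
  obtain ⟨D, hD⟩ := hg.bdd
  exact ⟨hf.meas.add hg.meas, fun x => by simp only [hf.per x, hg.per x],
    C + D, fun x => (abs_add_le _ _).trans (add_le_add (hC x) (hD x))⟩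

lemma BddPer.sub {f g : ℝ → ℝ} (hf : BddPer f) (hg : BddPer g) : BddPer (fun x => f x - g x) := by
  obtain ⟨C, hC⟩ := hf.bdd
  obtain ⟨D, hD⟩ := hg.bdd
  exact ⟨hf.meas.sub hg.meas, fun x => by simp only [hf.per x, hg.per x],
    C + D, fun x => (abs_sub _ _).trans (add_le_add (hC x) (hD x))⟩

lemma BddPer.mul {f g : ℝ → ℝ} (hf : BddPer f) (hg : BddPer g) : BddPer (fun x => f x * g x) := by
  obtain ⟨C, hC⟩ := hf.bdd
  obtain ⟨D, hD⟩ := hg.bdd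
  refine ⟨hf.meas.mul hg.meas, fun x => by simp only [hf.per x, hg.per x], C * D, fun x => ?_⟩
  rw [abs_mul]
  exact mul_le_mul (hC x) (hD x) (abs_nonneg _) ((abs_nonneg _).trans (hC x))

lemma integrable_mul_ee {f : ℝ → ℝ} (hf : Integrable f circMeasure) (k : ℤ) :
    Integrable (fun x => (f x : ℂ) * ee k x) circMeasure :=
  hf.ofReal.mul_bdd (c := 1) (measurable_ee k).aestronglyMeasurable
    (ae_of_all _ fun x => (norm_ee k x).le)

lemma fcR_add {f g : ℝ → ℝ} (hf : Integrable f circMeasure) (hg : Integrable g circMeasure)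
    (k : ℤ) : fcR (fun x => f x + g x) k = fcR f k + fcR g k := by
  simp only [fcR_eq]
  rw [← mul_add, ← integral_add (integrable_mul_ee hf _) (integrable_mul_ee hg _)]
  congr 2
  ext x
  push_cast
  ring

lemma fcR_sub {f g : ℝ → ℝ} (hf : Integrable f circMeasure) (hg : Integrable g circMeasure)
    (k : ℤ) : fcR (fun x => f x - g x) k = fcR f k - fcR g k := by
  simp only [fcR_eq]
  rw [← mul_sub, ← integral_sub (integrable_mul_ee hf _) (integrable_mul_ee hg _)]
  congr 2
  ext x
  push_cast
  ring

lemma fcR_congr {f g : ℝ → ℝ} (h : f =ᵐ[circMeasure] g) (k : ℤ) : fcR f k = fcR g k := by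
  simp only [fcR_eq]
  congr 1
  refine integral_congr_ae ?_
  filter_upwards [h] with x hx
  rw [hx]

lemma fcR_shift {f : ℝ → ℝ} (hf : Function.Periodic f (2 * π)) (h : ℝ) (k : ℤ) :
    fcR (fun x => f (h + x)) k = ee k h * fcR f k := by
  simp only [fcR_eq]
  rw [integral_shift (x := h) (g := fun x => (f x : ℂ) * ee (-k) x) fun x => by
    simp only [hf x, ee_periodic (-k) x]]
  rw [mul_left_comm, ← integral_const_mul (ee k h)]
  congr 1
  refine integral_congr_ae (ae_of_all _ fun x => ?_)
  simp only
  rw [ee_arg_add, mul_left_comm, ← mul_assoc (ee k h), ee_mul, add_neg_cancel, ee_zero, one_mul]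

/-- Hermitian symmetry of a sequence of Fourier coefficients. -/
def Herm (c : ℤ → ℂ) : Prop := ∀ k, c (-k) = (starRingEnd ℂ) (c k)

lemma herm_fcR (f : ℝ → ℝ) : Herm (fcR f) := by
  intro k
  simp only [fcR_eq]
  rw [map_mul, Complex.conj_ofReal, ← integral_conj]
  simp_rw [map_mul, Complex.conj_ofReal, conj_ee]

lemma Herm.mul_real {c : ℤ → ℂ} (hc : Herm c) {m : ℤ → ℝ} (hm : ∀ k, m (-k) = m k) :
    Herm fun k => (m k : ℂ) * c k := by
  intro k
  simp only [hm k, hc k, map_mul, Complex.conj_ofReal]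

/-- The real trigonometric polynomial with coefficients `c k`, `|k| ≤ K`. -/
def trg (K : ℕ) (c : ℤ → ℂ) (x : ℝ) : ℝ := (∑ k ∈ Finset.Icc (-(K : ℤ)) K, c k * ee k x).re

lemma sum_Icc_neg {M : Type*} [AddCommMonoid M] (K : ℕ) (g : ℤ → M) :
    ∑ k ∈ Finset.Icc (-(K : ℤ)) K, g (-k) = ∑ k ∈ Finset.Icc (-(K : ℤ)) K, g k := by
  refine Finset.sum_nbij' (fun k => -k) (fun k => -k) ?_ ?_ ?_ ?_ ?_ <;>
    simp only [Finset.mem_Icc, neg_neg, implies_true] <;> intro k hk <;> omega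

lemma trg_ofReal {c : ℤ → ℂ} (hc : Herm c) (K : ℕ) (x : ℝ) :
    (trg K c x : ℂ) = ∑ k ∈ Finset.Icc (-(K : ℤ)) K, c k * ee k x := by
  rw [trg]
  refine Complex.conj_eq_iff_re.1 ?_
  rw [map_sum, ← sum_Icc_neg]
  refine Finset.sum_congr rfl fun k _ => ?_
  rw [map_mul, conj_ee, ← hc, neg_neg]

lemma continuous_trg (K : ℕ) (c : ℤ → ℂ) : Continuous (trg K c) := by
  unfold trg
  fun_prop

lemma bddPer_trg (K : ℕ) (c : ℤ → ℂ) : BddPer (trg K c) := by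
  refine ⟨(continuous_trg K c).measurable, fun x => ?_,
    ∑ k ∈ Finset.Icc (-(K : ℤ)) K, ‖c k‖, fun x => ?_⟩
  · simp only [trg, ee_periodic _ x]
  · refine (Complex.abs_re_le_norm _).trans ((norm_sum_le _ _).trans (le_of_eq ?_))
    simp

lemma fcR_trg {c : ℤ → ℂ} (hc : Herm c) (K : ℕ) (k : ℤ) :
    fcR (trg K c) k = if k ∈ Finset.Icc (-(K : ℤ)) K then c k else 0 := by
  rw [fcR_eq]
  simp_rw [trg_ofReal hc, Finset.sum_mul, mul_assoc, ee_mul]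
  rw [integral_finsetSum _ fun j _ => integrable_of_continuous (by fun_prop)]
  simp_rw [integral_const_mul, integral_ee]
  have hpi : (π : ℂ) ≠ 0 := by exact_mod_cast Real.pi_ne_zero
  have : ∀ j : ℤ, (c j * if j + -k = 0 then (2 * π : ℂ) else 0)
      = if j = k then c k * (2 * π) else 0 := by
    intro j
    by_cases h : j = k
    · subst h; simp
    · rw [if_neg h, if_neg (by omega), mul_zero]
  simp_rw [this]
  rw [Finset.sum_ite_eq']
  split_ifs
  · push_cast
    field_simp
  · simp

lemma fourierCoeffOn_eq_fcR (f : ℝ → ℝ) (k : ℤ) :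
    fourierCoeffOn (show -π < π by linarith [Real.pi_pos]) (fun x => (f x : ℂ)) k = fcR f k := by
  rw [fourierCoeffOn_eq_integral, fcR_eq, integral_circ, Complex.real_smul]
  congr 1
  · congr 2
    ring
  · refine intervalIntegral.integral_congr fun x _ => ?_
    simp only [fourier_coe_apply, ee, smul_eq_mul]
    rw [mul_comm]
    congr 2
    have : (π : ℂ) ≠ 0 := by exact_mod_cast Real.pi_ne_zero
    push_cast
    field_simp
    ring

lemma BddPer.memLp {f : ℝ → ℝ} (hf : BddPer f) (p : ℝ≥0∞) : MemLp f p circMeasure := by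
  obtain ⟨C, hC⟩ := hf.bdd
  exact MemLp.of_bound hf.meas.aestronglyMeasurable C (ae_of_all _ hC)

lemma hasSum_norm_fcR_sq {f : ℝ → ℝ} (hf : BddPer f) :
    HasSum (fun k => ‖fcR f k‖ ^ 2) ((2 * π)⁻¹ * ∫ x in circ, f x ^ 2) := by
  have h := hasSum_sq_fourierCoeffOn (show -π < π by linarith [Real.pi_pos])
    (f := fun x => (f x : ℂ)) (hf.memLp 2).ofReal
  simp_rw [fourierCoeffOn_eq_fcR] at h
  convert h using 1
  rw [smul_eq_mul, integral_circ]
  congr 2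
  · ring
  · ext x
    simp

lemma lintegral_enorm_sq_eq {f : ℝ → ℝ} (hf : BddPer f) :
    ∫⁻ x in circ, ‖f x‖ₑ ^ 2 = ENNReal.ofReal (2 * π) * ∑' k, ‖fcR f k‖ₑ ^ 2 := by
  have h := hasSum_norm_fcR_sq hf
  have h1 : ∀ k, ‖fcR f k‖ₑ ^ 2 = ENNReal.ofReal (‖fcR f k‖ ^ 2) := fun k => by
    rw [ENNReal.ofReal_pow (norm_nonneg _), ofReal_norm]
  simp_rw [h1]
  rw [← ENNReal.ofReal_tsum_of_nonneg (fun k => sq_nonneg _) h.summable, h.tsum_eq,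
    ← ENNReal.ofReal_mul (by positivity), mul_inv_cancel_left₀ (by positivity),
    ofReal_integral_eq_lintegral_ofReal]
  · refine lintegral_congr fun x => ?_
    rw [← sq_abs, ENNReal.ofReal_pow (abs_nonneg _), ← Real.norm_eq_abs, ofReal_norm]
  · have := (hf.mul hf).integrable
    simpa only [sq] using this
  · exact ae_of_all _ fun x => sq_nonneg _

end Fourier

section Fejer

/-- Multiplier of the `N`-th Fejér mean. -/
def fejerMul (N : ℕ) (k : ℤ) : ℝ :=
  (((Finset.range N ×ˢ Finset.range N).filter fun p => (p.1 : ℤ) - p.2 = k).card : ℝ) / N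

lemma fejerMul_neg (N : ℕ) (k : ℤ) : fejerMul N (-k) = fejerMul N k := by
  simp only [fejerMul]
  congr 2
  refine Finset.card_nbij' Prod.swap Prod.swap ?_ ?_ ?_ ?_
  · intro p hp
    simp only [Finset.mem_product, Finset.mem_range, Prod.fst_swap,
      Prod.snd_swap, Finset.coe_filter, Set.mem_ofPred_eq] at hp ⊢
    omega
  · intro p hp
    simp only [Finset.mem_product, Finset.mem_range, Prod.fst_swap,
      Prod.snd_swap, Finset.coe_filter, Set.mem_ofPred_eq] at hp ⊢
    omega
  · intro p _; simp
  · intro p _; simp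

lemma fejerMul_nonneg (N : ℕ) (k : ℤ) : 0 ≤ fejerMul N k := by
  unfold fejerMul
  positivity

lemma fejerMul_le_one (N : ℕ) (k : ℤ) : fejerMul N k ≤ 1 := by
  refine div_le_one_of_le₀ ?_ (Nat.cast_nonneg _)
  refine Nat.cast_le.2 ((Finset.card_le_card_of_injOn Prod.fst (t := Finset.range N) ?_ ?_).trans
    (Finset.card_range N).le)
  · intro p hp
    simp only [Finset.coe_filter, Finset.mem_product, Set.mem_ofPred_eq] at hp
    exact hp.1.1
  · rintro ⟨a, b⟩ hp ⟨c, d⟩ hq h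
    simp only [Finset.coe_filter, Finset.mem_product, Set.mem_ofPred_eq] at hp hq h
    ext <;> simp <;> omega

lemma le_fejerMul {N : ℕ} (hN : 0 < N) (k : ℤ) : 1 - (k.natAbs : ℝ) / N ≤ fejerMul N k := by
  wlog hk : 0 ≤ k with H
  · have := H hN (-k) (by omega)
    rwa [Int.natAbs_neg, fejerMul_neg] at this
  have hN' : (0 : ℝ) < N := by exact_mod_cast hN
  rw [fejerMul, le_div_iff₀ hN', sub_mul, one_mul, div_mul_cancel₀ _ hN'.ne']
  have : N - k.natAbs ≤ ((Finset.range N ×ˢ Finset.range N).filter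
      fun p => (p.1 : ℤ) - p.2 = k).card := by
    conv_lhs => rw [← Finset.card_range (N - k.natAbs)]
    refine Finset.card_le_card_of_injOn (fun j => (j + k.natAbs, j)) ?_ ?_
    · intro j hj
      simp only [Finset.coe_range, Set.mem_Iio, Finset.coe_filter, Finset.mem_product,
        Finset.mem_range, Set.mem_ofPred_eq] at hj ⊢
      omega
    · intro a _ b _ h
      simpa using congrArg Prod.snd h
  have h2 : N ≤ ((Finset.range N ×ˢ Finset.range N).filter
      fun p => (p.1 : ℤ) - p.2 = k).card + k.natAbs := by omega
  have h3 : (N : ℝ) ≤ (((Finset.range N ×ˢ Finset.range N).filter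
      fun p => (p.1 : ℤ) - p.2 = k).card : ℝ) + k.natAbs := by exact_mod_cast h2
  linarith

lemma tendsto_fejerMul (k : ℤ) : Tendsto (fun N => fejerMul N k) atTop (𝓝 1) := by
  refine tendsto_of_tendsto_of_tendsto_of_le_of_le' (g := fun N : ℕ => 1 - (k.natAbs : ℝ) / N)
    ?_ tendsto_const_nhds ((eventually_gt_atTop 0).mono fun N hN => le_fejerMul hN k)
    (Eventually.of_forall fun N => fejerMul_le_one N k)
  simpa using tendsto_const_nhds.sub (tendsto_const_div_atTop_nhds_zero_nat (k.natAbs : ℝ))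

/-- The `N`-th Fejér mean. -/
def fejer (N : ℕ) (f : ℝ → ℝ) : ℝ → ℝ := trg N fun k => (fejerMul N k : ℂ) * fcR f k

lemma herm_fejer (N : ℕ) (f : ℝ → ℝ) : Herm fun k => (fejerMul N k : ℂ) * fcR f k :=
  (herm_fcR f).mul_real (fejerMul_neg N)

lemma fcR_fejer (N : ℕ) (f : ℝ → ℝ) (k : ℤ) :
    fcR (fejer N f) k = (fejerMul N k : ℂ) * fcR f k := by
  rw [fejer, fcR_trg (herm_fejer N f)]
  split_ifs with h
  · rfl
  · have : fejerMul N k = 0 := by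
      rw [fejerMul, Finset.card_eq_zero.2, Nat.cast_zero, zero_div]
      rw [Finset.filter_eq_empty_iff]
      intro p hp
      simp only [Finset.mem_product, Finset.mem_range] at hp
      rw [Finset.mem_Icc] at h
      omega
    rw [this]
    simp

lemma bddPer_fejer (N : ℕ) (f : ℝ → ℝ) : BddPer (fejer N f) := bddPer_trg _ _

lemma fejer_ofReal {f : ℝ → ℝ} (hf : BddPer f) (N : ℕ) (x : ℝ) :
    (fejer N f x : ℂ) = ((1 / (2 * π * N) *
      ∫ y in circ, f y * ‖∑ j ∈ Finset.range N, ee j x * ee (-j) y‖ ^ 2 : ℝ) : ℂ) := by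
  rw [fejer, trg_ofReal (herm_fejer N f)]
  have h1 : ∀ k : ℤ, (fejerMul N k : ℂ) * fcR f k * ee k x
      = (1 / (N : ℂ)) * ∑ p ∈ (Finset.range N ×ˢ Finset.range N).filter
        (fun p => (p.1 : ℤ) - p.2 = k), fcR f (p.1 - p.2) * ee (p.1 - p.2) x := by
    intro k
    rw [Finset.sum_congr rfl (g := fun _ => fcR f k * ee k x)
      (fun p hp => by rw [(Finset.mem_filter.1 hp).2]), Finset.sum_const, fejerMul]
    rw [nsmul_eq_mul]
    push_cast
    ring
  simp_rw [h1]
  rw [← Finset.mul_sum, Finset.sum_fiberwise_of_maps_to (s := Finset.range N ×ˢ Finset.range N)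
    (t := Finset.Icc (-(N : ℤ)) N) (g := fun p => (p.1 : ℤ) - p.2)
    (f := fun p => fcR f (p.1 - p.2) * ee (p.1 - p.2) x)]
  swap
  · intro p hp
    simp only [Finset.mem_product, Finset.mem_range] at hp
    rw [Finset.mem_Icc]
    omega
  have h2 : ∀ y : ℝ, ((f y * ‖∑ j ∈ Finset.range N, ee j x * ee (-j) y‖ ^ 2 : ℝ) : ℂ)
      = ∑ p ∈ Finset.range N ×ˢ Finset.range N,
        ((f y : ℂ) * ee (-(p.1 - p.2)) y) * ee (p.1 - p.2) x := by
    intro y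
    push_cast
    rw [← Complex.mul_conj', map_sum, Finset.sum_mul_sum, Finset.sum_product, Finset.mul_sum]
    refine Finset.sum_congr rfl fun j _ => ?_
    rw [Finset.mul_sum]
    refine Finset.sum_congr rfl fun l _ => ?_
    rw [map_mul, conj_ee, conj_ee, sub_eq_add_neg, ← ee_mul, neg_add, ← ee_mul]
    ring
  rw [Complex.ofReal_mul, ← integral_complex_ofReal]
  simp_rw [h2]
  rw [integral_finsetSum _ fun p _ => (integrable_mul_ee hf.integrable _).mul_const _]
  simp_rw [integral_mul_const, fcR_eq]
  rw [Finset.mul_sum, Finset.mul_sum]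
  refine Finset.sum_congr rfl fun p _ => ?_
  push_cast
  ring

lemma abs_fejer_le {f : ℝ → ℝ} (hf : BddPer f) {C : ℝ} (hC : ∀ x, |f x| ≤ C) (N : ℕ) (x : ℝ) :
    |fejer N f x| ≤ C := by
  have hC0 : 0 ≤ C := (abs_nonneg _).trans (hC 0)
  have h1 : fejer N f x = 1 / (2 * π * N) *
      ∫ y in circ, f y * ‖∑ j ∈ Finset.range N, ee j x * ee (-j) y‖ ^ 2 := by
    exact_mod_cast fejer_ofReal hf N x
  have h2 : ∫ y in circ, ‖∑ j ∈ Finset.range N, ee j x * ee (-j) y‖ ^ 2 = 2 * π * N := by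
    have := integral_norm_sq_sum_ee (Finset.Ioc (-N : ℤ) 0) (fun k => ee (-k) x)
    have h3 : ∀ y : ℝ, ∑ j ∈ Finset.range N, ee j x * ee (-j) y
        = ∑ k ∈ Finset.Ioc (-N : ℤ) 0, ee (-k) x * ee k y := by
      intro y
      refine Finset.sum_bij (fun (l : ℕ) _ => -(l : ℤ)) ?_ ?_ ?_ ?_
      · intro l hl
        rw [Finset.mem_range] at hl
        rw [Finset.mem_Ioc]
        omega
      · intro a _ b _ hab
        omega
      · intro b hb
        rw [Finset.mem_Ioc] at hb
        exact ⟨(-b).toNat, by rw [Finset.mem_range]; omega, by omega⟩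
      · intro l _
        rw [neg_neg]
    simp_rw [h3]
    rw [this]
    simp
  rcases Nat.eq_zero_or_pos N with rfl | hN
  · rw [h1]; simpa using hC0
  rw [h1, abs_mul, abs_of_nonneg (by positivity : (0 : ℝ) ≤ 1 / (2 * π * N)), div_mul_eq_mul_div,
    one_mul, div_le_iff₀ (by positivity), ← h2, ← integral_const_mul]
  refine (abs_integral_le_integral_abs).trans ?_
  have hc : Continuous fun y => ‖∑ j ∈ Finset.range N, ee j x * ee (-j) y‖ ^ 2 := by fun_prop
  refine integral_mono_of_nonneg (ae_of_all _ fun y => abs_nonneg _)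
    ((integrable_of_continuous hc).const_mul C) (ae_of_all _ fun y => ?_)
  simp only [abs_mul, abs_of_nonneg (sq_nonneg ‖∑ j ∈ Finset.range N, ee j x * ee (-j) y‖)]
  exact mul_le_mul_of_nonneg_right (hC y) (sq_nonneg _)

/-- A subsequence of the Fejér means converges almost everywhere. -/
lemma exists_fejer_tendsto_ae {f : ℝ → ℝ} (hf : BddPer f) :
    ∃ ns : ℕ → ℕ, StrictMono ns ∧
      ∀ᵐ x ∂circMeasure, Tendsto (fun j => fejer (ns j) f x) atTop (𝓝 (f x)) := by
  suffices h : TendstoInMeasure circMeasure (fun N => fejer N f) atTop f from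
    h.exists_seq_tendsto_ae
  refine tendstoInMeasure_of_tendsto_eLpNorm (p := 2) two_ne_zero
    (fun N => (bddPer_fejer N f).meas.aestronglyMeasurable) hf.meas.aestronglyMeasurable ?_
  have h1 : ∀ N, eLpNorm (fejer N f - f) 2 circMeasure
      = (ENNReal.ofReal (2 * π * ∑' k, (1 - fejerMul N k) ^ 2 * ‖fcR f k‖ ^ 2)) ^ (1 / 2 : ℝ) := by
    intro N
    rw [eLpNorm_eq_lintegral_rpow_enorm_toReal two_ne_zero ENNReal.ofNat_ne_top]
    simp only [ENNReal.toReal_ofNat, ENNReal.rpow_two, Pi.sub_apply]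
    have hb := (bddPer_fejer N f).sub hf
    rw [lintegral_enorm_sq_eq hb, ENNReal.ofReal_mul (p := 2 * π) (by positivity),
      ENNReal.ofReal_tsum_of_nonneg (fun k => by positivity)]
    · congr 3
      ext k
      rw [fcR_sub (bddPer_fejer N f).integrable hf.integrable, fcR_fejer, ← sub_one_mul,
        enorm_mul, mul_pow, ENNReal.ofReal_mul (sq_nonneg _), ENNReal.ofReal_pow (norm_nonneg _),
        ofReal_norm]
      congr 1
      rw [← sq_abs, ENNReal.ofReal_pow (abs_nonneg _), ← abs_neg, ← Real.norm_eq_abs,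
        ← ofReal_norm, ← Complex.norm_real]
      push_cast
      rw [neg_sub]
    · refine Summable.of_nonneg_of_le (fun k => by positivity) (fun k => ?_)
        (hasSum_norm_fcR_sq hf).summable
      refine mul_le_of_le_one_left (sq_nonneg _) ?_
      have := fejerMul_nonneg N k
      have := fejerMul_le_one N k
      nlinarith
  simp_rw [h1]
  have h2 : Tendsto (fun N => ∑' k, (1 - fejerMul N k) ^ 2 * ‖fcR f k‖ ^ 2) atTop
      (𝓝 (∑' k : ℤ, (0 : ℝ))) := by
    refine tendsto_tsum_of_dominated_convergence (hasSum_norm_fcR_sq hf).summable (fun k => ?_)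
      (Eventually.of_forall fun N k => ?_)
    · have := ((tendsto_const_nhds (x := (1 : ℝ))).sub (tendsto_fejerMul k)).pow 2
      simpa using this.mul_const (‖fcR f k‖ ^ 2)
    · rw [Real.norm_of_nonneg (by positivity)]
      refine mul_le_of_le_one_left (sq_nonneg _) ?_
      have := fejerMul_nonneg N k
      have := fejerMul_le_one N k
      nlinarith
  rw [tsum_zero] at h2
  have h3 := (ENNReal.tendsto_ofReal (h2.const_mul (2 * π))).ennrpow_const (1 / 2 : ℝ)
  simpa using h3

end Fejer

section Kernel

/-- The density `1/|x-y|²`. -/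
def kapD (p : ℝ × ℝ) : ℝ≥0∞ := ENNReal.ofReal (1 / cd p.1 p.2 ^ 2)

/-- The measure `dx dy / |x-y|²` on the torus. -/
def kap : Measure (ℝ × ℝ) := (circMeasure.prod circMeasure).withDensity kapD

lemma measurable_kapD : Measurable kapD := by
  have := continuous_cd.measurable
  unfold kapD
  fun_prop

lemma kapD_swap (p : ℝ × ℝ) : kapD p.swap = kapD p := by
  simp only [kapD, Prod.fst_swap, Prod.snd_swap, cd_comm]

lemma lintegral_kap' {F : ℝ × ℝ → ℝ≥0∞} (hF : Measurable F) :
    ∫⁻ p, F p ∂kap = ∫⁻ p, kapD p * F p ∂(circMeasure.prod circMeasure) := by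
  rw [kap, lintegral_withDensity_eq_lintegral_mul _ measurable_kapD hF]
  rfl

lemma lintegral_kap {F : ℝ × ℝ → ℝ≥0∞} (hF : Measurable F) :
    ∫⁻ p, F p ∂kap = ∫⁻ x in circ, ∫⁻ y in circ, kapD (x, y) * F (x, y) := by
  rw [lintegral_kap' hF]
  exact lintegral_prod _ (measurable_kapD.mul hF).aemeasurable

lemma measurePreserving_swap_kap : MeasurePreserving Prod.swap kap kap := by
  refine ⟨measurable_swap, Measure.ext_of_lintegral _ fun F hF => ?_⟩
  rw [lintegral_map hF measurable_swap,
    lintegral_kap' (F := fun p => F p.swap) (hF.comp measurable_swap), lintegral_kap' hF, ← lintegral_prod_swap]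
  simp_rw [kapD_swap, Prod.swap_swap]

lemma lintegral_kap_swap {F : ℝ × ℝ → ℝ≥0∞} (hF : Measurable F) :
    ∫⁻ p, F p.swap ∂kap = ∫⁻ p, F p ∂kap :=
  measurePreserving_swap_kap.lintegral_comp hF

lemma integral_kap_swap (F : ℝ × ℝ → ℝ) : ∫ p, F p.swap ∂kap = ∫ p, F p ∂kap :=
  measurePreserving_swap_kap.integral_comp MeasurableEquiv.prodComm.measurableEmbedding F

lemma kapD_lt_top (p : ℝ × ℝ) : kapD p < ⊤ := ENNReal.ofReal_lt_top

lemma kapD_toReal (p : ℝ × ℝ) : (kapD p).toReal = 1 / cd p.1 p.2 ^ 2 :=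
  ENNReal.toReal_ofReal (by positivity)

lemma integrable_kap_iff {F : ℝ × ℝ → ℝ} :
    Integrable F kap ↔ Integrable (fun p => F p / cd p.1 p.2 ^ 2) (circMeasure.prod circMeasure) := by
  rw [kap, integrable_withDensity_iff_integrable_smul' measurable_kapD
    (ae_of_all _ kapD_lt_top)]
  simp_rw [kapD_toReal, smul_eq_mul, one_div_mul_eq_div]

lemma integral_kap {F : ℝ × ℝ → ℝ} (hF : Integrable F kap) :
    ∫ p, F p ∂kap = ∫ x in circ, ∫ y in circ, F (x, y) / cd x y ^ 2 := by
  rw [kap, integral_withDensity_eq_integral_toReal_smul measurable_kapD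
    (ae_of_all _ kapD_lt_top)]
  simp_rw [kapD_toReal, smul_eq_mul, one_div_mul_eq_div]
  rw [integral_prod _ (integrable_kap_iff.1 hF)]

lemma ae_kap_of_ae {p : ℝ → Prop} (h : ∀ᵐ x ∂circMeasure, p x) : ∀ᵐ q ∂kap, p q.1 ∧ p q.2 := by
  refine (withDensity_absolutelyContinuous _ _).ae_le ?_
  exact (Measure.quasiMeasurePreserving_fst.ae h).and (Measure.quasiMeasurePreserving_snd.ae h)

lemma lintegral_shift {g : ℝ → ℝ≥0∞} (hg : Function.Periodic g (2 * π)) (x : ℝ) :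
    ∫⁻ y in circ, g y = ∫⁻ h in circ, g (x + h) := by
  have h1 := (measurePreserving_add_left volume x).setLIntegral_comp_preimage_emb
    (measurableEmbedding_addLeft x) g (Set.Ioc (x - π) (x + π))
  have h2 : (fun h => x + h) ⁻¹' Set.Ioc (x - π) (x + π) = circ := by
    ext h
    simp only [Set.mem_preimage, Set.mem_Ioc, circ]
    constructor <;> rintro ⟨a, b⟩ <;> constructor <;> linarith
  rw [h2] at h1
  rw [h1]
  have h3 := isAddFundamentalDomain_Ioc Real.two_pi_pos (-π)
  have h4 := isAddFundamentalDomain_Ioc Real.two_pi_pos (x - π)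
  rw [show -π + 2 * π = π by ring] at h3
  rw [show x - π + 2 * π = x + π by ring] at h4
  refine h3.setLIntegral_eq h4 g ?_
  rintro ⟨_, n, rfl⟩ y
  have := hg.int_mul n y
  rw [add_comm] at this
  simpa [AddSubgroup.vadd_def, zsmul_eq_mul] using this

lemma lintegral_one_sub_ee (k : ℤ) :
    ∫⁻ h in circ, kapD (0, h) * ‖1 - ee k h‖ₑ ^ 2 = ENNReal.ofReal (2 * π * k.natAbs) := by
  rw [← integral_one_sub_ee, ofReal_integral_eq_lintegral_ofReal]
  · refine lintegral_congr fun h => ?_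
    rw [kapD, ← ofReal_norm, ← ENNReal.ofReal_pow (norm_nonneg _),
      ← ENNReal.ofReal_mul (by positivity), ee_arg_zero, one_div_mul_eq_div]
  · have := (memLp_ee_sub_div k).integrable_sq
    simpa only [div_pow] using this
  · exact ae_of_all _ fun h => by positivity

/-- The Gagliardo energy `∬ |f(x)-f(y)|²/|x-y|²`. -/
def gag {F : Type*} [NormedAddCommGroup F] (f : ℝ → F) : ℝ≥0∞ :=
  ∫⁻ p, ‖f p.1 - f p.2‖ₑ ^ 2 ∂kap

/-- Weighted sums `∑ ω(|k|) |f̂(k)|²`. -/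
def hW (ω : ℕ → ℝ) (f : ℝ → ℝ) : ℝ≥0∞ := ∑' k : ℤ, ENNReal.ofReal (ω k.natAbs) * ‖fcR f k‖ₑ ^ 2

lemma gag_eq {f : ℝ → ℝ} (hf : BddPer f) :
    gag f = ENNReal.ofReal (4 * π ^ 2) * hW (fun k => k) f := by
  have hm := hf.meas
  have h1 : gag f = ∫⁻ x in circ, ∫⁻ h in circ, kapD (0, h) * ‖f x - f (x + h)‖ₑ ^ 2 := by
    rw [gag, lintegral_kap (by fun_prop)]
    refine lintegral_congr fun x => ?_
    rw [lintegral_shift (x := x)]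
    · simp only [kapD, cd_shift]
    · intro y
      have h3 := cd_periodic x y
      simp only at h3
      simp only [kapD, h3, hf.per y]
  have hk : Measurable fun h : ℝ => kapD (0, h) := measurable_kapD.comp (by fun_prop)
  rw [h1, lintegral_lintegral_swap]
  swap
  · refine Measurable.aemeasurable ?_
    have : Measurable fun p : ℝ × ℝ => kapD (0, p.2) := hk.comp measurable_snd
    unfold Function.uncurry
    fun_prop
  have h2 : ∀ h : ℝ, ∫⁻ x in circ, kapD (0, h) * ‖f x - f (x + h)‖ₑ ^ 2
      = ∑' k, ENNReal.ofReal (2 * π) * ‖fcR f k‖ₑ ^ 2 * (kapD (0, h) * ‖1 - ee k h‖ₑ ^ 2) := by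
    intro h
    have hs : BddPer fun x => f (h + x) := by
      obtain ⟨C, hC⟩ := hf.bdd
      exact ⟨by fun_prop, fun x => by simp only [← add_assoc, hf.per (h + x)], C, fun x => hC _⟩
    rw [lintegral_const_mul _ (by fun_prop)]
    simp_rw [fun x => add_comm x h]
    rw [lintegral_enorm_sq_eq (hf.sub hs), ← ENNReal.tsum_mul_left, ← ENNReal.tsum_mul_left]
    refine tsum_congr fun k => ?_
    rw [fcR_sub hf.integrable hs.integrable, fcR_shift hf.per, ← one_sub_mul, enorm_mul, mul_pow]
    ring
  simp_rw [h2]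
  rw [lintegral_tsum fun k => (by fun_prop), hW, ← ENNReal.tsum_mul_left]
  refine tsum_congr fun k => ?_
  rw [lintegral_const_mul _ (by fun_prop), lintegral_one_sub_ee,
    ENNReal.ofReal_mul (by positivity : (0 : ℝ) ≤ 2 * π),
    show (4 * π ^ 2 : ℝ) = (2 * π) * (2 * π) by ring,
    ENNReal.ofReal_mul (by positivity : (0 : ℝ) ≤ 2 * π)]
  ring

/-- Bounded measurable periodic functions of finite Gagliardo energy. -/
structure FinEnergy (f : ℝ → ℝ) : Prop extends BddPer f where
  memLp : MemLp (fun p : ℝ × ℝ => f p.1 - f p.2) 2 kap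

lemma finEnergy_of_gag {f : ℝ → ℝ} (hf : BddPer f) (h : gag f < ⊤) : FinEnergy f := by
  have := hf.meas
  refine ⟨hf, Measurable.aestronglyMeasurable (by fun_prop), ?_⟩
  rw [eLpNorm_lt_top_iff_lintegral_rpow_enorm_lt_top two_ne_zero ENNReal.ofNat_ne_top]
  simpa [gag] using h

lemma FinEnergy.gag_lt_top {f : ℝ → ℝ} (hf : FinEnergy f) : gag f < ⊤ := by
  have h := hf.memLp.2
  rw [eLpNorm_lt_top_iff_lintegral_rpow_enorm_lt_top two_ne_zero ENNReal.ofNat_ne_top] at h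
  simpa [gag] using h

lemma FinEnergy.add {f g : ℝ → ℝ} (hf : FinEnergy f) (hg : FinEnergy g) :
    FinEnergy fun x => f x + g x := by
  refine ⟨hf.toBddPer.add hg.toBddPer, ?_⟩
  convert hf.memLp.add hg.memLp using 1
  ext p
  simp only [Pi.add_apply]
  ring

lemma FinEnergy.sub {f g : ℝ → ℝ} (hf : FinEnergy f) (hg : FinEnergy g) :
    FinEnergy fun x => f x - g x := by
  refine ⟨hf.toBddPer.sub hg.toBddPer, ?_⟩
  convert hf.memLp.sub hg.memLp using 1
  ext p
  simp only [Pi.sub_apply]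
  ring

lemma FinEnergy.mul {f g : ℝ → ℝ} (hf : FinEnergy f) (hg : FinEnergy g) :
    FinEnergy fun x => f x * g x := by
  refine ⟨hf.toBddPer.mul hg.toBddPer, ?_⟩
  obtain ⟨C, hC⟩ := hf.bdd
  obtain ⟨D, hD⟩ := hg.bdd
  have := hf.meas
  have := hg.meas
  have h1 : MemLp (fun p : ℝ × ℝ => f p.1 * (g p.1 - g p.2)) 2 kap := by
    refine (hg.memLp.const_mul C).of_le (Measurable.aestronglyMeasurable (by fun_prop))
      (ae_of_all _ fun p => ?_)
    rw [norm_mul, norm_mul]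
    exact mul_le_mul_of_nonneg_right ((hC _).trans (le_abs_self C)) (norm_nonneg _)
  have h2 : MemLp (fun p : ℝ × ℝ => g p.2 * (f p.1 - f p.2)) 2 kap := by
    refine (hf.memLp.const_mul D).of_le (Measurable.aestronglyMeasurable (by fun_prop))
      (ae_of_all _ fun p => ?_)
    rw [norm_mul, norm_mul]
    exact mul_le_mul_of_nonneg_right ((hD _).trans (le_abs_self D)) (norm_nonneg _)
  convert h1.add h2 using 1
  ext p
  simp only [Pi.add_apply]
  ring

lemma finEnergy_trg (K : ℕ) {c : ℤ → ℂ} (hc : Herm c) : FinEnergy (trg K c) := by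
  refine finEnergy_of_gag (bddPer_trg K c) ?_
  rw [gag_eq (bddPer_trg K c), hW]
  refine ENNReal.mul_lt_top ENNReal.ofReal_lt_top ?_
  rw [tsum_eq_sum (s := Finset.Icc (-(K : ℤ)) K)]
  · exact ENNReal.sum_lt_top.2 fun k _ => ENNReal.mul_lt_top ENNReal.ofReal_lt_top
      (ENNReal.pow_lt_top enorm_lt_top)
  · intro k hk
    rw [fcR_trg hc, if_neg hk]
    simp

lemma finEnergy_fejer (N : ℕ) (f : ℝ → ℝ) : FinEnergy (fejer N f) :=
  finEnergy_trg N (herm_fejer N f)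

lemma FinEnergy.integrable_mul {f g : ℝ → ℝ} (hf : FinEnergy f) (hg : FinEnergy g) :
    Integrable (fun p : ℝ × ℝ => (f p.1 - f p.2) * (g p.1 - g p.2)) kap :=
  hf.memLp.integrable_mul hg.memLp

lemma hasSum_energy {f : ℝ → ℝ} (hf : FinEnergy f) :
    HasSum (fun k : ℤ => (k.natAbs : ℝ) * ‖fcR f k‖ ^ 2)
      ((4 * π ^ 2)⁻¹ * ∫ p, (f p.1 - f p.2) ^ 2 ∂kap) := by
  have h0 := hf.gag_lt_top
  have h1 : gag f = ENNReal.ofReal (∫ p, (f p.1 - f p.2) ^ 2 ∂kap) := by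
    rw [ofReal_integral_eq_lintegral_ofReal hf.memLp.integrable_sq
      (ae_of_all _ fun _ => sq_nonneg _), gag]
    refine lintegral_congr fun p => ?_
    rw [← ofReal_norm, ← ENNReal.ofReal_pow (norm_nonneg _), Real.norm_eq_abs, sq_abs]
  have h2 : ∀ k : ℤ, ENNReal.ofReal (k.natAbs : ℝ) * ‖fcR f k‖ₑ ^ 2
      = ENNReal.ofReal ((k.natAbs : ℝ) * ‖fcR f k‖ ^ 2) := fun k => by
    rw [ENNReal.ofReal_mul (Nat.cast_nonneg _), ← ofReal_norm,
      ← ENNReal.ofReal_pow (norm_nonneg _)]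
  have h3 := gag_eq hf.toBddPer
  simp only [hW, h2] at h3
  have hs : Summable fun k : ℤ => (k.natAbs : ℝ) * ‖fcR f k‖ ^ 2 := by
    have h4 : ∑' k : ℤ, ENNReal.ofReal ((k.natAbs : ℝ) * ‖fcR f k‖ ^ 2) ≠ ⊤ := by
      intro h
      rw [h, ENNReal.mul_top (ENNReal.ofReal_pos.2 (by positivity)).ne'] at h3
      exact h0.ne h3
    have := ENNReal.summable_toReal h4
    refine this.congr fun k => ?_
    rw [ENNReal.toReal_ofReal (by positivity)]
  rw [h1, ← ENNReal.ofReal_tsum_of_nonneg (fun k => by positivity) hs,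
    ← ENNReal.ofReal_mul (by positivity), ENNReal.ofReal_eq_ofReal_iff
      (integral_nonneg fun _ => sq_nonneg _)
      (mul_nonneg (by positivity) (tsum_nonneg fun k => by positivity))] at h3
  rw [h3, inv_mul_cancel_left₀ (by positivity)]
  exact hs.hasSum

/-- The Gagliardo pairing on the Fourier side. -/
lemma hasSum_pairing {f g : ℝ → ℝ} (hf : FinEnergy f) (hg : FinEnergy g) :
    HasSum (fun k : ℤ => (k.natAbs : ℝ) * (fcR f k * (starRingEnd ℂ) (fcR g k)).re)
      ((4 * π ^ 2)⁻¹ * ∫ p, (f p.1 - f p.2) * (g p.1 - g p.2) ∂kap) := by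
  have h1 := ((hasSum_energy (hf.add hg)).sub (hasSum_energy (hf.sub hg))).mul_left (1 / 4)
  have e1 : (fun k : ℤ => (k.natAbs : ℝ) * (fcR f k * (starRingEnd ℂ) (fcR g k)).re)
      = fun k : ℤ => 1 / 4 * ((k.natAbs : ℝ) * ‖fcR (fun x => f x + g x) k‖ ^ 2
        - (k.natAbs : ℝ) * ‖fcR (fun x => f x - g x) k‖ ^ 2) := by
    funext k
    rw [fcR_add hf.integrable hg.integrable, fcR_sub hf.integrable hg.integrable]
    simp only [Complex.sq_norm, Complex.normSq_apply, Complex.mul_re, Complex.conj_re,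
      Complex.conj_im, Complex.add_re, Complex.add_im, Complex.sub_re, Complex.sub_im]
    ring
  have e2 : ∫ p, (f p.1 - f p.2) * (g p.1 - g p.2) ∂kap
      = 1 / 4 * (∫ p, (f p.1 + g p.1 - (f p.2 + g p.2)) ^ 2 ∂kap
        - ∫ p, (f p.1 - g p.1 - (f p.2 - g p.2)) ^ 2 ∂kap) := by
    rw [← integral_sub (hf.add hg).memLp.integrable_sq (hf.sub hg).memLp.integrable_sq,
      ← integral_const_mul]
    congr 1
    ext p
    ring
  rw [e1, e2, mul_left_comm, mul_sub (4 * π ^ 2)⁻¹]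
  exact h1

lemma summable_pairing {f g : ℝ → ℝ} (hf : FinEnergy f) (hg : FinEnergy g) :
    Summable fun k : ℤ => (k.natAbs : ℝ) * (‖fcR f k‖ ^ 2 + ‖fcR g k‖ ^ 2) := by
  simp_rw [mul_add]
  exact (hasSum_energy hf).summable.add (hasSum_energy hg).summable

lemma integral_pairing_trg {f : ℝ → ℝ} (hf : FinEnergy f) (K : ℕ) {c : ℤ → ℂ} (hc : Herm c) :
    ∫ p, (f p.1 - f p.2) * (trg K c p.1 - trg K c p.2) ∂kap
      = 4 * π ^ 2 * ∑ k ∈ Finset.Icc (-(K : ℤ)) K,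
        (k.natAbs : ℝ) * (fcR f k * (starRingEnd ℂ) (c k)).re := by
  have h := (hasSum_pairing hf (finEnergy_trg K hc)).tsum_eq
  rw [tsum_eq_sum (s := Finset.Icc (-(K : ℤ)) K)] at h
  · rw [Finset.sum_congr rfl (g := fun k : ℤ => (k.natAbs : ℝ) * (fcR f k * (starRingEnd ℂ) (c k)).re)
      fun k hk => by rw [fcR_trg hc, if_pos hk]] at h
    rw [h, mul_inv_cancel_left₀ (by positivity)]
  · intro k hk
    rw [fcR_trg hc, if_neg hk]
    simp

lemma tendsto_pairing_fejer {f g : ℝ → ℝ} (hf : FinEnergy f) (hg : FinEnergy g) :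
    Tendsto (fun N => ∫ p, (f p.1 - f p.2) * (fejer N g p.1 - fejer N g p.2) ∂kap) atTop
      (𝓝 (∫ p, (f p.1 - f p.2) * (g p.1 - g p.2) ∂kap)) := by
  have key : ∀ {h : ℝ → ℝ}, FinEnergy h → ∫ p, (f p.1 - f p.2) * (h p.1 - h p.2) ∂kap
      = 4 * π ^ 2 * ∑' k : ℤ, (k.natAbs : ℝ) * (fcR f k * (starRingEnd ℂ) (fcR h k)).re := by
    intro h hh
    rw [(hasSum_pairing hf hh).tsum_eq, mul_inv_cancel_left₀ (by positivity)]
  rw [key hg]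
  refine Tendsto.congr (fun N => (key (finEnergy_fejer N g)).symm) ?_
  refine Tendsto.const_mul _ (tendsto_tsum_of_dominated_convergence (summable_pairing hf hg)
    (fun k => ?_) (Eventually.of_forall fun N k => ?_))
  · have h1 : ∀ N, (k.natAbs : ℝ) * (fcR f k * (starRingEnd ℂ) (fcR (fejer N g) k)).re
        = fejerMul N k * ((k.natAbs : ℝ) * (fcR f k * (starRingEnd ℂ) (fcR g k)).re) := by
      intro N
      rw [fcR_fejer, map_mul, Complex.conj_ofReal, mul_left_comm, Complex.re_ofReal_mul]
      ring
    simp_rw [h1]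
    simpa using (tendsto_fejerMul k).mul_const
      ((k.natAbs : ℝ) * (fcR f k * (starRingEnd ℂ) (fcR g k)).re)
  · rw [norm_mul, Real.norm_of_nonneg (Nat.cast_nonneg _)]
    refine mul_le_mul_of_nonneg_left ?_ (Nat.cast_nonneg _)
    rw [Real.norm_eq_abs]
    refine (Complex.abs_re_le_norm _).trans ?_
    rw [norm_mul, RCLike.norm_conj, fcR_fejer, norm_mul, Complex.norm_real,
      Real.norm_of_nonneg (fejerMul_nonneg N k)]
    have h1 := fejerMul_le_one N k
    have h2 : fejerMul N k * ‖fcR g k‖ ≤ ‖fcR g k‖ := mul_le_of_le_one_left (norm_nonneg _) h1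
    have h3 := mul_le_mul_of_nonneg_left h2 (norm_nonneg (fcR f k))
    nlinarith [sq_nonneg (‖fcR f k‖ - ‖fcR g k‖), sq_nonneg ‖fcR f k‖, sq_nonneg ‖fcR g k‖]

end Kernel

section Quadratic

lemma lintegral_quad_le (s : Finset ℤ) (c : ℤ → ℂ) (B : ℤ → ℤ → ℂ) (b : ℤ → ℝ)
    (hb : ∀ k, 0 ≤ b k) (hB : ∀ j k, ‖B j k‖ ≤ b j * b k) (h0 : b 0 * ‖c 0‖ = 0) {R : ℝ → ℝ}
    (hR : ∀ x, (R x : ℂ) = ∑ j ∈ s, ∑ k ∈ s, c j * c k * B j k * ee (j + k) x) :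
    ∫⁻ x in circ, ‖R x‖ₑ ^ 2
      ≤ ENNReal.ofReal (48 * π * (∑ k ∈ s, √(k.natAbs : ℝ) * (b k * ‖c k‖) ^ 2) ^ 2) := by
  have hcont : Continuous R := by
    have h1 : R = fun x => (∑ j ∈ s, ∑ k ∈ s, c j * c k * B j k * ee (j + k) x).re := by
      ext x
      rw [← hR, Complex.ofReal_re]
    rw [h1]
    fun_prop
  have h1 : ∫⁻ x in circ, ‖R x‖ₑ ^ 2 = ENNReal.ofReal (∫ x in circ, R x ^ 2) := by
    rw [ofReal_integral_eq_lintegral_ofReal (integrable_of_continuous (by fun_prop))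
      (ae_of_all _ fun _ => sq_nonneg _)]
    refine lintegral_congr fun p => ?_
    rw [← ofReal_norm, ← ENNReal.ofReal_pow (norm_nonneg _), Real.norm_eq_abs, sq_abs]
  rw [h1]
  refine ENNReal.ofReal_le_ofReal ?_
  have h2 : ∀ x, ((R x ^ 2 : ℝ) : ℂ) = ∑ j ∈ s, ∑ k ∈ s, ∑ l ∈ s, ∑ m ∈ s,
      c j * c k * B j k * (c l * c m * B l m) * ee (j + k + l + m) x := by
    intro x
    push_cast
    rw [hR, sq, Finset.sum_mul]
    refine Finset.sum_congr rfl fun j _ => ?_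
    rw [Finset.sum_mul]
    refine Finset.sum_congr rfl fun k _ => ?_
    rw [Finset.mul_sum]
    refine Finset.sum_congr rfl fun l _ => ?_
    rw [Finset.mul_sum]
    refine Finset.sum_congr rfl fun m _ => ?_
    rw [add_assoc (j + k), ← ee_mul (j + k)]
    ring
  have h3 : ((∫ x in circ, R x ^ 2 : ℝ) : ℂ) = ∑ j ∈ s, ∑ k ∈ s, ∑ l ∈ s, ∑ m ∈ s,
      c j * c k * B j k * (c l * c m * B l m) * if j + k + l + m = 0 then (2 * π : ℂ) else 0 := by
    rw [← integral_complex_ofReal]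
    simp_rw [h2]
    rw [integral_finsetSum _ fun j _ => integrable_of_continuous (by fun_prop)]
    refine Finset.sum_congr rfl fun j _ => ?_
    rw [integral_finsetSum _ fun j _ => integrable_of_continuous (by fun_prop)]
    refine Finset.sum_congr rfl fun k _ => ?_
    rw [integral_finsetSum _ fun j _ => integrable_of_continuous (by fun_prop)]
    refine Finset.sum_congr rfl fun l _ => ?_
    rw [integral_finsetSum _ fun j _ => integrable_of_continuous (by fun_prop)]
    refine Finset.sum_congr rfl fun m _ => ?_
    rw [integral_const_mul, integral_ee]
  have h4 : ∫ x in circ, R x ^ 2 ≤ ‖((∫ x in circ, R x ^ 2 : ℝ) : ℂ)‖ := by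
    rw [Complex.norm_real]
    exact le_abs_self _
  refine h4.trans ?_
  have h5 : ‖((∫ x in circ, R x ^ 2 : ℝ) : ℂ)‖ ≤ ∑ j ∈ s, ∑ k ∈ s, ∑ l ∈ s, ∑ m ∈ s, 2 * π *
      if j + k + l + m = 0 then
        b j * ‖c j‖ * (b k * ‖c k‖) * (b l * ‖c l‖) * (b m * ‖c m‖) else 0 := by
    rw [h3]
    refine norm_sum_le_of_le _ fun j _ => norm_sum_le_of_le _ fun k _ =>
      norm_sum_le_of_le _ fun l _ => norm_sum_le_of_le _ fun m _ => ?_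
    split_ifs
    · simp only [norm_mul, Complex.norm_ofNat, Complex.norm_real, Real.norm_of_nonneg Real.pi_nonneg]
      have := mul_le_mul (hB j k) (hB l m) (norm_nonneg _) (mul_nonneg (hb j) (hb k))
      have h6 : 0 ≤ ‖c j‖ * ‖c k‖ * ‖c l‖ * ‖c m‖ * (2 * π) := by positivity
      have h7 := mul_le_mul_of_nonneg_left this h6
      calc _ = ‖c j‖ * ‖c k‖ * ‖c l‖ * ‖c m‖ * (2 * π) * (‖B j k‖ * ‖B l m‖) := by ring
        _ ≤ _ := h7
        _ = _ := by ring
    · simp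
  refine h5.trans ?_
  simp_rw [← Finset.mul_sum]
  have h6 := quad_sum_le s (fun k => b k * ‖c k‖) (fun k => mul_nonneg (hb k) (norm_nonneg _)) h0
  have h7 := mul_le_mul_of_nonneg_left h6 (by positivity : 0 ≤ 2 * π)
  refine h7.trans (le_of_eq ?_)
  ring

lemma ofReal_sum_le_hW (s : Finset ℤ) {ω : ℕ → ℝ} (hω : ∀ k, 0 ≤ ω k) {f g : ℝ → ℝ}
    (hfg : ∀ k, ‖fcR g k‖ ≤ ‖fcR f k‖) :
    ENNReal.ofReal (∑ k ∈ s, ω k.natAbs * ‖fcR g k‖ ^ 2) ≤ hW ω f := by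
  rw [ENNReal.ofReal_sum_of_nonneg fun k _ => mul_nonneg (hω _) (sq_nonneg _)]
  refine (Finset.sum_le_sum fun k _ => ?_).trans (ENNReal.sum_le_tsum s)
  rw [ENNReal.ofReal_mul (hω _), ENNReal.ofReal_pow (norm_nonneg _), ofReal_norm]
  gcongr
  rw [← ofReal_norm, ← ofReal_norm]
  exact ENNReal.ofReal_le_ofReal (hfg k)

lemma norm_fcR_fejer_le (N : ℕ) (f : ℝ → ℝ) (k : ℤ) : ‖fcR (fejer N f) k‖ ≤ ‖fcR f k‖ := by
  rw [fcR_fejer, norm_mul, Complex.norm_real, Real.norm_of_nonneg (fejerMul_nonneg N k)]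
  exact mul_le_of_le_one_left (norm_nonneg _) (fejerMul_le_one N k)

lemma fejer_eq_sum (N : ℕ) (f : ℝ → ℝ) (x : ℝ) :
    (fejer N f x : ℂ) = ∑ k ∈ Finset.Icc (-(N : ℤ)) N, fcR (fejer N f) k * ee k x := by
  simp_rw [fcR_fejer]
  exact trg_ofReal (herm_fejer N f) N x

lemma lintegral_fejer_pow_four_le {f : ℝ → ℝ} (h0 : fcR f 0 = 0) (N : ℕ) :
    ∫⁻ x in circ, ‖fejer N f x‖ₑ ^ 4
      ≤ ENNReal.ofReal (48 * π) * hW (fun k => √k) f ^ 2 := by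
  have h := lintegral_quad_le (Finset.Icc (-(N : ℤ)) N) (fcR (fejer N f)) (fun _ _ => 1)
    (fun _ => 1) (fun _ => zero_le_one) (by simp) (by simp [fcR_fejer, h0])
    (R := fun x => fejer N f x ^ 2) (fun x => by
      push_cast
      rw [fejer_eq_sum, sq, Finset.sum_mul_sum]
      refine Finset.sum_congr rfl fun j _ => Finset.sum_congr rfl fun k _ => ?_
      rw [← ee_mul]
      ring)
  simp_rw [enorm_pow, ← pow_mul, one_mul] at h
  refine h.trans ?_
  rw [ENNReal.ofReal_mul (by positivity), ENNReal.ofReal_pow (by positivity)]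
  gcongr
  exact ofReal_sum_le_hW _ (ω := fun k => √k) (fun k => Real.sqrt_nonneg _) (norm_fcR_fejer_le N f)

lemma liminf_le_of_forall_le {a : ℕ → ℝ≥0∞} {C : ℝ≥0∞} (h : ∀ j, a j ≤ C) :
    liminf a atTop ≤ C :=
  liminf_le_of_frequently_le' (Frequently.of_forall h)

/-- `L⁴` bound by the `Ḣ^{1/4}` seminorm. -/
lemma lintegral_pow_four_le {f : ℝ → ℝ} (hf : BddPer f) (h0 : fcR f 0 = 0) :
    ∫⁻ x in circ, ‖f x‖ₑ ^ 4 ≤ ENNReal.ofReal (48 * π) * hW (fun k => √k) f ^ 2 := by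
  obtain ⟨ns, -, hns⟩ := exists_fejer_tendsto_ae hf
  calc ∫⁻ x in circ, ‖f x‖ₑ ^ 4
      = ∫⁻ x in circ, liminf (fun j => ‖fejer (ns j) f x‖ₑ ^ 4) atTop := by
        refine lintegral_congr_ae ?_
        filter_upwards [hns] with x hx
        exact (((ENNReal.continuous_pow 4).tendsto _).comp hx.enorm).liminf_eq.symm
    _ ≤ liminf (fun j => ∫⁻ x in circ, ‖fejer (ns j) f x‖ₑ ^ 4) atTop :=
        lintegral_liminf_le fun j => (bddPer_fejer (ns j) f).meas.enorm.pow_const 4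
    _ ≤ _ := liminf_le_of_forall_le fun j => lintegral_fejer_pow_four_le h0 _

/-- `∫ |f(x)-f(y)|²/|x-y|² dy` with values in `[0,∞]`. -/
def gl {F : Type*} [NormedAddCommGroup F] (f : ℝ → F) (x : ℝ) : ℝ≥0∞ :=
  ∫⁻ y in circ, kapD (x, y) * ‖f x - f y‖ₑ ^ 2

lemma measurable_gl {f : ℝ → ℝ} (hf : Measurable f) : Measurable (gl f) := by
  unfold gl
  refine Measurable.lintegral_prod_right' (f := fun p : ℝ × ℝ => kapD p * ‖f p.1 - f p.2‖ₑ ^ 2) ?_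
  have := measurable_kapD
  fun_prop

lemma gl_fejer_eq (N : ℕ) (f : ℝ → ℝ) (x : ℝ) : gl (fejer N f) x
    = ENNReal.ofReal (∫ y in circ, (fejer N f x - fejer N f y) ^ 2 / cd x y ^ 2) := by
  set P := fejer N f with hP
  have hm : Measurable P := (bddPer_fejer N f).meas
  have hc := measurable_cd_right x
  rw [ofReal_integral_eq_lintegral_ofReal _ (ae_of_all _ fun y => by positivity), gl]
  · refine lintegral_congr fun y => ?_
    rw [kapD, ← ofReal_norm, ← ENNReal.ofReal_pow (norm_nonneg _), ← ENNReal.ofReal_mul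
      (by positivity), Real.norm_eq_abs, sq_abs, one_div_mul_eq_div]
  · refine Integrable.of_bound (C := (∑ k ∈ Finset.Icc (-(N : ℤ)) N,
      ‖fcR P k‖ * k.natAbs) ^ 2) (Measurable.aestronglyMeasurable (by fun_prop))
      (ae_of_all _ fun y => ?_)
    rw [← div_pow, norm_pow, norm_div, Real.norm_of_nonneg (cd_nonneg x y)]
    refine pow_le_pow_left₀ (div_nonneg (norm_nonneg _) (cd_nonneg _ _)) ?_ 2
    rw [← Complex.norm_real, Complex.ofReal_sub, hP, fejer_eq_sum, fejer_eq_sum,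
      ← Finset.sum_sub_distrib]
    refine (div_le_div_of_nonneg_right (norm_sum_le _ _) (cd_nonneg x y)).trans ?_
    rw [Finset.sum_div]
    refine Finset.sum_le_sum fun k _ => ?_
    rw [← mul_sub, norm_mul, mul_div_assoc]
    exact mul_le_mul_of_nonneg_left (norm_ee_sub_div_le k x y) (norm_nonneg _)

lemma lintegral_gl_fejer_sq_le (N : ℕ) (f : ℝ → ℝ) :
    ∫⁻ x in circ, gl (fejer N f) x ^ 2
      ≤ ENNReal.ofReal (192 * π ^ 3) * hW (fun k => k * √k) f ^ 2 := by
  set P := fejer N f with hP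
  have h := lintegral_quad_le (Finset.Icc (-(N : ℤ)) N) (fcR P) kerA
    (fun k => √(2 * π * k.natAbs)) (fun _ => Real.sqrt_nonneg _) norm_kerA_le (by simp)
    (R := fun x => ∫ y in circ, (P x - P y) ^ 2 / cd x y ^ 2) (fun x => by
      rw [← integral_complex_ofReal]
      have h1 : ∀ y, (((P x - P y) ^ 2 / cd x y ^ 2 : ℝ) : ℂ)
          = ∑ j ∈ Finset.Icc (-(N : ℤ)) N, ∑ k ∈ Finset.Icc (-(N : ℤ)) N, fcR P j * fcR P k *
            ((ee j x - ee j y) * (ee k x - ee k y) / ((cd x y ^ 2 : ℝ) : ℂ)) := by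
        intro y
        rw [Complex.ofReal_div, Complex.ofReal_pow, Complex.ofReal_sub, hP, fejer_eq_sum,
          fejer_eq_sum, ← Finset.sum_sub_distrib, sq (∑ k ∈ _, _), Finset.sum_mul_sum,
          Finset.sum_div]
        refine Finset.sum_congr rfl fun j _ => ?_
        rw [Finset.sum_div]
        refine Finset.sum_congr rfl fun k _ => ?_
        ring
      simp_rw [h1]
      rw [integral_finsetSum _ fun j _ => integrable_finsetSum _ fun k _ =>
        (integrable_ee_sub_mul j k x).const_mul _]
      refine Finset.sum_congr rfl fun j _ => ?_
      rw [integral_finsetSum _ fun k _ => (integrable_ee_sub_mul j k x).const_mul _]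
      refine Finset.sum_congr rfl fun k _ => ?_
      rw [integral_const_mul, integral_ee_sub_mul]
      ring)
  have h2 : ∀ x, gl P x ^ 2 = ‖∫ y in circ, (P x - P y) ^ 2 / cd x y ^ 2‖ₑ ^ 2 := by
    intro x
    rw [gl_fejer_eq, Real.enorm_of_nonneg (integral_nonneg fun y => by positivity)]
  simp_rw [h2]
  refine h.trans ?_
  have h3 : 48 * π * (∑ k ∈ Finset.Icc (-(N : ℤ)) N,
      √(k.natAbs : ℝ) * (√(2 * π * k.natAbs) * ‖fcR P k‖) ^ 2) ^ 2
      = 192 * π ^ 3 * (∑ k ∈ Finset.Icc (-(N : ℤ)) N,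
        ((k.natAbs : ℝ) * √(k.natAbs : ℝ)) * ‖fcR P k‖ ^ 2) ^ 2 := by
    have : ∀ k : ℤ, √(k.natAbs : ℝ) * (√(2 * π * k.natAbs) * ‖fcR P k‖) ^ 2
        = 2 * π * (((k.natAbs : ℝ) * √(k.natAbs : ℝ)) * ‖fcR P k‖ ^ 2) := by
      intro k
      rw [mul_pow, Real.sq_sqrt (by positivity)]
      ring
    simp_rw [this]
    rw [← Finset.mul_sum]
    ring
  rw [h3, ENNReal.ofReal_mul (by positivity), ENNReal.ofReal_pow (by positivity)]
  gcongr
  exact ofReal_sum_le_hW _ (ω := fun k => k * √k) (fun k => by positivity) (norm_fcR_fejer_le N f)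

/-- `L²` bound of the fractional gradient density by the `Ḣ^{3/4}` seminorm. -/
lemma lintegral_gl_sq_le {f : ℝ → ℝ} (hf : BddPer f) :
    ∫⁻ x in circ, gl f x ^ 2 ≤ ENNReal.ofReal (192 * π ^ 3) * hW (fun k => k * √k) f ^ 2 := by
  obtain ⟨ns, -, hns⟩ := exists_fejer_tendsto_ae hf
  have h1 : ∀ᵐ x ∂circMeasure, gl f x ≤ liminf (fun j => gl (fejer (ns j) f) x) atTop := by
    filter_upwards [hns] with x hx
    calc gl f x = ∫⁻ y in circ, liminf (fun j =>
          kapD (x, y) * ‖fejer (ns j) f x - fejer (ns j) f y‖ₑ ^ 2) atTop := by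
          refine lintegral_congr_ae ?_
          filter_upwards [hns] with y hy
          refine (ENNReal.Tendsto.const_mul (((ENNReal.continuous_pow 2).tendsto _).comp
            (hx.sub hy).enorm) (Or.inr (kapD_lt_top _).ne)).liminf_eq.symm
      _ ≤ _ := by
          refine lintegral_liminf_le fun j => ?_
          have := (bddPer_fejer (ns j) f).meas
          have h2 : Measurable fun y => kapD (x, y) := measurable_kapD.comp measurable_prodMk_left
          fun_prop
  calc ∫⁻ x in circ, gl f x ^ 2
      ≤ ∫⁻ x in circ, liminf (fun j => gl (fejer (ns j) f) x ^ 2) atTop := by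
        refine lintegral_mono_ae ?_
        filter_upwards [h1] with x hx
        refine (pow_le_pow_left' hx 2).trans (le_of_eq ?_)
        exact Monotone.map_liminf_of_continuousAt (pow_left_mono 2) _
          (ENNReal.continuous_pow 2).continuousAt
    _ ≤ liminf (fun j => ∫⁻ x in circ, gl (fejer (ns j) f) x ^ 2) atTop :=
        lintegral_liminf_le fun j => (measurable_gl (bddPer_fejer (ns j) f).meas).pow_const 2
    _ ≤ _ := liminf_le_of_forall_le fun j => lintegral_gl_fejer_sq_le _ _

end Quadratic

section

variable {n : ℕ}

/-- All components have finite energy. -/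
def FinV (u : ℝ → E n) : Prop := ∀ i, FinEnergy fun x => u x i

lemma enorm_sq_eq_sum (v : E n) : ‖v‖ₑ ^ 2 = ∑ i, ‖v i‖ₑ ^ 2 := by
  have h : ∀ {F : Type} [NormedAddCommGroup F] (z : F), ‖z‖ₑ ^ 2 = ENNReal.ofReal (‖z‖ ^ 2) :=
    fun z => by rw [ENNReal.ofReal_pow (norm_nonneg _), ofReal_norm]
  simp_rw [h]
  rw [EuclideanSpace.norm_sq_eq, ENNReal.ofReal_sum_of_nonneg fun i _ => sq_nonneg _]

lemma abs_apply_le_norm (v : E n) (i : Fin n) : |v i| ≤ ‖v‖ := by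
  simpa using PiLp.norm_apply_le v i

lemma norm_le_sum_abs (v : E n) : ‖v‖ ≤ ∑ i, |v i| := by
  rw [EuclideanSpace.norm_eq]
  refine Real.sqrt_le_iff.2 ⟨Finset.sum_nonneg fun i _ => abs_nonneg _, ?_⟩
  exact Finset.sum_sq_le_sq_sum_of_nonneg fun i _ => abs_nonneg _

lemma inner_eq_sum (v w : E n) : inner ℝ v w = ∑ i, v i * w i := by
  rw [PiLp.inner_apply]
  exact Finset.sum_congr rfl fun i _ => by simp [mul_comm]

lemma measurable_of_apply {α : Type*} [MeasurableSpace α] {u : α → E n}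
    (h : ∀ i, Measurable fun x => u x i) : Measurable u :=
  (MeasurableEquiv.toLp 2 (Fin n → ℝ)).measurable.comp (measurable_pi_lambda _ h)

lemma Measurable.comp_apply {α : Type*} [MeasurableSpace α] {u : α → E n}
    (h : Measurable u) (i : Fin n) : Measurable fun x => u x i :=
  (measurable_pi_apply i).comp ((MeasurableEquiv.toLp 2 (Fin n → ℝ)).symm.measurable.comp h)

lemma FinV.meas {u : ℝ → E n} (hu : FinV u) : Measurable u :=
  measurable_of_apply fun i => (hu i).meas

lemma FinV.bdd {u : ℝ → E n} (hu : FinV u) : ∃ C : ℝ, ∀ x, ‖u x‖ ≤ C := by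
  choose C hC using fun i => (hu i).bdd
  exact ⟨∑ i, C i, fun x => (norm_le_sum_abs _).trans (Finset.sum_le_sum fun i _ => hC i x)⟩

lemma gag_eq_sum {u : ℝ → E n} (hu : Measurable u) : gag u = ∑ i, gag fun x => u x i := by
  have := hu.comp_apply
  simp only [gag, enorm_sq_eq_sum, PiLp.sub_apply]
  exact lintegral_finsetSum _ fun i _ => by fun_prop

lemma FinV.gag_lt_top {u : ℝ → E n} (hu : FinV u) : gag u < ⊤ := by
  rw [gag_eq_sum hu.meas]
  exact ENNReal.sum_lt_top.2 fun i _ => (hu i).gag_lt_top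

lemma FinV.memLp {u : ℝ → E n} (hu : FinV u) :
    MemLp (fun p : ℝ × ℝ => u p.1 - u p.2) 2 kap := by
  have := hu.meas
  refine ⟨Measurable.aestronglyMeasurable (by fun_prop), ?_⟩
  rw [eLpNorm_lt_top_iff_lintegral_rpow_enorm_lt_top two_ne_zero ENNReal.ofNat_ne_top]
  simpa [gag] using hu.gag_lt_top

lemma integrable_norm_sub_sq {u : ℝ → E n} (hu : FinV u) :
    Integrable (fun p : ℝ × ℝ => ‖u p.1 - u p.2‖ ^ 2) kap :=
  hu.memLp.integrable_norm_pow two_ne_zero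

lemma FinEnergy.zero : FinEnergy fun _ => 0 :=
  ⟨⟨measurable_const, fun _ => rfl, 0, by simp⟩, by simp⟩

lemma FinEnergy.sum {ι : Type*} (s : Finset ι) {f : ι → ℝ → ℝ} (hf : ∀ i, FinEnergy (f i)) :
    FinEnergy fun x => ∑ i ∈ s, f i x := by
  classical
  induction s using Finset.induction_on with
  | empty => simpa using FinEnergy.zero
  | insert a s ha ih => simpa [Finset.sum_insert ha] using (hf a).add ih

lemma FinV.inner {u v : ℝ → E n} (hu : FinV u) (hv : FinV v) :
    FinEnergy fun x => inner ℝ (u x) (v x) := by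
  simp_rw [inner_eq_sum]
  exact FinEnergy.sum _ fun i => (hu i).mul (hv i)

lemma FinV.sub {u v : ℝ → E n} (hu : FinV u) (hv : FinV v) : FinV fun x => u x - v x :=
  fun i => (hu i).sub (hv i)

lemma FinV.smul {f : ℝ → ℝ} {v : ℝ → E n} (hf : FinEnergy f) (hv : FinV v) :
    FinV fun x => f x • v x :=
  fun i => hf.mul (hv i)

lemma integrable_mul_bdd {F G : ℝ × ℝ → ℝ} (hF : Integrable F kap) (hG : Measurable G) {C : ℝ}
    (hC : ∀ p, |G p| ≤ C) : Integrable (fun p => F p * G p) kap :=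
  hF.mul_bdd (c := C) hG.aestronglyMeasurable (ae_of_all _ hC)

/-- A time slice of the flow, tested against trigonometric polynomials. -/
structure SliceSol (u w : ℝ → E n) : Prop where
  fin : FinV u
  norm_one : ∀ x, ‖u x‖ = 1
  wmeas : Measurable w
  wL2 : ∫⁻ x in circ, ‖w x‖ₑ ^ 2 < ⊤
  eq_trg : ∀ (i : Fin n) (K : ℕ) (c : ℤ → ℂ), Herm c →
    (∫ x in circ, w x i * trg K c x) + ∫ p, (u p.1 i - u p.2 i) * (trg K c p.1 - trg K c p.2) ∂kap
      = ∫ p, ‖u p.1 - u p.2‖ ^ 2 * (u p.1 i * trg K c p.1) ∂kap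

lemma memLp_of_lintegral {F : Type*} [NormedAddCommGroup F] [MeasurableSpace F] [BorelSpace F]
    [SecondCountableTopology F] {μ : Measure ℝ} {w : ℝ → F} (hw : Measurable w)
    (h : ∫⁻ x, ‖w x‖ₑ ^ 2 ∂μ < ⊤) : MemLp w 2 μ := by
  refine ⟨hw.aestronglyMeasurable, ?_⟩
  rw [eLpNorm_lt_top_iff_lintegral_rpow_enorm_lt_top two_ne_zero ENNReal.ofNat_ne_top]
  simpa using h

namespace SliceSol

variable {u w : ℝ → E n} (h : SliceSol u w)
include h

lemma memLp_w : MemLp w 2 circMeasure := memLp_of_lintegral h.wmeas h.wL2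

lemma integrable_w (i : Fin n) : Integrable (fun x => w x i) circMeasure := by
  refine (h.memLp_w.integrable one_le_two).mono (h.wmeas.comp_apply i).aestronglyMeasurable
    (ae_of_all _ fun x => ?_)
  exact abs_apply_le_norm _ _

lemma integrable_norm_sq : Integrable (fun p : ℝ × ℝ => ‖u p.1 - u p.2‖ ^ 2) kap :=
  integrable_norm_sub_sq h.fin

lemma eq_fin (i : Fin n) {ψ : ℝ → ℝ} (hψ : FinEnergy ψ) :
    (∫ x in circ, w x i * ψ x) + ∫ p, (u p.1 i - u p.2 i) * (ψ p.1 - ψ p.2) ∂kap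
      = ∫ p, ‖u p.1 - u p.2‖ ^ 2 * (u p.1 i * ψ p.1) ∂kap := by
  obtain ⟨ns, hns, hlim⟩ := exists_fejer_tendsto_ae hψ.toBddPer
  obtain ⟨C, hC⟩ := hψ.bdd
  have hfC := abs_fejer_le hψ.toBddPer hC
  have hfm : ∀ N, Measurable (fejer N ψ) := fun N => (bddPer_fejer N ψ).meas
  have hum := h.fin.meas
  have hui := (h.fin i).meas
  have hwi := h.wmeas.comp_apply i
  have t1 : Tendsto (fun j => ∫ x in circ, w x i * fejer (ns j) ψ x) atTop
      (𝓝 (∫ x in circ, w x i * ψ x)) := by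
    refine tendsto_integral_of_dominated_convergence (fun x => |w x i| * C)
      (fun j => (hwi.mul (hfm _)).aestronglyMeasurable) ((h.integrable_w i).abs.mul_const C)
      (fun j => ae_of_all _ fun x => ?_) ?_
    · rw [norm_mul]
      exact mul_le_mul_of_nonneg_left (hfC _ _) (abs_nonneg _)
    · filter_upwards [hlim] with x hx
      exact hx.const_mul _
  have t2 := (tendsto_pairing_fejer (h.fin i) hψ).comp hns.tendsto_atTop
  have t3 : Tendsto (fun j => ∫ p, ‖u p.1 - u p.2‖ ^ 2 * (u p.1 i * fejer (ns j) ψ p.1) ∂kap) atTop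
      (𝓝 (∫ p, ‖u p.1 - u p.2‖ ^ 2 * (u p.1 i * ψ p.1) ∂kap)) := by
    have := fun j => hfm (ns j)
    refine tendsto_integral_of_dominated_convergence (fun p => ‖u p.1 - u p.2‖ ^ 2 * C)
      (fun j => Measurable.aestronglyMeasurable (by fun_prop)) (h.integrable_norm_sq.mul_const C)
      (fun j => ae_of_all _ fun p => ?_) ?_
    · rw [norm_mul, norm_mul, Real.norm_of_nonneg (by positivity : 0 ≤ ‖u p.1 - u p.2‖ ^ 2)]
      refine mul_le_mul_of_nonneg_left ?_ (by positivity)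
      have h1 := (abs_apply_le_norm (u p.1) i).trans (h.norm_one _).le
      exact (mul_le_of_le_one_left (norm_nonneg _) h1).trans (hfC _ _)
    · filter_upwards [ae_kap_of_ae hlim] with p hp
      exact (hp.1.const_mul _).const_mul _
  refine tendsto_nhds_unique (t1.add t2) (t3.congr fun j => ?_)
  exact (h.eq_trg i (ns j) _ (herm_fejer _ ψ)).symm

lemma eq_vec {φ : ℝ → E n} (hφ : FinV φ) :
    (∫ x in circ, inner ℝ (w x) (φ x)) + ∫ p, inner ℝ (u p.1 - u p.2) (φ p.1 - φ p.2) ∂kap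
      = ∫ p, ‖u p.1 - u p.2‖ ^ 2 * inner ℝ (u p.1) (φ p.1) ∂kap := by
  simp only [inner_eq_sum, PiLp.sub_apply, Finset.mul_sum]
  rw [integral_finsetSum, integral_finsetSum, integral_finsetSum, ← Finset.sum_add_distrib]
  · exact Finset.sum_congr rfl fun i _ => h.eq_fin i (hφ i)
  · intro i _
    obtain ⟨C, hC⟩ : ∃ C : ℝ, ∀ x, |u x i * φ x i| ≤ C := ((h.fin i).mul (hφ i)).bdd
    have h1 := (h.fin i).meas
    have h2 := (hφ i).meas
    exact integrable_mul_bdd (G := fun p => u p.1 i * φ p.1 i) (C := C) h.integrable_norm_sq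
      ((h1.comp measurable_fst).mul (h2.comp measurable_fst)) fun p => hC p.1
  · intro i _
    have := (h.fin i).integrable_mul (hφ i)
    exact this
  · intro i _
    obtain ⟨C, hC⟩ := (hφ i).bdd
    exact (h.integrable_w i).mul_bdd (c := C) (hφ i).meas.aestronglyMeasurable (ae_of_all _ hC)

end SliceSol

end

/-- The antisymmetric form `⟪b,p⟫⟪a,q⟫ - ⟪a,p⟫⟪b,q⟫`. -/
def omg {V : Type*} [NormedAddCommGroup V] [InnerProductSpace ℝ V] (a b p q : V) : ℝ :=
  inner ℝ b p * inner ℝ a q - inner ℝ a p * inner ℝ b q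

/-- The bilinear form with `F(u,φ) = ½|δu|²(⟪u(x),φ(x)⟫ + ⟪u(y),φ(y)⟫)`. -/
def frm {V : Type*} [NormedAddCommGroup V] [InnerProductSpace ℝ V] (a b p q r s : V) : ℝ :=
  omg a b ((1 / 2 : ℝ) • (r + s)) (p - q) + 1 / 4 * ‖a - b‖ ^ 2 * inner ℝ (p - q) (r - s)

section Algebra

variable {V : Type*} [NormedAddCommGroup V] [InnerProductSpace ℝ V] {a b : V}

lemma abs_omg_le (ha : ‖a‖ = 1) (b p q : V) :
    |omg a b p q| ≤ 2 * ‖a - b‖ * ‖p‖ * ‖q‖ := by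
  have h : omg a b p q = inner ℝ a p * inner ℝ (a - b) q - inner ℝ (a - b) p * inner ℝ a q := by
    simp only [omg, inner_sub_left]; ring
  have h1 := abs_real_inner_le_norm a p
  have h2 := abs_real_inner_le_norm a q
  have h3 := abs_real_inner_le_norm (a - b) p
  have h4 := abs_real_inner_le_norm (a - b) q
  rw [ha, one_mul] at h1 h2
  rw [h]
  refine (abs_sub _ _).trans ?_
  rw [abs_mul, abs_mul]
  have h5 := mul_le_mul h1 h4 (abs_nonneg _) (norm_nonneg _)
  have h6 := mul_le_mul h3 h2 (abs_nonneg _) (by positivity)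
  linarith

lemma norm_sub_sq_sphere (ha : ‖a‖ = 1) (hb : ‖b‖ = 1) : ‖a - b‖ ^ 2 = 2 - 2 * inner ℝ a b := by
  rw [norm_sub_sq_real, ha, hb]; ring

omit [InnerProductSpace ℝ V] in
lemma norm_sub_le_two (ha : ‖a‖ = 1) (hb : ‖b‖ = 1) : ‖a - b‖ ≤ 2 := by
  have := norm_sub_le a b
  linarith

lemma abs_quarter_le (ha : ‖a‖ = 1) (hb : ‖b‖ = 1) (p r s : V) :
    |1 / 4 * ‖a - b‖ ^ 2 * inner ℝ p (r - s)| ≤ 1 / 2 * ‖a - b‖ * ‖p‖ * (‖r‖ + ‖s‖) := by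
  rw [abs_mul, abs_of_nonneg (by positivity)]
  have h1 := (abs_real_inner_le_norm p (r - s)).trans
    (mul_le_mul_of_nonneg_left (norm_sub_le r s) (norm_nonneg _))
  have h2 : 1 / 4 * ‖a - b‖ ^ 2 ≤ 1 / 2 * ‖a - b‖ := by
    nlinarith [norm_sub_le_two ha hb, norm_nonneg (a - b)]
  calc _ ≤ (1 / 2 * ‖a - b‖) * (‖p‖ * (‖r‖ + ‖s‖)) := mul_le_mul h2 h1 (abs_nonneg _) (by positivity)
    _ = _ := by ring

lemma norm_half_add_le (r s : V) : ‖(1 / 2 : ℝ) • (r + s)‖ ≤ 1 / 2 * (‖r‖ + ‖s‖) := by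
  rw [norm_smul, Real.norm_of_nonneg (by norm_num)]
  exact mul_le_mul_of_nonneg_left (norm_add_le r s) (by norm_num)

lemma frm_self (ha : ‖a‖ = 1) (hb : ‖b‖ = 1) (r s : V) :
    frm a b a b r s = 1 / 2 * (‖a - b‖ ^ 2 * inner ℝ a r + ‖a - b‖ ^ 2 * inner ℝ b s) := by
  rw [frm, omg, norm_sub_sq_sphere ha hb]
  simp only [inner_sub_left, inner_sub_right, inner_add_right, real_inner_smul_right,
    real_inner_self_eq_norm_sq, ha, hb, real_inner_comm a b]
  ring

lemma frm_sub (a b p q p' q' r s : V) :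
    frm a b (p - p') (q - q') r s = frm a b p q r s - frm a b p' q' r s := by
  simp only [frm, omg, inner_sub_left, inner_sub_right, inner_add_right, real_inner_smul_right]
  ring

lemma abs_frm_le (ha : ‖a‖ = 1) (hb : ‖b‖ = 1) (p q r s : V) :
    |frm a b p q r s| ≤ 3 / 2 * (‖a - b‖ * ‖p - q‖ * (‖r‖ + ‖s‖)) := by
  refine (abs_add_le _ _).trans ?_
  have h1 := abs_omg_le ha b ((1 / 2 : ℝ) • (r + s)) (p - q)
  have h2 := abs_quarter_le ha hb (p - q) r s
  have h3 : 2 * ‖a - b‖ * ‖(1 / 2 : ℝ) • (r + s)‖ * ‖p - q‖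
      ≤ 2 * ‖a - b‖ * (1 / 2 * (‖r‖ + ‖s‖)) * ‖p - q‖ := by
    gcongr; exact norm_half_add_le r s
  linarith

lemma abs_frm_sub_le (ha : ‖a‖ = 1) (hb : ‖b‖ = 1) (p q r s : V) :
    |frm a b p q r s - inner ℝ (a - b)
      ((inner ℝ a r • p - inner ℝ a p • r) - (inner ℝ b s • q - inner ℝ b q • s))|
      ≤ 3 / 2 * (‖a - b‖ * ‖r - s‖ * (‖p‖ + ‖q‖)) := by
  have h : frm a b p q r s - inner ℝ (a - b)
      ((inner ℝ a r • p - inner ℝ a p • r) - (inner ℝ b s • q - inner ℝ b q • s))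
      = -omg a b (r - s) ((1 / 2 : ℝ) • (p + q)) + 1 / 4 * ‖a - b‖ ^ 2 * inner ℝ (r - s) (p - q) := by
    rw [frm, real_inner_comm (r - s) (p - q)]
    simp only [omg, inner_sub_left, inner_sub_right, inner_add_right, real_inner_smul_right]
    ring
  rw [h]
  refine (abs_add_le _ _).trans ?_
  rw [abs_neg]
  have h1 := abs_omg_le ha b (r - s) ((1 / 2 : ℝ) • (p + q))
  have h2 := abs_quarter_le ha hb (r - s) p q
  have h3 : 2 * ‖a - b‖ * ‖r - s‖ * ‖(1 / 2 : ℝ) • (p + q)‖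
      ≤ 2 * ‖a - b‖ * ‖r - s‖ * (1 / 2 * (‖p‖ + ‖q‖)) := by
    gcongr; exact norm_half_add_le p q
  linarith

end Algebra

/-- Weighted Fourier sums of a vector-valued map. -/
def hWV {n : ℕ} (ω : ℕ → ℝ) (u : ℝ → E n) : ℝ≥0∞ := ∑ i, hW ω fun x => u x i

section

variable {n : ℕ}

lemma ennreal_sq_sum_le (a : Fin n → ℝ≥0∞) : (∑ i, a i) ^ 2 ≤ n * ∑ i, a i ^ 2 := by
  have h := ENNReal.inner_le_Lp_mul_Lq Finset.univ (fun _ : Fin n => 1) a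
    (p := 2) (q := 2) ⟨by norm_num, by norm_num, by norm_num⟩
  simp only [one_mul, Finset.sum_const, Finset.card_univ, Fintype.card_fin,
    nsmul_eq_mul, mul_one, one_pow, ENNReal.rpow_two] at h
  calc (∑ i, a i) ^ 2 ≤ ((n : ℝ≥0∞) ^ (1 / 2 : ℝ) * (∑ i, a i ^ 2) ^ (1 / 2 : ℝ)) ^ 2 := by gcongr
    _ = n * ∑ i, a i ^ 2 := by
      rw [mul_pow, ← ENNReal.rpow_two, ← ENNReal.rpow_two, ← ENNReal.rpow_mul, ← ENNReal.rpow_mul]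
      norm_num

lemma sum_sq_le_sq_sum' (a : Fin n → ℝ≥0∞) : ∑ i, a i ^ 2 ≤ (∑ i, a i) ^ 2 := by
  simp_rw [sq, Finset.sum_mul]
  exact Finset.sum_le_sum fun i _ => mul_le_mul_right
    (Finset.single_le_sum (f := a) (fun j _ => zero_le) (Finset.mem_univ i)) _

lemma measurable_glV {u : ℝ → E n} (hu : Measurable u) : Measurable (gl u) := by
  unfold gl
  refine Measurable.lintegral_prod_right' (f := fun p : ℝ × ℝ => kapD p * ‖u p.1 - u p.2‖ₑ ^ 2) ?_
  have := measurable_kapD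
  fun_prop

lemma gl_eq_sum {u : ℝ → E n} (hu : Measurable u) (x : ℝ) : gl u x = ∑ i, gl (fun x => u x i) x := by
  have := hu.comp_apply
  have hk := measurable_kapD
  simp only [gl, enorm_sq_eq_sum, PiLp.sub_apply, Finset.mul_sum]
  exact lintegral_finsetSum _ fun i _ => by fun_prop

lemma lintegral_gl_sq_le_vec {u : ℝ → E n} (hu : ∀ i, BddPer fun x => u x i) :
    ∫⁻ x in circ, gl u x ^ 2
      ≤ n * (ENNReal.ofReal (192 * π ^ 3) * hWV (fun k => k * √k) u ^ 2) := by
  have hm : Measurable u := measurable_of_apply fun i => (hu i).meas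
  calc ∫⁻ x in circ, gl u x ^ 2
      ≤ ∫⁻ x in circ, n * ∑ i, gl (fun x => u x i) x ^ 2 := lintegral_mono fun x => by
        rw [gl_eq_sum hm]; exact ennreal_sq_sum_le _
    _ = n * ∑ i, ∫⁻ x in circ, gl (fun x => u x i) x ^ 2 := by
        rw [lintegral_const_mul' _ _ (ENNReal.natCast_ne_top n), lintegral_finsetSum]
        exact fun i _ => (measurable_gl (hu i).meas).pow_const 2
    _ ≤ n * ∑ i, ENNReal.ofReal (192 * π ^ 3) * hW (fun k => k * √k) (fun x => u x i) ^ 2 := by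
        gcongr with i _; exact lintegral_gl_sq_le (hu i)
    _ ≤ _ := by
        rw [← Finset.mul_sum]
        gcongr
        exact sum_sq_le_sq_sum' _

lemma lintegral_pow_four_le_vec {u : ℝ → E n} (hu : ∀ i, BddPer fun x => u x i)
    (h0 : ∀ i, fcR (fun x => u x i) 0 = 0) :
    ∫⁻ x in circ, ‖u x‖ₑ ^ 4 ≤ n * (ENNReal.ofReal (48 * π) * hWV (fun k => √k) u ^ 2) := by
  calc ∫⁻ x in circ, ‖u x‖ₑ ^ 4
      ≤ ∫⁻ x in circ, n * ∑ i, ‖u x i‖ₑ ^ 4 := lintegral_mono fun x => by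
        rw [show 4 = 2 * 2 from rfl, pow_mul, enorm_sq_eq_sum]
        simp_rw [pow_mul]
        exact ennreal_sq_sum_le _
    _ = n * ∑ i, ∫⁻ x in circ, ‖u x i‖ₑ ^ 4 := by
        rw [lintegral_const_mul' _ _ (ENNReal.natCast_ne_top n), lintegral_finsetSum]
        exact fun i _ => (hu i).meas.enorm.pow_const 4
    _ ≤ n * ∑ i, ENNReal.ofReal (48 * π) * hW (fun k => √k) (fun x => u x i) ^ 2 := by
        gcongr with i _; exact lintegral_pow_four_le (hu i) (h0 i)
    _ ≤ _ := by
        rw [← Finset.mul_sum]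
        gcongr
        exact sum_sq_le_sq_sum' _

lemma trilin_pow_four_le {u l φ : ℝ → E n} (hu : Measurable u) (hl : Measurable l)
    (hφ : Measurable φ) :
    (∫⁻ p, ‖u p.1 - u p.2‖ₑ * (‖l p.1 - l p.2‖ₑ * ‖φ p.1‖ₑ) ∂kap) ^ 4
      ≤ gag u ^ 2 * ((∫⁻ x in circ, gl l x ^ 2) * ∫⁻ x in circ, ‖φ x‖ₑ ^ 4) := by
  have hk := measurable_kapD
  have h1 := lintegral_mul_sq_le (μ := kap) (f := fun p : ℝ × ℝ => ‖u p.1 - u p.2‖ₑ)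
    (g := fun p => ‖l p.1 - l p.2‖ₑ * ‖φ p.1‖ₑ) (by fun_prop) (by fun_prop)
  have h2 : ∫⁻ p, (‖l p.1 - l p.2‖ₑ * ‖φ p.1‖ₑ) ^ 2 ∂kap
      = ∫⁻ x in circ, gl l x * ‖φ x‖ₑ ^ 2 := by
    rw [lintegral_kap (by fun_prop)]
    refine lintegral_congr fun x => ?_
    rw [gl, ← lintegral_mul_const _ (by fun_prop)]
    refine lintegral_congr fun y => ?_
    ring
  have h3 := lintegral_mul_sq_le (μ := circMeasure) (f := gl l) (g := fun x => ‖φ x‖ₑ ^ 2)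
    (measurable_glV hl).aemeasurable (by fun_prop)
  simp_rw [← pow_mul] at h3
  rw [h2] at h1
  calc _ = ((∫⁻ p, ‖u p.1 - u p.2‖ₑ * (‖l p.1 - l p.2‖ₑ * ‖φ p.1‖ₑ) ∂kap) ^ 2) ^ 2 :=
        pow_mul _ 2 2
    _ ≤ (gag u * ∫⁻ x in circ, gl l x * ‖φ x‖ₑ ^ 2) ^ 2 := by gcongr; exact h1
    _ = gag u ^ 2 * (∫⁻ x in circ, gl l x * ‖φ x‖ₑ ^ 2) ^ 2 := mul_pow _ _ _
    _ ≤ _ := by gcongr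

lemma trilin_sq_le {u l φ : ℝ → E n} (hu : Measurable u) (hl : ∀ i, BddPer fun x => l x i)
    (hφ : ∀ i, BddPer fun x => φ x i) (h0 : ∀ i, fcR (fun x => φ x i) 0 = 0) :
    (∫⁻ p, ‖u p.1 - u p.2‖ₑ * (‖l p.1 - l p.2‖ₑ * ‖φ p.1‖ₑ) ∂kap) ^ 2
      ≤ gag u * (n * (ENNReal.ofReal (96 * π ^ 2)
        * (hWV (fun k => k * √k) l * hWV (fun k => √k) φ))) := by
  rw [← ENNReal.pow_le_pow_left_iff two_ne_zero, ← pow_mul]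
  refine (trilin_pow_four_le hu (measurable_of_apply fun i => (hl i).meas)
    (measurable_of_apply fun i => (hφ i).meas)).trans ?_
  refine (mul_le_mul_right (mul_le_mul' (lintegral_gl_sq_le_vec hl)
    (lintegral_pow_four_le_vec hφ h0)) _).trans (le_of_eq ?_)
  have h : ENNReal.ofReal (192 * π ^ 3) * ENNReal.ofReal (48 * π)
      = ENNReal.ofReal (96 * π ^ 2) ^ 2 := by
    rw [← ENNReal.ofReal_mul (by positivity), ← ENNReal.ofReal_pow (by positivity)]
    congr 1; ring
  simp only [mul_pow]
  rw [← h]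
  ring

end

section

variable {n : ℕ}

lemma integrable_and_enorm_integral_le {u l φ : ℝ → E n} (hu : FinV u) (hl : FinV l) (hφ : FinV φ)
    {G : ℝ × ℝ → ℝ} (hG : Measurable G)
    (hb : ∀ p, |G p| ≤ 3 / 2 * (‖u p.1 - u p.2‖ * ‖l p.1 - l p.2‖ * (‖φ p.1‖ + ‖φ p.2‖))) :
    Integrable G kap ∧
      ‖∫ p, G p ∂kap‖ₑ ≤ 3 * ∫⁻ p, ‖u p.1 - u p.2‖ₑ * (‖l p.1 - l p.2‖ₑ * ‖φ p.1‖ₑ) ∂kap := by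
  obtain ⟨C, hC⟩ := hφ.bdd
  have h1 := hu.meas
  have h2 := hl.meas
  have h3 := hφ.meas
  have hint : Integrable (fun p : ℝ × ℝ => ‖u p.1 - u p.2‖ * ‖l p.1 - l p.2‖) kap :=
    hu.memLp.norm.integrable_mul hl.memLp.norm
  refine ⟨(hint.mul_const (3 / 2 * (C + C))).mono hG.aestronglyMeasurable
    (ae_of_all _ fun p => ?_), ?_⟩
  · refine (hb p).trans (le_trans ?_ (le_abs_self _))
    rw [mul_comm (3 / 2 : ℝ), mul_assoc, mul_comm (‖φ p.1‖ + ‖φ p.2‖)]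
    gcongr
    · exact hC _
    · exact hC _
  set F : ℝ × ℝ → ℝ≥0∞ := fun p => ‖u p.1 - u p.2‖ₑ * (‖l p.1 - l p.2‖ₑ * ‖φ p.1‖ₑ) with hF
  have hFm : Measurable F := by fun_prop
  have hsw : ∫⁻ p, F p.swap ∂kap = ∫⁻ p, F p ∂kap := lintegral_kap_swap hFm
  calc ‖∫ p, G p ∂kap‖ₑ ≤ ∫⁻ p, ‖G p‖ₑ ∂kap := enorm_integral_le_lintegral_enorm _
    _ ≤ ∫⁻ p, ENNReal.ofReal (3 / 2) * (F p + F p.swap) ∂kap := by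
        refine lintegral_mono fun p => ?_
        have e : ENNReal.ofReal (3 / 2) * (F p + F p.swap) = ENNReal.ofReal
            (3 / 2 * (‖u p.1 - u p.2‖ * ‖l p.1 - l p.2‖ * (‖φ p.1‖ + ‖φ p.2‖))) := by
          rw [ENNReal.ofReal_mul (by norm_num), ENNReal.ofReal_mul (by positivity),
            ENNReal.ofReal_mul (by positivity), ENNReal.ofReal_add (by positivity) (by positivity)]
          simp only [hF, Prod.fst_swap, Prod.snd_swap, ofReal_norm]
          rw [enorm_sub_rev (u p.2), enorm_sub_rev (l p.2)]
          ring
        rw [e, ← ofReal_norm]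
        exact ENNReal.ofReal_le_ofReal (hb p)
    _ = ENNReal.ofReal (3 / 2) * (∫⁻ p, F p ∂kap + ∫⁻ p, F p ∂kap) := by
        rw [lintegral_const_mul' _ _ ENNReal.ofReal_ne_top, lintegral_add_left hFm, hsw]
    _ = 3 * ∫⁻ p, F p ∂kap := by
        rw [← two_mul, ← mul_assoc]
        congr 1
        rw [← ENNReal.ofReal_ofNat 2, ← ENNReal.ofReal_mul (by norm_num)]
        norm_num

lemma measurable_inner' {α : Type*} [MeasurableSpace α] {f g : α → E n} (hf : Measurable f)
    (hg : Measurable g) : Measurable fun x => (inner ℝ (f x) (g x) : ℝ) := hf.inner hg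

lemma measurable_frm {u v φ : ℝ → E n} (hu : Measurable u) (hv : Measurable v)
    (hφ : Measurable φ) :
    Measurable fun p : ℝ × ℝ => frm (u p.1) (u p.2) (v p.1) (v p.2) (φ p.1) (φ p.2) := by
  have m1 : ∀ {f : ℝ → E n}, Measurable f → Measurable fun p : ℝ × ℝ => f p.1 :=
    fun hf => hf.comp measurable_fst
  have m2 : ∀ {f : ℝ → E n}, Measurable f → Measurable fun p : ℝ × ℝ => f p.2 :=
    fun hf => hf.comp measurable_snd
  have e1 := ((m1 hφ).add (m2 hφ)).const_smul (1 / 2 : ℝ)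
  have e2 := (m1 hv).sub (m2 hv)
  exact (((measurable_inner' (m2 hu) e1).mul (measurable_inner' (m1 hu) e2)).sub
    ((measurable_inner' (m1 hu) e1).mul (measurable_inner' (m2 hu) e2))).add
    (((((m1 hu).sub (m2 hu)).norm.pow_const 2).const_mul (1 / 4)).mul
      (measurable_inner' e2 ((m1 hφ).sub (m2 hφ))))

lemma enorm_four_add_le {a b c d : ℝ} {A B C D : ℝ≥0∞} (ha : ‖a‖ₑ ≤ A) (hb : ‖b‖ₑ ≤ B)
    (hc : ‖c‖ₑ ≤ C) (hd : ‖d‖ₑ ≤ D) : ‖-a + b + c + -d‖ₑ ≤ A + B + C + D := by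
  rw [← enorm_neg] at ha hd
  exact (enorm_add_le _ _).trans (add_le_add ((enorm_add_le _ _).trans
    (add_le_add ((enorm_add_le _ _).trans (add_le_add ha hb)) hc)) hd)

namespace SliceSol

variable {u w : ℝ → E n} (h : SliceSol u w)
include h

omit h in
lemma enorm_integral_inner_le (φ : ℝ → E n) :
    ‖∫ x in circ, inner ℝ (w x) (φ x)‖ₑ ≤ ∫⁻ x in circ, ‖w x‖ₑ * ‖φ x‖ₑ := by
  refine (enorm_integral_le_lintegral_enorm _).trans (lintegral_mono fun x => ?_)
  rw [← ofReal_norm, ← ofReal_norm (w x), ← ofReal_norm (φ x), ← ENNReal.ofReal_mul (norm_nonneg _)]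
  exact ENNReal.ofReal_le_ofReal (norm_inner_le_norm _ _)

lemma enorm_pairing_le_aux {l φ v ψ : ℝ → E n} (hl : FinV l) (hφ : FinV φ) (hv : FinV v)
    (hψ : FinV ψ) (hvdef : ∀ x, v x = u x - l x)
    (hψdef : ∀ x, ψ x = (inner ℝ (u x) (φ x) : ℝ) • v x - (inner ℝ (u x) (v x) : ℝ) • φ x) :
    ‖∫ p, (inner ℝ (u p.1 - u p.2) (φ p.1 - φ p.2) : ℝ) ∂kap‖ₑ
      ≤ (∫⁻ x in circ, ‖w x‖ₑ * ‖φ x‖ₑ)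
        + 3 * (∫⁻ p, ‖u p.1 - u p.2‖ₑ * (‖l p.1 - l p.2‖ₑ * ‖φ p.1‖ₑ) ∂kap)
        + 3 * (∫⁻ p, ‖u p.1 - u p.2‖ₑ * (‖φ p.1 - φ p.2‖ₑ * ‖v p.1‖ₑ) ∂kap)
        + 2 * ∫⁻ x in circ, ‖w x‖ₑ * (‖φ x‖ₑ * ‖v x‖ₑ) := by
  have hu := h.fin
  have h1 := h.norm_one
  have huψ : ∀ x, (inner ℝ (u x) (ψ x) : ℝ) = 0 := fun x => by
    rw [hψdef, inner_sub_right, real_inner_smul_right, real_inner_smul_right]; ring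
  have eφ := h.eq_vec hφ
  have eψ := h.eq_vec hψ
  simp only [huψ, mul_zero, integral_zero] at eψ
  set A : ℝ × ℝ → ℝ := fun p => ‖u p.1 - u p.2‖ ^ 2 * inner ℝ (u p.1) (φ p.1) with hA
  have hAint : Integrable A kap := by
    obtain ⟨C, hC⟩ : ∃ C : ℝ, ∀ x, |(inner ℝ (u x) (φ x) : ℝ)| ≤ C := (hu.inner hφ).bdd
    exact integrable_mul_bdd (G := fun p => inner ℝ (u p.1) (φ p.1)) (C := C) h.integrable_norm_sq
      ((hu.inner hφ).meas.comp measurable_fst) fun p => hC p.1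
  have hAsw : Integrable (fun p => A p.swap) kap := by
    have e := measurePreserving_swap_kap.integrable_comp_of_integrable hAint
    exact e
  obtain ⟨i1, b1⟩ := integrable_and_enorm_integral_le hu hl hφ
    (measurable_frm hu.meas hl.meas hφ.meas)
    (fun p => abs_frm_le (h1 p.1) (h1 p.2) (l p.1) (l p.2) (φ p.1) (φ p.2))
  obtain ⟨i2, -⟩ := integrable_and_enorm_integral_le hu hv hφ
    (measurable_frm hu.meas hv.meas hφ.meas)
    (fun p => abs_frm_le (h1 p.1) (h1 p.2) (v p.1) (v p.2) (φ p.1) (φ p.2))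
  have hpm : Measurable fun p : ℝ × ℝ => (inner ℝ (u p.1 - u p.2) (ψ p.1 - ψ p.2) : ℝ) :=
    measurable_inner' ((hu.meas.comp measurable_fst).sub (hu.meas.comp measurable_snd))
      ((hψ.meas.comp measurable_fst).sub (hψ.meas.comp measurable_snd))
  obtain ⟨i3, b3⟩ := integrable_and_enorm_integral_le hu hφ hv
    ((measurable_frm hu.meas hv.meas hφ.meas).sub hpm)
    (fun p => by
      simp only [Pi.sub_apply, hψdef]
      exact abs_frm_sub_le (h1 p.1) (h1 p.2) (v p.1) (v p.2) (φ p.1) (φ p.2))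
  have eA : ∫ p, A p ∂kap
      = (∫ p, frm (u p.1) (u p.2) (l p.1) (l p.2) (φ p.1) (φ p.2) ∂kap)
        + ∫ p, frm (u p.1) (u p.2) (v p.1) (v p.2) (φ p.1) (φ p.2) ∂kap := by
    have e1 : ∫ p, A p ∂kap = ∫ p, 1 / 2 * (A p + A p.swap) ∂kap := by
      rw [integral_const_mul, integral_add hAint hAsw, integral_kap_swap A]
      ring
    have e4 : (fun p => 1 / 2 * (A p + A p.swap)) = fun p =>
        frm (u p.1) (u p.2) (l p.1) (l p.2) (φ p.1) (φ p.2)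
          + frm (u p.1) (u p.2) (v p.1) (v p.2) (φ p.1) (φ p.2) := by
      funext p
      have e2 := frm_self (h1 p.1) (h1 p.2) (φ p.1) (φ p.2)
      have e3 := frm_sub (u p.1) (u p.2) (u p.1) (u p.2) (l p.1) (l p.2) (φ p.1) (φ p.2)
      simp only [hA, hvdef, Prod.fst_swap, Prod.snd_swap]
      rw [norm_sub_rev (u p.2)]
      linarith
    rw [e1, ← integral_add i1 i2, e4]
  have i4 : Integrable (fun p : ℝ × ℝ => (inner ℝ (u p.1 - u p.2) (ψ p.1 - ψ p.2) : ℝ)) kap := by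
    have := i2.sub i3
    rwa [sub_sub_cancel] at this
  rw [integral_sub' i2 i4] at b3
  have hP : ∫ p, (inner ℝ (u p.1 - u p.2) (φ p.1 - φ p.2) : ℝ) ∂kap
      = -(∫ x in circ, inner ℝ (w x) (φ x))
        + (∫ p, frm (u p.1) (u p.2) (l p.1) (l p.2) (φ p.1) (φ p.2) ∂kap)
        + ((∫ p, frm (u p.1) (u p.2) (v p.1) (v p.2) (φ p.1) (φ p.2) ∂kap)
          - ∫ p, (inner ℝ (u p.1 - u p.2) (ψ p.1 - ψ p.2) : ℝ) ∂kap)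
        + -(∫ x in circ, inner ℝ (w x) (ψ x)) := by
    linarith
  have b4 : ∫⁻ x in circ, ‖w x‖ₑ * ‖ψ x‖ₑ ≤ 2 * ∫⁻ x in circ, ‖w x‖ₑ * (‖φ x‖ₑ * ‖v x‖ₑ) := by
    rw [← lintegral_const_mul' _ _ ENNReal.ofNat_ne_top]
    refine lintegral_mono fun x => (?_ : ‖w x‖ₑ * ‖ψ x‖ₑ ≤ 2 * (‖w x‖ₑ * (‖φ x‖ₑ * ‖v x‖ₑ)))
    have hx : ‖ψ x‖ ≤ 2 * (‖φ x‖ * ‖v x‖) := by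
      rw [hψdef]
      have k0 := norm_sub_le ((inner ℝ (u x) (φ x) : ℝ) • v x) ((inner ℝ (u x) (v x) : ℝ) • φ x)
      rw [norm_smul, norm_smul] at k0
      have k1 := norm_inner_le_norm (𝕜 := ℝ) (u x) (φ x)
      have k2 := norm_inner_le_norm (𝕜 := ℝ) (u x) (v x)
      rw [h1 x, one_mul] at k1 k2
      have k3 := mul_le_mul_of_nonneg_right k1 (norm_nonneg (v x))
      have k4 := mul_le_mul_of_nonneg_right k2 (norm_nonneg (φ x))
      linarith
    have hx' : ‖ψ x‖ₑ ≤ 2 * (‖φ x‖ₑ * ‖v x‖ₑ) := by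
      rw [← ofReal_norm, ← ofReal_norm (φ x), ← ofReal_norm (v x),
        ← ENNReal.ofReal_mul (norm_nonneg _)]
      refine (ENNReal.ofReal_le_ofReal hx).trans ?_
      rw [ENNReal.ofReal_mul zero_le_two, ENNReal.ofReal_ofNat]
    calc ‖w x‖ₑ * ‖ψ x‖ₑ ≤ ‖w x‖ₑ * (2 * (‖φ x‖ₑ * ‖v x‖ₑ)) := by gcongr
      _ = _ := by ring
  rw [hP]
  exact enorm_four_add_le (enorm_integral_inner_le φ) b1 b3 ((enorm_integral_inner_le ψ).trans b4)

lemma enorm_pairing_le {l φ : ℝ → E n} (hl : FinV l) (hφ : FinV φ) :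
    ‖∫ p, (inner ℝ (u p.1 - u p.2) (φ p.1 - φ p.2) : ℝ) ∂kap‖ₑ
      ≤ (∫⁻ x in circ, ‖w x‖ₑ * ‖φ x‖ₑ)
        + 3 * (∫⁻ p, ‖u p.1 - u p.2‖ₑ * (‖l p.1 - l p.2‖ₑ * ‖φ p.1‖ₑ) ∂kap)
        + 3 * (∫⁻ p, ‖u p.1 - u p.2‖ₑ * (‖φ p.1 - φ p.2‖ₑ * ‖u p.1 - l p.1‖ₑ) ∂kap)
        + 2 * ∫⁻ x in circ, ‖w x‖ₑ * (‖φ x‖ₑ * ‖u x - l x‖ₑ) :=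
  h.enorm_pairing_le_aux (v := fun x => u x - l x)
    (ψ := fun x => (inner ℝ (u x) (φ x) : ℝ) • (u x - l x) - (inner ℝ (u x) (u x - l x) : ℝ) • φ x)
    hl hφ (h.fin.sub hl) ((FinV.smul (h.fin.inner hφ) (h.fin.sub hl)).sub
    (FinV.smul (h.fin.inner (h.fin.sub hl)) hφ)) (fun _ => rfl) (fun _ => rfl)

lemma enorm_pairing_le' {φ : ℝ → E n} (hφ : FinV φ) :
    ‖∫ p, (inner ℝ (u p.1 - u p.2) (φ p.1 - φ p.2) : ℝ) ∂kap‖ₑ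
      ≤ (∫⁻ x in circ, ‖w x‖ₑ * ‖φ x‖ₑ) + ∫⁻ x in circ, gl u x * ‖φ x‖ₑ := by
  have hum := h.fin.meas
  have hφm := hφ.meas
  have hk := measurable_kapD
  have e := h.eq_vec hφ
  have e2 : ∫ p, (inner ℝ (u p.1 - u p.2) (φ p.1 - φ p.2) : ℝ) ∂kap
      = -(∫ x in circ, inner ℝ (w x) (φ x))
        + ∫ p, ‖u p.1 - u p.2‖ ^ 2 * inner ℝ (u p.1) (φ p.1) ∂kap := by
    rw [← e]; ring
  have e3 : ∫⁻ p, ‖u p.1 - u p.2‖ₑ ^ 2 * ‖φ p.1‖ₑ ∂kap = ∫⁻ x in circ, gl u x * ‖φ x‖ₑ := by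
    rw [lintegral_kap (by fun_prop)]
    refine lintegral_congr fun x => ?_
    rw [gl, ← lintegral_mul_const _ (by fun_prop)]
    refine lintegral_congr fun y => ?_
    ring
  rw [e2, ← e3]
  refine (enorm_add_le _ _).trans (add_le_add ?_ ?_)
  · rw [enorm_neg]; exact enorm_integral_inner_le φ
  · refine (enorm_integral_le_lintegral_enorm _).trans (lintegral_mono fun p => ?_)
    rw [enorm_mul, enorm_pow, enorm_norm]
    gcongr
    rw [← ofReal_norm, ← ofReal_norm (φ p.1)]
    refine ENNReal.ofReal_le_ofReal ((norm_inner_le_norm _ _).trans ?_)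
    rw [h.norm_one, one_mul]

end SliceSol

end

section

variable {n : ℕ}

/-- Partial sums of `hWV`. -/
def fsum (ω : ℕ → ℝ) (K : ℕ) (u : ℝ → E n) : ℝ :=
  ∑ i, ∑ k ∈ Finset.Icc (-(K : ℤ)) K, ω k.natAbs * ‖fcR (fun x => u x i) k‖ ^ 2

lemma fsum_nonneg {ω : ℕ → ℝ} (hω : ∀ k, 0 ≤ ω k) (K : ℕ) (u : ℝ → E n) : 0 ≤ fsum ω K u :=
  Finset.sum_nonneg fun _ _ => Finset.sum_nonneg fun _ _ => mul_nonneg (hω _) (sq_nonneg _)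

lemma fsum_mono {ω ω' : ℕ → ℝ} (K : ℕ) (h : ∀ k ≤ K, ω k ≤ ω' k) (u : ℝ → E n) :
    fsum ω K u ≤ fsum ω' K u := by
  refine Finset.sum_le_sum fun i _ => Finset.sum_le_sum fun k hk => ?_
  rw [Finset.mem_Icc] at hk
  exact mul_le_mul_of_nonneg_right (h _ (by omega)) (sq_nonneg _)

lemma ofReal_mul_norm_sq {a : ℝ} (ha : 0 ≤ a) (z : ℂ) :
    ENNReal.ofReal (a * ‖z‖ ^ 2) = ENNReal.ofReal a * ‖z‖ₑ ^ 2 := by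
  rw [ENNReal.ofReal_mul ha, ENNReal.ofReal_pow (norm_nonneg _), ofReal_norm]

lemma ofReal_fsum {ω : ℕ → ℝ} (hω : ∀ k, 0 ≤ ω k) (K : ℕ) (u : ℝ → E n) :
    ENNReal.ofReal (fsum ω K u) = ∑ i, ∑ k ∈ Finset.Icc (-(K : ℤ)) K,
      ENNReal.ofReal (ω k.natAbs) * ‖fcR (fun x => u x i) k‖ₑ ^ 2 := by
  rw [fsum, ENNReal.ofReal_sum_of_nonneg fun i _ => Finset.sum_nonneg fun _ _ =>
    mul_nonneg (hω _) (sq_nonneg _)]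
  refine Finset.sum_congr rfl fun i _ => ?_
  rw [ENNReal.ofReal_sum_of_nonneg fun i _ => mul_nonneg (hω _) (sq_nonneg _)]
  exact Finset.sum_congr rfl fun k _ => ofReal_mul_norm_sq (hω _) _

lemma ofReal_fsum_le {ω : ℕ → ℝ} (hω : ∀ k, 0 ≤ ω k) (K : ℕ) (u : ℝ → E n) :
    ENNReal.ofReal (fsum ω K u) ≤ hWV ω u := by
  rw [ofReal_fsum hω]
  exact Finset.sum_le_sum fun i _ => ENNReal.sum_le_tsum _

lemma tendsto_Icc_neg_atTop : Tendsto (fun K : ℕ => Finset.Icc (-(K : ℤ)) K) atTop atTop := by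
  refine tendsto_atTop_finset_of_monotone (fun a b hab => ?_) fun k => ⟨k.natAbs, ?_⟩
  · exact Finset.Icc_subset_Icc (by omega) (by omega)
  · rw [Finset.mem_Icc]; omega

lemma hWV_le_of_fsum_le {ω : ℕ → ℝ} (hω : ∀ k, 0 ≤ ω k) {u : ℝ → E n} {R : ℝ≥0∞}
    (h : ∀ K, ENNReal.ofReal (fsum ω K u) ≤ R) : hWV ω u ≤ R := by
  have ht : Tendsto (fun K => ENNReal.ofReal (fsum ω K u)) atTop (𝓝 (hWV ω u)) := by
    simp_rw [ofReal_fsum hω]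
    exact tendsto_finsetSum _ fun i _ =>
      (ENNReal.summable.hasSum (f := fun k : ℤ =>
        ENNReal.ofReal (ω k.natAbs) * ‖fcR (fun x => u x i) k‖ₑ ^ 2)).comp tendsto_Icc_neg_atTop
  exact le_of_tendsto' ht h

lemma hWV_le {ω ω' : ℕ → ℝ} (hω : ∀ k, 0 ≤ ω k) {u v : ℝ → E n}
    (h : ∀ i k, ω k.natAbs * ‖fcR (fun x => u x i) k‖ ^ 2
      ≤ ω' k.natAbs * ‖fcR (fun x => v x i) k‖ ^ 2) (hω' : ∀ k, 0 ≤ ω' k) :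
    hWV ω u ≤ hWV ω' v := by
  refine hWV_le_of_fsum_le hω fun K => le_trans (ENNReal.ofReal_le_ofReal ?_)
    (ofReal_fsum_le hω' K v)
  exact Finset.sum_le_sum fun i _ => Finset.sum_le_sum fun k _ => h i k

lemma hWV_const_mul {c : ℝ} (hc : 0 ≤ c) (ω : ℕ → ℝ) (u : ℝ → E n) :
    hWV (fun k => c * ω k) u = ENNReal.ofReal c * hWV ω u := by
  simp only [hWV, hW, Finset.mul_sum]
  refine Finset.sum_congr rfl fun i _ => ?_
  rw [← ENNReal.tsum_mul_left]
  refine tsum_congr fun k => ?_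
  rw [ENNReal.ofReal_mul hc, mul_assoc]

/-- The truncated Fourier multiplier with symbol `m(|k|)`. -/
def mulT (m : ℕ → ℝ) (K : ℕ) (u : ℝ → E n) : ℝ → E n := fun x =>
  WithLp.toLp 2 fun i => trg K (fun k => (m k.natAbs : ℂ) * fcR (fun x => u x i) k) x

lemma herm_mulT (m : ℕ → ℝ) (f : ℝ → ℝ) : Herm fun k => (m k.natAbs : ℂ) * fcR f k :=
  (herm_fcR f).mul_real (m := fun k => m k.natAbs) fun k => by rw [Int.natAbs_neg]

lemma finV_mulT (m : ℕ → ℝ) (K : ℕ) (u : ℝ → E n) : FinV (mulT m K u) :=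
  fun _ => finEnergy_trg K (herm_mulT m _)

lemma fcR_mulT (m : ℕ → ℝ) (K : ℕ) (u : ℝ → E n) (i : Fin n) (k : ℤ) :
    fcR (fun x => mulT m K u x i) k
      = if k ∈ Finset.Icc (-(K : ℤ)) K then (m k.natAbs : ℂ) * fcR (fun x => u x i) k else 0 :=
  fcR_trg (herm_mulT m _) K k

lemma hWV_mulT {ω : ℕ → ℝ} (hω : ∀ k, 0 ≤ ω k) (m : ℕ → ℝ) (K : ℕ) (u : ℝ → E n) :
    hWV ω (mulT m K u) = ENNReal.ofReal (fsum (fun k => ω k * m k ^ 2) K u) := by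
  rw [ofReal_fsum fun k => mul_nonneg (hω k) (sq_nonneg _)]
  refine Finset.sum_congr rfl fun i _ => ?_
  rw [hW, tsum_eq_sum (s := Finset.Icc (-(K : ℤ)) K)]
  · refine Finset.sum_congr rfl fun k hk => ?_
    rw [fcR_mulT, if_pos hk, ← ofReal_mul_norm_sq (hω _),
      ← ofReal_mul_norm_sq (mul_nonneg (hω _) (sq_nonneg _)), norm_mul, Complex.norm_real,
      mul_pow, Real.norm_eq_abs, sq_abs, mul_assoc]
  · intro k hk
    rw [fcR_mulT, if_neg hk]; simp

lemma hWV_mulT_le {ω ω' m : ℕ → ℝ} (hω : ∀ k, 0 ≤ ω k) (hω' : ∀ k, 0 ≤ ω' k) (K : ℕ)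
    (h : ∀ k ≤ K, ω k * m k ^ 2 ≤ ω' k) (u : ℝ → E n) :
    hWV ω (mulT m K u) ≤ hWV ω' u := by
  rw [hWV_mulT hω]
  exact (ENNReal.ofReal_le_ofReal (fsum_mono K h u)).trans (ofReal_fsum_le hω' K u)

lemma integral_pairing_mulT {u : ℝ → E n} (hu : FinV u) (m : ℕ → ℝ) (K : ℕ) :
    ∫ p, (inner ℝ (u p.1 - u p.2) (mulT m K u p.1 - mulT m K u p.2) : ℝ) ∂kap
      = 4 * π ^ 2 * fsum (fun k => k * m k) K u := by
  simp only [inner_eq_sum, PiLp.sub_apply]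
  rw [integral_finsetSum _ fun i _ => (hu i).integrable_mul (finV_mulT m K u i), fsum,
    Finset.mul_sum]
  refine Finset.sum_congr rfl fun i _ => ?_
  refine (integral_pairing_trg (hu i) K (herm_mulT m _)).trans ?_
  congr 1
  refine Finset.sum_congr rfl fun k _ => ?_
  rw [map_mul, Complex.conj_ofReal, mul_left_comm, Complex.mul_conj, ← Complex.ofReal_mul,
    Complex.ofReal_re, Complex.normSq_eq_norm_sq, mul_assoc]

lemma lintegral_enorm_sq_eq_hWV {u : ℝ → E n} (hu : ∀ i, BddPer fun x => u x i) :
    ∫⁻ x in circ, ‖u x‖ₑ ^ 2 = ENNReal.ofReal (2 * π) * hWV (fun _ => 1) u := by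
  simp only [enorm_sq_eq_sum, hWV, Finset.mul_sum]
  rw [lintegral_finsetSum _ fun i _ => (hu i).meas.enorm.pow_const 2]
  refine Finset.sum_congr rfl fun i _ => ?_
  rw [lintegral_enorm_sq_eq (hu i)]
  simp [hW]

lemma gag_eq_hWV {u : ℝ → E n} (hu : FinV u) :
    gag u = ENNReal.ofReal (4 * π ^ 2) * hWV (fun k => (k : ℝ)) u := by
  rw [gag_eq_sum hu.meas, hWV, Finset.mul_sum]
  exact Finset.sum_congr rfl fun i _ => gag_eq (hu i).toBddPer

lemma le_ofReal_of_sq_le {a : ℝ≥0∞} {r : ℝ} (hr : 0 ≤ r) (h : a ^ 2 ≤ ENNReal.ofReal (r ^ 2)) :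
    a ≤ ENNReal.ofReal r := by
  rw [ENNReal.ofReal_pow hr] at h
  exact (ENNReal.pow_le_pow_left_iff two_ne_zero).1 h

end

section

variable {n : ℕ}

lemma mul_sqrt_nonneg (k : ℕ) : (0 : ℝ) ≤ k * √k := by positivity

namespace SliceSol

variable {u w : ℝ → E n} (h : SliceSol u w) {ε δ : ℝ}
include h

lemma lintegral_w_mul_le (hδ : 0 ≤ δ) (hw : ∫⁻ x in circ, ‖w x‖ₑ ^ 2 ≤ ENNReal.ofReal (δ ^ 2))
    {F : ℝ → ℝ≥0∞} (hF : Measurable F) {a : ℝ} (ha : 0 ≤ a)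
    (hFa : ∫⁻ x in circ, F x ^ 2 ≤ ENNReal.ofReal (a ^ 2)) :
    ∫⁻ x in circ, ‖w x‖ₑ * F x ≤ ENNReal.ofReal (δ * a) := by
  refine le_ofReal_of_sq_le (by positivity) ?_
  refine (lintegral_mul_sq_le h.wmeas.enorm.aemeasurable hF.aemeasurable).trans ?_
  rw [mul_pow, ENNReal.ofReal_mul (by positivity)]
  exact mul_le_mul' hw hFa

lemma lintegral_w_norm_le (hδ : 0 ≤ δ)
    (hw : ∫⁻ x in circ, ‖w x‖ₑ ^ 2 ≤ ENNReal.ofReal (δ ^ 2)) {φ : ℝ → E n} (hφ : FinV φ)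
    {a : ℝ} (ha : 0 ≤ a) (hφa : hWV (fun _ => 1) φ ≤ ENNReal.ofReal a) :
    ∫⁻ x in circ, ‖w x‖ₑ * ‖φ x‖ₑ ≤ ENNReal.ofReal (δ * √(2 * π * a)) := by
  have hpi := pi_pos
  refine h.lintegral_w_mul_le hδ hw hφ.meas.enorm (by positivity) ?_
  rw [Real.sq_sqrt (by positivity), ENNReal.ofReal_mul (by positivity),
    lintegral_enorm_sq_eq_hWV fun i => (hφ i).toBddPer]
  gcongr

omit h in
lemma trilin_le (hu : Measurable u) (hε : 0 ≤ ε) (hG : gag u ≤ ENNReal.ofReal (4 * π ^ 2 * ε ^ 2))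
    {l φ : ℝ → E n} (hl : FinV l) (hφ : FinV φ) (h0 : ∀ i, fcR (fun x => φ x i) 0 = 0)
    {a b y : ℝ} (ha : 0 ≤ a) (hy : 0 ≤ y) (hab : a * b = y ^ 2)
    (hla : hWV (fun k => k * √k) l ≤ ENNReal.ofReal a)
    (hφb : hWV (fun k => √k) φ ≤ ENNReal.ofReal b) :
    ∫⁻ p, ‖u p.1 - u p.2‖ₑ * (‖l p.1 - l p.2‖ₑ * ‖φ p.1‖ₑ) ∂kap
      ≤ ENNReal.ofReal (√(384 * π ^ 4 * n) * ε * y) := by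
  have hpi := pi_pos
  refine le_ofReal_of_sq_le (by positivity) ?_
  refine (trilin_sq_le hu (fun i => (hl i).toBddPer) (fun i => (hφ i).toBddPer) h0).trans ?_
  have e : (√(384 * π ^ 4 * n) * ε * y) ^ 2
      = (4 * π ^ 2 * ε ^ 2) * (n * (96 * π ^ 2 * (a * b))) := by
    rw [mul_pow, mul_pow, Real.sq_sqrt (by positivity), hab]; ring
  rw [e, ENNReal.ofReal_mul (p := 4 * π ^ 2 * ε ^ 2) (by positivity),
    ENNReal.ofReal_mul (p := n) (by positivity),
    ENNReal.ofReal_mul (p := 96 * π ^ 2) (by positivity), ENNReal.ofReal_mul ha,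
    ENNReal.ofReal_natCast]
  gcongr

lemma lintegral_w_mul_mul_le (hδ : 0 ≤ δ)
    (hw : ∫⁻ x in circ, ‖w x‖ₑ ^ 2 ≤ ENNReal.ofReal (δ ^ 2)) {φ v : ℝ → E n}
    (hφ : FinV φ) (hv : FinV v) (hφ0 : ∀ i, fcR (fun x => φ x i) 0 = 0)
    (hv0 : ∀ i, fcR (fun x => v x i) 0 = 0) {y : ℝ} (hy : 0 ≤ y)
    (hφy : hWV (fun k => √k) φ ≤ ENNReal.ofReal y) (hvy : hWV (fun k => √k) v ≤ ENNReal.ofReal y) :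
    ∫⁻ x in circ, ‖w x‖ₑ * (‖φ x‖ₑ * ‖v x‖ₑ) ≤ ENNReal.ofReal (δ * (√(48 * π * n) * y)) := by
  have hpi := pi_pos
  have hφm := hφ.meas
  have hvm := hv.meas
  have e : (√(48 * π * n) * y) ^ 2 = n * (48 * π * y ^ 2) := by
    rw [mul_pow, Real.sq_sqrt (by positivity)]; ring
  have h4 : ∀ {g : ℝ → E n}, FinV g → (∀ i, fcR (fun x => g x i) 0 = 0) →
      hWV (fun k => √k) g ≤ ENNReal.ofReal y →
      ∫⁻ x in circ, (‖g x‖ₑ ^ 2) ^ 2 ≤ ENNReal.ofReal ((√(48 * π * n) * y) ^ 2) := by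
    intro g hg hg0 hgy
    simp only [← pow_mul]
    refine (lintegral_pow_four_le_vec (fun i => (hg i).toBddPer) hg0).trans ?_
    rw [e, ENNReal.ofReal_mul (p := n) (by positivity),
      ENNReal.ofReal_mul (p := 48 * π) (by positivity), ENNReal.ofReal_natCast,
      ENNReal.ofReal_pow hy]
    gcongr
  refine h.lintegral_w_mul_le hδ hw (by fun_prop) (by positivity) ?_
  refine le_ofReal_of_sq_le (by positivity) ?_
  simp only [mul_pow]
  refine (lintegral_mul_sq_le (by fun_prop) (by fun_prop)).trans ?_
  have := mul_le_mul' (h4 hφ hφ0 hφy) (h4 hv hv0 hvy)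
  rw [← ENNReal.ofReal_mul (by positivity)] at this
  refine this.trans (ENNReal.ofReal_le_ofReal (le_of_eq ?_))
  ring

lemma hWV_min_le (hε : 0 ≤ ε) (hδ : 0 ≤ δ) (hG : gag u ≤ ENNReal.ofReal (4 * π ^ 2 * ε ^ 2))
    (hw : ∫⁻ x in circ, ‖w x‖ₑ ^ 2 ≤ ENNReal.ofReal (δ ^ 2))
    (hA : 6 * √(384 * π ^ 4 * n) * ε + 2 * √(48 * π * n) * δ ≤ 2 * π ^ 2)
    {N : ℕ} (hN : 1 ≤ N) :
    hWV (fun k => min (k : ℝ) N * √k) u ≤ ENNReal.ofReal (δ ^ 2) := by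
  have hpi := pi_pos
  have hN' : (1 : ℝ) ≤ N := by exact_mod_cast hN
  set Ω : ℕ → ℝ := fun k => min (k : ℝ) N * √k with hΩ
  have hΩ0 : ∀ k, 0 ≤ Ω k := fun k => by positivity
  have hfinY : hWV Ω u ≠ ⊤ := by
    have h1 : hWV Ω u ≤ hWV (fun k => N * (k : ℝ)) u := by
      refine hWV_le hΩ0 (fun i k => ?_) fun k => by positivity
      refine mul_le_mul_of_nonneg_right ?_ (sq_nonneg _)
      simp only [hΩ]
      refine mul_le_mul (min_le_right _ _) ?_ (sqrt_nonneg _) (by positivity)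
      rw [Real.sqrt_le_left (by positivity)]
      exact_mod_cast Nat.le_self_pow two_ne_zero _
    have h2 := h.fin.gag_lt_top
    rw [gag_eq_hWV h.fin] at h2
    rw [hWV_const_mul (by positivity)] at h1
    refine (h1.trans_lt (ENNReal.mul_lt_top ENNReal.ofReal_lt_top ?_)).ne
    refine lt_of_le_of_ne le_top fun hc => h2.ne ?_
    rw [hc, ENNReal.mul_top]
    simp
  obtain ⟨y, hy, hY⟩ : ∃ y : ℝ, 0 ≤ y ∧ hWV Ω u = ENNReal.ofReal y :=
    ⟨_, ENNReal.toReal_nonneg, (ENNReal.ofReal_toReal hfinY).symm⟩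
  set m : ℕ → ℝ := fun k => min (k : ℝ) N / √k with hm
  have hmΩ : ∀ k : ℕ, k * m k = Ω k := by
    intro k
    rcases Nat.eq_zero_or_pos k with rfl | hk
    · simp [hm, hΩ]
    · have hk' : (0 : ℝ) < k := by exact_mod_cast hk
      have hs : (0 : ℝ) < √k := sqrt_pos.2 hk'
      simp only [hm, hΩ]
      field_simp
      rw [Real.sq_sqrt hk'.le]
  have hm2 : ∀ k : ℕ, √k * m k ^ 2 = min (k : ℝ) N * m k := by
    intro k
    rcases Nat.eq_zero_or_pos k with rfl | hk
    · simp [hm]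
    · have hk' : (0 : ℝ) < k := by exact_mod_cast hk
      have hs : (0 : ℝ) < √k := sqrt_pos.2 hk'
      simp only [hm]
      field_simp
  have hm0 : ∀ k, 0 ≤ m k := fun k => by positivity
  have hmN : ∀ k : ℕ, (min (k : ℝ) N) ≤ N := fun k => min_le_right _ _
  have hmk : ∀ k : ℕ, (min (k : ℝ) N) ≤ k := fun k => min_le_left _ _
  have c2 : ∀ k : ℕ, √k * m k ^ 2 ≤ Ω k := fun k => by
    rw [hm2, ← hmΩ]; exact mul_le_mul_of_nonneg_right (hmk k) (hm0 k)
  have c3 : ∀ k : ℕ, (k * √k) * m k ^ 2 ≤ N * Ω k := fun k => by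
    rw [mul_assoc, hm2, mul_left_comm, hmΩ]
    exact mul_le_mul_of_nonneg_right (hmN k) (hΩ0 k)
  have c1 : ∀ k : ℕ, 1 * m k ^ 2 ≤ Ω k := fun k => by
    rcases Nat.eq_zero_or_pos k with rfl | hk
    · simp [hm, hΩ]
    · refine le_trans (mul_le_mul_of_nonneg_right ?_ (sq_nonneg _)) (c2 k)
      rw [Real.one_le_sqrt]
      exact_mod_cast hk
  set l := mulT (fun _ => 1) N u with hl
  have hlF : FinV l := finV_mulT _ _ _
  have hvF : FinV fun x => u x - l x := h.fin.sub hlF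
  have hvc : ∀ i k, fcR (fun x => (u x - l x) i) k
      = if k ∈ Finset.Icc (-(N : ℤ)) N then 0 else fcR (fun x => u x i) k := by
    intro i k
    have := fcR_sub (h.fin i).integrable (hlF i).integrable k
    simp only [PiLp.sub_apply]
    rw [this, hl, fcR_mulT]
    split_ifs <;> simp
  have hl3 : hWV (fun k => k * √k) l ≤ ENNReal.ofReal y := by
    rw [← hY]
    refine hWV_mulT_le mul_sqrt_nonneg hΩ0 N (fun k hk => ?_) u
    have : (k : ℝ) ≤ N := by exact_mod_cast hk
    simp [hΩ, min_eq_left this]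
  have hv1 : hWV (fun k => √k) (fun x => u x - l x) ≤ ENNReal.ofReal (y / N) := by
    have e : ENNReal.ofReal (y / N) = hWV (fun k => (N : ℝ)⁻¹ * Ω k) u := by
      rw [hWV_const_mul (by positivity), hY, ← ENNReal.ofReal_mul (by positivity), div_eq_inv_mul]
    rw [e]
    refine hWV_le (fun k => sqrt_nonneg _) (fun i k => ?_) fun k => by positivity
    rw [hvc]
    split_ifs with hk
    · simp only [norm_zero]
      rw [zero_pow two_ne_zero, mul_zero]
      positivity
    · refine mul_le_mul_of_nonneg_right (le_of_eq ?_) (sq_nonneg _)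
      rw [Finset.mem_Icc] at hk
      have : (N : ℝ) ≤ k.natAbs := by
        have : N ≤ k.natAbs := by omega
        exact_mod_cast this
      simp only [hΩ, min_eq_right this]
      field_simp
  have hv2 : hWV (fun k => √k) (fun x => u x - l x) ≤ ENNReal.ofReal y :=
    hv1.trans (ENNReal.ofReal_le_ofReal (div_le_self hy hN'))
  have hv0 : ∀ i, fcR (fun x => (u x - l x) i) 0 = 0 := fun i => by
    rw [hvc, if_pos (by simp)]
  have key : ∀ K, 4 * π ^ 2 * fsum Ω K u
      ≤ δ * √(2 * π * y) + 3 * (√(384 * π ^ 4 * n) * ε * y) + 3 * (√(384 * π ^ 4 * n) * ε * y)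
        + 2 * (δ * (√(48 * π * n) * y)) := by
    intro K
    set φ := mulT m K u with hφ
    have hφF : FinV φ := finV_mulT _ _ _
    have hφ0 : ∀ i, fcR (fun x => φ x i) 0 = 0 := fun i => by
      rw [hφ, fcR_mulT]
      simp [hm]
    have hφ1 : hWV (fun _ => 1) φ ≤ ENNReal.ofReal y := by
      rw [← hY]
      exact hWV_mulT_le (fun _ => zero_le_one) hΩ0 K (fun k _ => c1 k) u
    have hφ2 : hWV (fun k => √k) φ ≤ ENNReal.ofReal y := by
      rw [← hY]
      exact hWV_mulT_le (fun _ => sqrt_nonneg _) hΩ0 K (fun k _ => c2 k) u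
    have hφ3 : hWV (fun k => k * √k) φ ≤ ENNReal.ofReal (N * y) := by
      rw [ENNReal.ofReal_mul (by positivity), ← hY, ← hWV_const_mul (by positivity)]
      exact hWV_mulT_le mul_sqrt_nonneg (fun k => by positivity) K (fun k _ => c3 k) u
    have hle := h.enorm_pairing_le hlF hφF
    rw [integral_pairing_mulT h.fin] at hle
    simp only [hmΩ] at hle
    rw [← ofReal_norm] at hle
    have t1 := h.lintegral_w_norm_le hδ hw hφF hy hφ1
    have t2 := trilin_le h.fin.meas hε hG hlF hφF hφ0 hy hy (sq y).symm hl3 hφ2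
    have t3 := trilin_le h.fin.meas hε hG hφF hvF hv0 (by positivity : 0 ≤ N * y)
      hy (by field_simp) hφ3 hv1
    have t4 := h.lintegral_w_mul_mul_le hδ hw hφF hvF hφ0 hv0 hy hφ2 hv2
    have tot := hle.trans (add_le_add (add_le_add (add_le_add t1 (mul_le_mul_right t2 3))
      (mul_le_mul_right t3 3)) (mul_le_mul_right t4 2))
    rw [← ENNReal.ofReal_ofNat 3, ← ENNReal.ofReal_ofNat 2, ← ENNReal.ofReal_mul (by norm_num),
      ← ENNReal.ofReal_mul (by norm_num), ← ENNReal.ofReal_add (by positivity) (by positivity),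
      ← ENNReal.ofReal_add (by positivity) (by positivity),
      ← ENNReal.ofReal_add (by positivity) (by positivity),
      ENNReal.ofReal_le_ofReal_iff (by positivity)] at tot
    exact (le_abs_self _).trans tot
  set R := δ * √(2 * π * y) + 3 * (√(384 * π ^ 4 * n) * ε * y)
    + 3 * (√(384 * π ^ 4 * n) * ε * y) + 2 * (δ * (√(48 * π * n) * y)) with hR
  have hyR : 4 * π ^ 2 * y ≤ R := by
    have : hWV Ω u ≤ ENNReal.ofReal (R / (4 * π ^ 2)) :=
      hWV_le_of_fsum_le hΩ0 fun K => ENNReal.ofReal_le_ofReal (by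
        rw [le_div_iff₀ (by positivity)]; linarith [key K])
    rw [hY, ENNReal.ofReal_le_ofReal_iff (by positivity), le_div_iff₀ (by positivity)] at this
    linarith
  rw [hY]
  refine ENNReal.ofReal_le_ofReal ?_
  have h1 : 2 * π ^ 2 * y ≤ δ * √(2 * π * y) := by
    have := mul_le_mul_of_nonneg_right hA hy
    rw [hR] at hyR
    linarith
  have h2 : (2 * π ^ 2 * y) ^ 2 ≤ δ ^ 2 * (2 * π * y) := by
    have := pow_le_pow_left₀ (by positivity) h1 2
    rwa [mul_pow δ, Real.sq_sqrt (by positivity)] at this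
  by_contra! hc
  have hy0 : 0 < y := (sq_nonneg δ).trans_lt hc
  have h3 : 2 * π ^ 3 * y ≤ δ ^ 2 := by
    have : (2 * π * y) * (2 * π ^ 3 * y) ≤ (2 * π * y) * δ ^ 2 := by linarith
    exact le_of_mul_le_mul_left this (by positivity)
  have h4 : (1 : ℝ) ≤ π ^ 3 := one_le_pow₀ (by linarith [pi_gt_three])
  nlinarith

lemma hWV_three_halves_le (hε : 0 ≤ ε) (hδ : 0 ≤ δ)
    (hG : gag u ≤ ENNReal.ofReal (4 * π ^ 2 * ε ^ 2))
    (hw : ∫⁻ x in circ, ‖w x‖ₑ ^ 2 ≤ ENNReal.ofReal (δ ^ 2))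
    (hA : 6 * √(384 * π ^ 4 * n) * ε + 2 * √(48 * π * n) * δ ≤ 2 * π ^ 2) :
    hWV (fun k => k * √k) u ≤ ENNReal.ofReal (δ ^ 2) := by
  refine hWV_le_of_fsum_le mul_sqrt_nonneg fun K => ?_
  refine le_trans (ENNReal.ofReal_le_ofReal (fsum_mono K (fun k hk => ?_) u))
    ((ofReal_fsum_le (fun k => ?_) K u).trans
      (h.hWV_min_le hε hδ hG hw hA (Nat.le_add_left 1 K)))
  · have : (k : ℝ) ≤ (K + 1 : ℕ) := by exact_mod_cast hk.trans (Nat.le_succ K)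
    rw [min_eq_left this]
  · positivity

/-- Small energy and small velocity force a small `H¹` seminorm. -/
theorem hWV_sq_le (hε : 0 ≤ ε) (hδ : 0 ≤ δ)
    (hG : gag u ≤ ENNReal.ofReal (4 * π ^ 2 * ε ^ 2))
    (hw : ∫⁻ x in circ, ‖w x‖ₑ ^ 2 ≤ ENNReal.ofReal (δ ^ 2))
    (hA : 6 * √(384 * π ^ 4 * n) * ε + 2 * √(48 * π * n) * δ ≤ 2 * π ^ 2) :
    hWV (fun k => (k : ℝ) ^ 2) u
      ≤ ENNReal.ofReal ((δ + √(192 * π ^ 3 * n) * δ ^ 2) ^ 2) := by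
  have hpi := pi_pos
  have h3 := h.hWV_three_halves_le hε hδ hG hw hA
  set B := √(192 * π ^ 3 * n) with hB
  have hB2 : B ^ 2 = 192 * π ^ 3 * n := Real.sq_sqrt (by positivity)
  have hgl : ∫⁻ x in circ, gl u x ^ 2 ≤ ENNReal.ofReal ((B * δ ^ 2) ^ 2) := by
    refine (lintegral_gl_sq_le_vec fun i => (h.fin i).toBddPer).trans ?_
    rw [mul_pow, hB2, mul_comm _ (n : ℝ), mul_assoc, ENNReal.ofReal_mul (p := n) (by positivity),
      ENNReal.ofReal_mul (p := 192 * π ^ 3) (by positivity), ENNReal.ofReal_natCast,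
      ENNReal.ofReal_pow (by positivity) 2]
    gcongr
  refine hWV_le_of_fsum_le (fun k => sq_nonneg _) fun K => ENNReal.ofReal_le_ofReal ?_
  set z := fsum (fun k => (k : ℝ) ^ 2) K u with hz
  have hz0 : 0 ≤ z := fsum_nonneg (fun k => sq_nonneg _) K u
  set φ := mulT (fun k => (k : ℝ)) K u with hφ
  have hφF : FinV φ := finV_mulT _ _ _
  have hφ1 : hWV (fun _ => 1) φ = ENNReal.ofReal z := by
    rw [hφ, hWV_mulT fun _ => zero_le_one]
    simp only [one_mul, hz]
  have hle := h.enorm_pairing_le' hφF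
  rw [integral_pairing_mulT h.fin] at hle
  simp only [← sq] at hle
  rw [← hz, ← ofReal_norm] at hle
  have t1 := h.lintegral_w_norm_le hδ hw hφF hz0 hφ1.le
  have t2 : ∫⁻ x in circ, gl u x * ‖φ x‖ₑ ≤ ENNReal.ofReal ((B * δ ^ 2) * √(2 * π * z)) := by
    refine le_ofReal_of_sq_le (by positivity) ?_
    refine (lintegral_mul_sq_le (measurable_glV h.fin.meas).aemeasurable
      hφF.meas.enorm.aemeasurable).trans ?_
    rw [mul_pow, ENNReal.ofReal_mul (by positivity), Real.sq_sqrt (by positivity),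
      lintegral_enorm_sq_eq_hWV fun i => (hφF i).toBddPer, hφ1,
      ← ENNReal.ofReal_mul (by positivity)]
    gcongr
  have tot := hle.trans (add_le_add t1 t2)
  rw [← ENNReal.ofReal_add (by positivity) (by positivity),
    ENNReal.ofReal_le_ofReal_iff (by positivity)] at tot
  have h1 : 4 * π ^ 2 * z ≤ (δ + B * δ ^ 2) * √(2 * π * z) := by
    refine ((le_abs_self _).trans tot).trans (le_of_eq ?_)
    ring
  have h2 : (4 * π ^ 2 * z) ^ 2 ≤ (δ + B * δ ^ 2) ^ 2 * (2 * π * z) := by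
    have := pow_le_pow_left₀ (by positivity) h1 2
    rwa [mul_pow _ (√_), Real.sq_sqrt (by positivity)] at this
  by_contra! hc
  have hy0 : 0 < z := (sq_nonneg _).trans_lt hc
  have h3 : 8 * π ^ 3 * z ≤ (δ + B * δ ^ 2) ^ 2 := by
    have : (2 * π * z) * (8 * π ^ 3 * z) ≤ (2 * π * z) * (δ + B * δ ^ 2) ^ 2 := by linarith
    exact le_of_mul_le_mul_left this (by positivity)
  have h4 : (1 : ℝ) ≤ π ^ 3 := one_le_pow₀ (by linarith [pi_gt_three])
  nlinarith

end SliceSol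

end

section

variable {n : ℕ}

lemma exists_herm_trg_eq (K : ℕ) (c : ℤ → ℂ) : ∃ c', Herm c' ∧ trg K c = trg K c' := by
  refine ⟨fun k => (1 / 2 : ℝ) * (c k + (starRingEnd ℂ) (c (-k))), fun k => ?_, ?_⟩
  · simp only [map_mul, map_add, Complex.conj_ofReal, Complex.conj_conj, neg_neg]
    ring
  · funext x
    have h1 : (∑ k ∈ Finset.Icc (-(K : ℤ)) K, (starRingEnd ℂ) (c (-k)) * ee k x)
        = (starRingEnd ℂ) (∑ k ∈ Finset.Icc (-(K : ℤ)) K, c k * ee k x) := by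
      rw [← sum_Icc_neg, map_sum]
      refine Finset.sum_congr rfl fun k _ => ?_
      rw [map_mul, conj_ee, neg_neg]
    simp only [trg, mul_assoc, add_mul, ← Finset.mul_sum, Finset.sum_add_distrib, h1]
    rw [Complex.re_ofReal_mul, Complex.add_re, Complex.conj_re]
    ring

lemma finEnergy_trg_of_complex (K : ℕ) (c : ℤ → ℂ) : FinEnergy (trg K c) := by
  obtain ⟨c', hc', e⟩ := exists_herm_trg_eq K c
  exact e ▸ finEnergy_trg K hc'

lemma trg_single (k : ℤ) (z : ℂ) (x : ℝ) : trg k.natAbs (Pi.single k z) x = (z * ee k x).re := by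
  rw [trg, Finset.sum_eq_single k]
  · simp
  · intro j _ hj
    simp [Pi.single_eq_of_ne hj]
  · intro hk
    rw [Finset.mem_Icc] at hk
    omega

lemma ee_re (k : ℤ) (x : ℝ) : (ee k x).re = Real.cos (k * x) := by
  rw [ee_eq]
  simp only [Complex.mul_re, Complex.add_re, Complex.ofReal_re, Complex.ofReal_im, Complex.I_re,
    Complex.I_im, mul_zero, zero_mul, sub_zero, add_zero]

lemma ee_im (k : ℤ) (x : ℝ) : (ee k x).im = Real.sin (k * x) := by
  rw [ee_eq]
  simp only [Complex.mul_im, Complex.add_im, Complex.ofReal_re, Complex.ofReal_im, Complex.I_re,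
    Complex.I_im, mul_zero, mul_one, zero_add, add_zero]

lemma finEnergy_const (a : ℝ) : FinEnergy fun _ => a := by
  have e : (fun _ => a) = trg 0 (fun _ => (a : ℂ)) := by
    funext x
    simp [trg]
  exact e ▸ finEnergy_trg_of_complex _ _

/-- The real trigonometric system. -/
def tfun (b : Bool) (k : ℤ) (x : ℝ) : ℝ := if b then Real.cos (k * x) else Real.sin (k * x)

lemma finEnergy_tfun (b : Bool) (k : ℤ) : FinEnergy (tfun b k) := by
  have e : tfun b k = trg k.natAbs (Pi.single k (if b then 1 else -Complex.I)) := by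
    funext x
    rw [trg_single, Complex.mul_re, ee_re, ee_im]
    cases b <;> simp [tfun]
  exact e ▸ finEnergy_trg_of_complex _ _

lemma contDiff_tfun (b : Bool) (k : ℤ) : ContDiff ℝ (⊤ : ℕ∞) (tfun b k) := by
  cases b
  · exact Real.contDiff_sin.comp (contDiff_const.mul contDiff_id)
  · exact Real.contDiff_cos.comp (contDiff_const.mul contDiff_id)

lemma trg_eq_sum_tfun (K : ℕ) (c : ℤ → ℂ) (x : ℝ) :
    trg K c x = ∑ k ∈ Finset.Icc (-(K : ℤ)) K,
      ((c k).re * tfun true k x + -(c k).im * tfun false k x) := by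
  rw [trg, Complex.re_sum]
  refine Finset.sum_congr rfl fun k _ => ?_
  rw [Complex.mul_re, ee_re, ee_im]
  simp only [tfun, if_true, Bool.false_eq_true, if_false]
  ring

/-- The equation of a time slice, tested against `ψ` in the `i`-th component. -/
def TestEq (u w : ℝ → E n) (i : Fin n) (ψ : ℝ → ℝ) : Prop :=
  (∫ x in circ, w x i * ψ x) + ∫ p, (u p.1 i - u p.2 i) * (ψ p.1 - ψ p.2) ∂kap
    = ∫ p, ‖u p.1 - u p.2‖ ^ 2 * (u p.1 i * ψ p.1) ∂kap

section

variable {u w : ℝ → E n} {i : Fin n} {ψ χ : ℝ → ℝ}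

lemma TestEq.const_mul (h : TestEq u w i ψ) (a : ℝ) : TestEq u w i fun x => a * ψ x := by
  have e1 : ∀ x, w x i * (a * ψ x) = a * (w x i * ψ x) := fun x => by ring
  have e2 : ∀ p : ℝ × ℝ, (u p.1 i - u p.2 i) * (a * ψ p.1 - a * ψ p.2)
    = a * ((u p.1 i - u p.2 i) * (ψ p.1 - ψ p.2)) := fun x => by ring
  have e3 : ∀ p : ℝ × ℝ, ‖u p.1 - u p.2‖ ^ 2 * (u p.1 i * (a * ψ p.1))
    = a * (‖u p.1 - u p.2‖ ^ 2 * (u p.1 i * ψ p.1)) := fun x => by ring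
  unfold TestEq at h ⊢
  simp only [e1, e2, e3, integral_const_mul, ← mul_add, h]

lemma integrable_cubic (hu : FinV u) (i : Fin n) (hψ : FinEnergy ψ) :
    Integrable (fun p : ℝ × ℝ => ‖u p.1 - u p.2‖ ^ 2 * (u p.1 i * ψ p.1)) kap := by
  obtain ⟨C, hC⟩ : ∃ C : ℝ, ∀ x, |u x i * ψ x| ≤ C := ((hu i).mul hψ).bdd
  have h1 := (hu i).meas
  have h2 := hψ.meas
  exact integrable_mul_bdd (G := fun p => u p.1 i * ψ p.1) (C := C) (integrable_norm_sub_sq hu)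
    ((h1.comp measurable_fst).mul (h2.comp measurable_fst)) fun p => hC p.1

lemma TestEq.add (hu : FinV u) (hw : Integrable (fun x => w x i) circMeasure)
    (hψ : FinEnergy ψ) (hχ : FinEnergy χ) (h : TestEq u w i ψ) (h' : TestEq u w i χ) :
    TestEq u w i fun x => ψ x + χ x := by
  have e1 : ∀ x, w x i * (ψ x + χ x) = w x i * ψ x + w x i * χ x := fun x => by ring
  have e2 : ∀ p : ℝ × ℝ, (u p.1 i - u p.2 i) * (ψ p.1 + χ p.1 - (ψ p.2 + χ p.2))
    = (u p.1 i - u p.2 i) * (ψ p.1 - ψ p.2) + (u p.1 i - u p.2 i) * (χ p.1 - χ p.2) :=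
    fun x => by ring
  have e3 : ∀ p : ℝ × ℝ, ‖u p.1 - u p.2‖ ^ 2 * (u p.1 i * (ψ p.1 + χ p.1))
    = ‖u p.1 - u p.2‖ ^ 2 * (u p.1 i * ψ p.1) + ‖u p.1 - u p.2‖ ^ 2 * (u p.1 i * χ p.1) :=
    fun x => by ring
  have i1 : ∀ {η : ℝ → ℝ}, FinEnergy η → Integrable (fun x => w x i * η x) circMeasure := by
    intro η hη
    obtain ⟨C, hC⟩ := hη.bdd
    exact hw.mul_bdd (c := C) hη.meas.aestronglyMeasurable (ae_of_all _ hC)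
  have j1 := integral_add (i1 hψ) (i1 hχ)
  have j2 := integral_add ((hu i).integrable_mul hψ) ((hu i).integrable_mul hχ)
  have j3 := integral_add (integrable_cubic hu i hψ) (integrable_cubic hu i hχ)
  unfold TestEq at h h' ⊢
  simp only [e1, e2, e3]
  rw [j1, j2, j3, ← h, ← h']
  ring

lemma TestEq.zero : TestEq u w i fun _ => 0 := by simp [TestEq]

lemma TestEq.of_tfun (hu : FinV u) (hw : Integrable (fun x => w x i) circMeasure)
    (h : ∀ b k, TestEq u w i (tfun b k)) (K : ℕ) (c : ℤ → ℂ) : TestEq u w i (trg K c) := by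
  have e : trg K c = fun x => ∑ k ∈ Finset.Icc (-(K : ℤ)) K,
      ((c k).re * tfun true k x + -(c k).im * tfun false k x) := funext (trg_eq_sum_tfun K c)
  have hcm : ∀ (a : ℝ) b k, FinEnergy fun x => a * tfun b k x := fun a b k => by
    exact (finEnergy_const a).mul (finEnergy_tfun b k)
  rw [e]
  generalize Finset.Icc (-(K : ℤ)) K = s
  classical
  induction s using Finset.induction_on with
  | empty => simpa using TestEq.zero
  | insert a s ha ih =>
    simp only [Finset.sum_insert ha]
    exact TestEq.add hu hw ((hcm _ _ _).add (hcm _ _ _))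
      (FinEnergy.sum s fun k => (hcm _ _ _).add (hcm _ _ _))
      (TestEq.add hu hw (hcm _ _ _) (hcm _ _ _) ((h _ _).const_mul _) ((h _ _).const_mul _)) ih

lemma SliceSol.of_tfun (hu : FinV u) (h1 : ∀ x, ‖u x‖ = 1) (hwm : Measurable w)
    (hw : ∫⁻ x in circ, ‖w x‖ₑ ^ 2 < ⊤) (h : ∀ i b k, TestEq u w i (tfun b k)) :
    SliceSol u w := by
  refine ⟨hu, h1, hwm, hw, fun i K c _ => ?_⟩
  refine TestEq.of_tfun hu ?_ (h i) K c
  refine ((memLp_of_lintegral hwm hw).integrable one_le_two).mono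
    (hwm.comp_apply i).aestronglyMeasurable (ae_of_all _ fun x => ?_)
  exact abs_apply_le_norm _ _

end

lemma hSum_eq_hWV (ω : ℕ → ℝ) (u : ℝ → E n) :
    ∑' k : ℤ, ENNReal.ofReal (ω k.natAbs) * ∑ i, (‖fcV u k i‖₊ : ℝ≥0∞) ^ 2 = hWV ω u := by
  simp only [Finset.mul_sum]
  rw [Summable.tsum_finsetSum fun i _ => ENNReal.summable]
  rfl

lemma hHalf_eq_hWV (u : ℝ → E n) : hHalf u = hWV (fun k => (k : ℝ)) u := by
  rw [← hSum_eq_hWV]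
  simp only [ENNReal.ofReal_natCast, hHalf]

lemma hSob_one_eq_hWV (u : ℝ → E n) :
    hSob 1 u = hWV (fun _ => 1) u + hWV (fun k => (k : ℝ) ^ 2) u := by
  rw [← hSum_eq_hWV, ← hSum_eq_hWV, ← ENNReal.tsum_add]
  refine tsum_congr fun k => ?_
  rw [← add_mul, ← ENNReal.ofReal_add zero_le_one (sq_nonneg _), Real.rpow_one]
  congr 3
  rw [Nat.cast_natAbs, Int.cast_abs, sq_abs]

lemma hWV_congr {u v : ℝ → E n} (h : u =ᵐ[circMeasure] v) (ω : ℕ → ℝ) : hWV ω u = hWV ω v := by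
  refine Finset.sum_congr rfl fun i _ => tsum_congr fun k => ?_
  have e : (fun x => u x i) =ᵐ[circMeasure] fun x => v x i := h.mono fun x hx => by simp only [hx]
  rw [fcR_congr e]

lemma FinV.of_hWV {u : ℝ → E n} (hu : ∀ i, BddPer fun x => u x i)
    (h : hWV (fun k => (k : ℝ)) u < ⊤) : FinV u := by
  intro i
  refine finEnergy_of_gag (hu i) ?_
  rw [gag_eq (hu i)]
  exact ENNReal.mul_lt_top ENNReal.ofReal_lt_top (ENNReal.sum_lt_top.1 h i (Finset.mem_univ i))

end

section

variable {n : ℕ}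

/-- Modification of a flow on the set where it leaves the unit sphere. -/
def toSphere (e : E n) (u : ℝ → ℝ → E n) (t x : ℝ) : E n := if ‖u t x‖ = 1 then u t x else e

section

variable {e : E n} {u : ℝ → ℝ → E n}

lemma measurable_toSphere (e : E n) (hu : Measurable (Function.uncurry u)) :
    Measurable (Function.uncurry (toSphere e u)) := by
  have hs : MeasurableSet {p : ℝ × ℝ | ‖Function.uncurry u p‖ = 1} :=
    hu.norm (measurableSet_singleton 1)
  exact Measurable.ite hs hu measurable_const

lemma norm_toSphere (he : ‖e‖ = 1) (u : ℝ → ℝ → E n) (t x : ℝ) : ‖toSphere e u t x‖ = 1 := by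
  unfold toSphere
  split_ifs with h
  exacts [h, he]

lemma bddPer_toSphere (he : ‖e‖ = 1) (hu : Measurable (Function.uncurry u))
    (hp : ∀ t, Function.Periodic (u t) (2 * π)) (t : ℝ) (i : Fin n) :
    BddPer fun x => toSphere e u t x i where
  meas := ((measurable_toSphere e hu).comp measurable_prodMk_left).comp_apply i
  per x := by simp only [toSphere, hp t x]
  bdd := ⟨1, fun x => (abs_apply_le_norm _ i).trans (norm_toSphere he u t x).le⟩

end

section

variable {u v : ℝ → E n} {ψ : ℝ → ℝ}

lemma sum_mul_single (a : E n) (i : Fin n) (c : ℝ) :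
    ∑ j, a j * (EuclideanSpace.single i c : E n) j = a i * c := by
  rw [Finset.sum_eq_single i]
  · simp
  · intro j _ hj
    simp [hj]
  · simp

lemma pairing_single (h : u =ᵐ[circMeasure] v) (hv : FinV v) (hψ : FinEnergy ψ) (i : Fin n)
    (c : ℝ) : pairing u (fun x => EuclideanSpace.single i (c * ψ x))
      = c * ∫ p, (v p.1 i - v p.2 i) * (ψ p.1 - ψ p.2) ∂kap := by
  rw [integral_kap ((hv i).integrable_mul hψ), ← integral_const_mul]
  refine integral_congr_ae (h.mono fun x hx => ?_)
  dsimp only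
  rw [← integral_const_mul]
  refine integral_congr_ae (h.mono fun y hy => ?_)
  dsimp only
  have e1 := sum_mul_single (v x - v y) i (c * ψ x)
  have e2 := sum_mul_single (v x - v y) i (c * ψ y)
  simp only [PiLp.sub_apply] at e1 e2
  simp only [hx, hy, mul_sub, Finset.sum_sub_distrib, e1, e2]
  ring

lemma integral_gagl_single (h : u =ᵐ[circMeasure] v) (hv : FinV v) (hψ : FinEnergy ψ) (i : Fin n)
    (c : ℝ) :
    ∫ x in circ, gagl u x * ∑ j, u x j * (EuclideanSpace.single i (c * ψ x) : E n) j
      = c * ∫ p, ‖v p.1 - v p.2‖ ^ 2 * (v p.1 i * ψ p.1) ∂kap := by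
  rw [integral_kap (integrable_cubic hv i hψ), ← integral_const_mul]
  refine integral_congr_ae (h.mono fun x hx => ?_)
  dsimp only
  have e : gagl u x = ∫ y in circ, ‖v x - v y‖ ^ 2 / cd x y ^ 2 := by
    refine integral_congr_ae (h.mono fun y hy => ?_)
    simp only [hx, hy, EuclideanSpace.norm_sq_eq, PiLp.sub_apply, Real.norm_eq_abs, sq_abs]
  rw [sum_mul_single, e, hx, ← integral_mul_const, ← integral_const_mul]
  refine integral_congr_ae (ae_of_all _ fun y => ?_)
  dsimp only
  ring

lemma enorm_integral_pairing_sq_le (hv : FinV v) (hψ : FinEnergy ψ) (i : Fin n) :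
    ‖∫ p, (v p.1 i - v p.2 i) * (ψ p.1 - ψ p.2) ∂kap‖ₑ ^ 2 ≤ gag v * gag ψ := by
  have h := norm_integral_mul_sq_le (hv i).memLp.aestronglyMeasurable.aemeasurable
    hψ.memLp.aestronglyMeasurable.aemeasurable
  refine h.trans (mul_le_mul_left ?_ _)
  rw [gag_eq_sum hv.meas]
  exact Finset.single_le_sum (f := fun i => gag fun x => v x i) (fun _ _ => zero_le)
    (Finset.mem_univ i)

lemma enorm_integral_cubic_le (h1 : ∀ x, ‖v x‖ = 1) (hψ : ∀ x, |ψ x| ≤ 1) (i : Fin n) :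
    ‖∫ p, ‖v p.1 - v p.2‖ ^ 2 * (v p.1 i * ψ p.1) ∂kap‖ₑ ≤ gag v := by
  refine (enorm_integral_le_lintegral_enorm _).trans (lintegral_mono fun p => ?_)
  have h2 : ‖v p.1 i * ψ p.1‖ₑ ≤ 1 := by
    rw [← enorm_one (G := ℝ), enorm_le_iff_norm_le, norm_mul, norm_one]
    exact mul_le_one₀ ((abs_apply_le_norm _ i).trans (h1 _).le) (norm_nonneg _) (hψ _)
  calc ‖‖v p.1 - v p.2‖ ^ 2 * (v p.1 i * ψ p.1)‖ₑ
      = ‖v p.1 - v p.2‖ₑ ^ 2 * ‖v p.1 i * ψ p.1‖ₑ := by rw [enorm_mul, enorm_pow, enorm_norm]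
    _ ≤ ‖v p.1 - v p.2‖ₑ ^ 2 := mul_le_of_le_one_right' h2

end

/-- Product test functions. -/
lemma isSTTest_single {η ψ : ℝ → ℝ} (hη : ContDiff ℝ (⊤ : ℕ∞) η) (hc : HasCompactSupport η)
    (hs : tsupport η ⊆ Set.Ioi 0) (hψ : ContDiff ℝ (⊤ : ℕ∞) ψ)
    (hp : Function.Periodic ψ (2 * π)) (i : Fin n) :
    IsSTTest n fun t x => EuclideanSpace.single i (η t * ψ x) where
  smooth := by
    rw [contDiff_euclidean]
    intro j
    by_cases h : j = i
    · subst h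
      simp only [PiLp.single_apply, if_true]
      exact (hη.comp contDiff_fst).mul (hψ.comp contDiff_snd)
    · simp only [PiLp.single_apply, if_neg h]
      exact contDiff_const
  periodic t x := by simp only [hp x]
  suppTime := by
    obtain ⟨b, hb⟩ := hc.isCompact.bddAbove
    have hz : ∀ t, t ∉ tsupport η → ∀ x, (EuclideanSpace.single i (η t * ψ x) : E n) = 0 := by
      intro t ht x
      rw [image_eq_zero_of_notMem_tsupport ht, zero_mul]
      simp
    rcases (tsupport η).eq_empty_or_nonempty with h0 | h0
    · exact ⟨1, b, one_pos, fun t _ => hz t (h0 ▸ Set.notMem_empty t)⟩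
    · obtain ⟨a, ha⟩ := hc.isCompact.exists_isLeast h0
      exact ⟨a, b, hs ha.1, fun t ht => hz t fun h => ht ⟨ha.2 h, hb h⟩⟩

end

lemma abs_tfun_le (b : Bool) (k : ℤ) (x : ℝ) : |tfun b k x| ≤ 1 := by
  cases b
  exacts [Real.abs_sin_le_one _, Real.abs_cos_le_one _]

instance : SFinite kap := inferInstanceAs (SFinite (Measure.withDensity _ _))

namespace IsEnergySolAux

variable {n : ℕ} {u₀ : ℝ → E n} {u w : ℝ → ℝ → E n} (h : IsEnergySolAux n u₀ u w) {e : E n}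
  (he : ‖e‖ = 1)
include h

lemma ae_eq_toSphere (e : E n) : ∀ᵐ t ∂(volume.restrict (Set.Ioi (0 : ℝ))),
    u t =ᵐ[circMeasure] toSphere e u t := by
  filter_upwards [Measure.ae_ae_of_ae_prod h.sphere] with t ht
  filter_upwards [ht] with x hx
  simp only [toSphere, if_pos hx]

lemma ae_lintegral_w_lt_top : ∀ᵐ t ∂(volume.restrict (Set.Ioi (0 : ℝ))),
    ∫⁻ x in circ, ‖w t x‖ₑ ^ 2 < ⊤ := by
  have hm : Measurable fun p : ℝ × ℝ => ‖w p.1 p.2‖ₑ ^ 2 := h.wMeas.enorm.pow_const 2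
  exact ae_lt_top hm.lintegral_prod_right' h.wL2.ne

include he

lemma exists_ae_gag_le : ∃ M : ℝ≥0∞, M < ⊤ ∧ ∀ᵐ t ∂(volume.restrict (Set.Ioi (0 : ℝ))),
    FinV (toSphere e u t) ∧ gag (toSphere e u t) ≤ M := by
  obtain ⟨M, hM, hu⟩ := h.energyBdd
  refine ⟨ENNReal.ofReal (4 * π ^ 2) * M, ENNReal.mul_lt_top ENNReal.ofReal_lt_top hM, ?_⟩
  filter_upwards [hu, h.ae_eq_toSphere e] with t ht hte
  rw [hHalf_eq_hWV, hWV_congr hte] at ht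
  have hf := FinV.of_hWV (bddPer_toSphere he h.meas h.periodic t) (ht.trans_lt hM)
  refine ⟨hf, ?_⟩
  rw [gag_eq_hWV hf]
  gcongr

lemma ae_testEq (i : Fin n) (b : Bool) (k : ℤ) : ∀ᵐ t ∂(volume.restrict (Set.Ioi (0 : ℝ))),
    TestEq (toSphere e u t) (w t) i (tfun b k) := by
  obtain ⟨M, hM, hg⟩ := h.exists_ae_gag_le he
  have hψ := finEnergy_tfun b k
  have hψm : Measurable (tfun b k) := hψ.meas
  have hψ1 := abs_tfun_le b k
  have hψs := contDiff_tfun b k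
  generalize tfun b k = ψ at *
  have hv := measurable_toSphere e h.meas
  have hvi : Measurable fun p : ℝ × ℝ => toSphere e u p.1 p.2 i := hv.comp_apply i
  have hvn := norm_toSphere he u
  have hae := h.ae_eq_toSphere e
  generalize toSphere e u = v at *
  set A : ℝ → ℝ := fun t => ∫ x in circ, w t x i * ψ x with hA
  set B : ℝ → ℝ := fun t => ∫ p, (v t p.1 i - v t p.2 i) * (ψ p.1 - ψ p.2) ∂kap with hB
  set C : ℝ → ℝ := fun t => ∫ p, ‖v t p.1 - v t p.2‖ ^ 2 * (v t p.1 i * ψ p.1) ∂kap with hC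
  have m1 : Measurable fun q : ℝ × ℝ × ℝ => (q.1, q.2.1) := by fun_prop
  have m2 : Measurable fun q : ℝ × ℝ × ℝ => (q.1, q.2.2) := by fun_prop
  have mA : StronglyMeasurable A := by
    refine StronglyMeasurable.integral_prod_right' (f := fun p : ℝ × ℝ => w p.1 p.2 i * ψ p.2) ?_
    exact ((h.wMeas.comp_apply i).mul (hψm.comp measurable_snd)).stronglyMeasurable
  have mB : StronglyMeasurable B := by
    refine StronglyMeasurable.integral_prod_right' (f := fun q : ℝ × ℝ × ℝ =>
      (v q.1 q.2.1 i - v q.1 q.2.2 i) * (ψ q.2.1 - ψ q.2.2)) (Measurable.stronglyMeasurable ?_)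
    exact ((hvi.comp m1).sub (hvi.comp m2)).mul (by fun_prop)
  have mC : StronglyMeasurable C := by
    refine StronglyMeasurable.integral_prod_right' (f := fun q : ℝ × ℝ × ℝ =>
      ‖v q.1 q.2.1 - v q.1 q.2.2‖ ^ 2 * (v q.1 q.2.1 i * ψ q.2.1))
      (Measurable.stronglyMeasurable ?_)
    exact (((hv.comp m1).sub (hv.comp m2)).norm.pow_const 2).mul
      ((hvi.comp m1).mul (by fun_prop))
  have lA : LocallyIntegrable A (volume.restrict (Set.Ioi 0)) := by
    refine MemLp.locallyIntegrable (p := 2) (memLp_of_lintegral mA.measurable ?_) one_le_two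
    have hw : ∀ t, ‖A t‖ₑ ^ 2
        ≤ (∫⁻ x in circ, ‖w t x‖ₑ ^ 2) * ∫⁻ x in circ, ‖ψ x‖ₑ ^ 2 := by
      intro t
      refine (norm_integral_mul_sq_le ((h.wMeas.comp_apply i).comp
        measurable_prodMk_left).aemeasurable hψm.aemeasurable).trans (mul_le_mul_left ?_ _)
      refine lintegral_mono fun x => pow_le_pow_left' ?_ 2
      exact enorm_le_iff_norm_le.2 (abs_apply_le_norm _ _)
    have hψ2 : ∫⁻ x in circ, ‖ψ x‖ₑ ^ 2 < ⊤ := by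
      refine (lintegral_mono (g := fun _ => 1) fun x => pow_le_one₀ zero_le ?_).trans_lt ?_
      · rw [← enorm_one (G := ℝ), enorm_le_iff_norm_le, norm_one]
        exact hψ1 x
      · rw [lintegral_one]
        exact measure_lt_top _ _
    refine (lintegral_mono hw).trans_lt ?_
    rw [lintegral_mul_const' _ _ hψ2.ne]
    exact ENNReal.mul_lt_top h.wL2 hψ2
  have lB : LocallyIntegrable B (volume.restrict (Set.Ioi 0)) := by
    refine (memLp_top_of_bound mB.aestronglyMeasurable (√(M * gag ψ).toReal) ?_).locallyIntegrable
      le_top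
    filter_upwards [hg] with t ht
    refine Real.le_sqrt_of_sq_le ?_
    rw [← toReal_enorm, ← ENNReal.toReal_pow]
    exact ENNReal.toReal_mono (ENNReal.mul_lt_top hM hψ.gag_lt_top).ne
      ((enorm_integral_pairing_sq_le ht.1 hψ i).trans (mul_le_mul_left ht.2 _))
  have lC : LocallyIntegrable C (volume.restrict (Set.Ioi 0)) := by
    refine (memLp_top_of_bound mC.aestronglyMeasurable M.toReal ?_).locallyIntegrable le_top
    filter_upwards [hg] with t ht
    rw [← toReal_enorm]
    exact ENNReal.toReal_mono hM.ne ((enorm_integral_cubic_le (hvn t) hψ1 i).trans ht.2)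
  have key := isOpen_Ioi.ae_eq_zero_of_integral_contDiff_smul_eq_zero
    (((lA.add lB).sub lC).locallyIntegrableOn (Set.Ioi 0)) fun η hη hc hs => by
    have iA := lA.integrable_smul_left_of_hasCompactSupport hη.continuous hc
    have iB := lB.integrable_smul_left_of_hasCompactSupport hη.continuous hc
    have iC := lC.integrable_smul_left_of_hasCompactSupport hη.continuous hc
    have hf := h.flow _ (isSTTest_single hη hc hs hψs hψ.per i)
    have eA : ∀ t, ∫ x in circ, ∑ j, w t x j * (EuclideanSpace.single i (η t * ψ x) : E n) j
        = η t • A t := fun t => by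
      rw [hA, smul_eq_mul, ← integral_const_mul]
      refine integral_congr_ae (ae_of_all _ fun x => ?_)
      dsimp only
      rw [sum_mul_single]
      ring
    have eB : (∫ t in Set.Ioi 0, pairing (u t) fun x => EuclideanSpace.single i (η t * ψ x))
        = ∫ t in Set.Ioi 0, η t • B t := by
      refine integral_congr_ae ?_
      filter_upwards [hg, hae] with t ht ht'
      exact pairing_single ht' ht.1 hψ i (η t)
    have eC : (∫ t in Set.Ioi 0, ∫ x in circ, gagl (u t) x *
        ∑ j, u t x j * (EuclideanSpace.single i (η t * ψ x) : E n) j)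
        = ∫ t in Set.Ioi 0, η t • C t := by
      refine integral_congr_ae ?_
      filter_upwards [hg, hae] with t ht ht'
      exact integral_gagl_single ht' ht.1 hψ i (η t)
    simp only [eA, eB, eC] at hf
    simp only [Pi.add_apply, Pi.sub_apply, smul_sub, smul_add]
    have e1 := integral_sub (iA.add iB) iC
    simp only [Pi.add_apply] at e1
    rw [e1, integral_add iA iB, hf, sub_self]
  filter_upwards [key, ae_restrict_mem measurableSet_Ioi] with t ht ht0
  exact sub_eq_zero.1 (ht ht0)

lemma ae_sliceSol : ∀ᵐ t ∂(volume.restrict (Set.Ioi (0 : ℝ))), SliceSol (toSphere e u t) (w t) := by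
  obtain ⟨M, -, hg⟩ := h.exists_ae_gag_le he
  have ht : ∀ᵐ t ∂(volume.restrict (Set.Ioi (0 : ℝ))), ∀ i b k,
      TestEq (toSphere e u t) (w t) i (tfun b k) := by
    simp only [ae_all_iff]
    exact h.ae_testEq he
  filter_upwards [hg, h.ae_lintegral_w_lt_top, ht] with t h1 h2 h3
  exact SliceSol.of_tfun h1.1 (norm_toSphere he u t) (h.wMeas.comp measurable_prodMk_left) h2 h3

end IsEnergySolAux

section

variable {n : ℕ} {v : ℝ → E n}

lemma IsEnergySolAux.exists_time {u₀ : ℝ → E n} {u w : ℝ → ℝ → E n} (h : IsEnergySolAux n u₀ u w)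
    {P : ℝ → Prop} (hP : ∀ᵐ t ∂(volume.restrict (Set.Ioi (0 : ℝ))), P t) {T δ : ℝ} (hT : 0 ≤ T)
    (hδ : 0 < δ) :
    ∃ t, T < t ∧ P t ∧ ∫⁻ x in circ, ‖w t x‖ₑ ^ 2 ≤ ENNReal.ofReal (δ ^ 2) := by
  by_contra! hcon
  have hsub : volume.restrict (Set.Ioi T) ≤ volume.restrict (Set.Ioi 0) :=
    Measure.restrict_mono (Set.Ioi_subset_Ioi hT) le_rfl
  have h1 : ∫⁻ _ in Set.Ioi T, ENNReal.ofReal (δ ^ 2)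
      ≤ ∫⁻ t in Set.Ioi T, ∫⁻ x in circ, ‖w t x‖ₑ ^ 2 := by
    refine lintegral_mono_ae ?_
    filter_upwards [hsub.absolutelyContinuous.ae_le hP, ae_restrict_mem measurableSet_Ioi]
      with t ht htT
    exact (hcon t htT ht).le
  have h2 := (h1.trans (lintegral_mono' hsub le_rfl)).trans_lt h.wL2
  rw [lintegral_const, Measure.restrict_apply_univ, Real.volume_Ioi,
    ENNReal.mul_top (by simpa using hδ.ne')] at h2
  exact lt_irrefl _ h2

lemma fcR_const (a : ℝ) (k : ℤ) : fcR (fun _ => a) k = if k = 0 then (a : ℂ) else 0 := by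
  have e : (fun _ => a) = trg 0 (Pi.single 0 (a : ℂ)) := by
    funext x
    simp [trg]
  have hH : Herm (Pi.single 0 (a : ℂ)) := fun k => by
    rcases eq_or_ne k 0 with rfl | hk <;> simp [*]
  rw [e, fcR_trg hH]
  rcases eq_or_ne k 0 with rfl | hk <;> simp [*]

lemma fcR_zero_eq_re (f : ℝ → ℝ) : ((fcR f 0).re : ℂ) = fcR f 0 :=
  Complex.conj_eq_iff_re.1 (by simpa using (herm_fcR f 0).symm)

/-- The Poincaré inequality on the circle. -/
lemma lintegral_sub_mean_le (hv : ∀ i, BddPer fun x => v x i) :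
    ∃ m : E n, ∫⁻ x in circ, ‖v x - m‖ₑ ^ 2
      ≤ ENNReal.ofReal (2 * π) * hWV (fun k => (k : ℝ) ^ 2) v := by
  refine ⟨WithLp.toLp 2 fun i => (fcR (fun x => v x i) 0).re, ?_⟩
  have hc : ∀ a : ℝ, BddPer fun _ => a := fun a => (finEnergy_const a).toBddPer
  rw [lintegral_enorm_sq_eq_hWV (u := fun x => v x - WithLp.toLp 2 _)
    fun i => (hv i).sub (hc _)]
  gcongr
  refine hWV_le (fun _ => zero_le_one) (fun i k => ?_) fun _ => sq_nonneg _
  have e := fcR_sub (hv i).integrable (hc (fcR (fun x => v x i) 0).re).integrable k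
  simp only [PiLp.sub_apply]
  rw [e, fcR_const]
  split_ifs with hk
  · subst hk
    rw [fcR_zero_eq_re, sub_self]
    simp
  · rw [sub_zero]
    gcongr
    rw [one_le_sq_iff₀ (by positivity), Nat.one_le_cast]
    omega

lemma enorm_sub_sq_le (a b c : E n) : ‖a - c‖ₑ ^ 2 ≤ 2 * ‖a - b‖ₑ ^ 2 + 2 * ‖b - c‖ₑ ^ 2 := by
  have h := ennreal_sq_sum_le ![‖a - b‖ₑ, ‖b - c‖ₑ]
  simp only [Fin.sum_univ_two, Matrix.cons_val_zero, Matrix.cons_val_one, mul_add] at h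
  refine le_trans (pow_le_pow_left' ?_ 2) h
  rw [← sub_add_sub_cancel a b c]
  exact enorm_add_le _ _

lemma lintegral_sub_sq_le (hv : Measurable v) (b c : E n) : ∫⁻ x in circ, ‖v x - c‖ₑ ^ 2
    ≤ 2 * (∫⁻ x in circ, ‖v x - b‖ₑ ^ 2) + 2 * ENNReal.ofReal (2 * π) * ‖b - c‖ₑ ^ 2 := by
  refine (lintegral_mono fun x => enorm_sub_sq_le (v x) b c).trans (le_of_eq ?_)
  rw [lintegral_add_right _ measurable_const, lintegral_const_mul _ (by fun_prop), lintegral_const,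
    circMeasure_univ]
  ring

lemma exists_unit_lintegral_sub_le (hv : ∀ i, BddPer fun x => v x i) (h1 : ∀ x, ‖v x‖ = 1) :
    ∃ c : E n, ‖c‖ = 1 ∧ ∫⁻ x in circ, ‖v x - c‖ₑ ^ 2
      ≤ 4 * ENNReal.ofReal (2 * π) * hWV (fun k => (k : ℝ) ^ 2) v := by
  obtain ⟨m, hm⟩ := lintegral_sub_mean_le hv
  have hvm : Measurable v := measurable_of_apply fun i => (hv i).meas
  have hμ : circMeasure ≠ 0 := by
    rw [Ne, ← Measure.measure_univ_eq_zero, circMeasure_univ, ENNReal.ofReal_eq_zero, not_le]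
    positivity
  obtain ⟨x, hx⟩ := exists_le_laverage hμ (f := fun x => ‖v x - m‖ₑ ^ 2)
    ((hvm.sub_const m).enorm.pow_const 2).aemeasurable
  refine ⟨v x, h1 x, (lintegral_sub_sq_le hvm m (v x)).trans ?_⟩
  have hx' : ENNReal.ofReal (2 * π) * ‖m - v x‖ₑ ^ 2 ≤ ∫⁻ x in circ, ‖v x - m‖ₑ ^ 2 := by
    rw [enorm_sub_rev, mul_comm]
    rw [laverage_eq, circMeasure_univ] at hx
    exact (ENNReal.le_div_iff_mul_le (Or.inl (by simp [Real.pi_pos]))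
      (Or.inl ENNReal.ofReal_ne_top)).1 hx
  calc _ ≤ 2 * (∫⁻ x in circ, ‖v x - m‖ₑ ^ 2) + 2 * ∫⁻ x in circ, ‖v x - m‖ₑ ^ 2 := by
        rw [mul_assoc]
        gcongr
    _ = 4 * ∫⁻ x in circ, ‖v x - m‖ₑ ^ 2 := by ring
    _ ≤ _ := by
        rw [mul_assoc]
        gcongr

lemma hWV_one_eq (hv : ∀ i, BddPer fun x => v x i) (h1 : ∀ x, ‖v x‖ = 1) :
    hWV (fun _ => 1) v = 1 := by
  have h := lintegral_enorm_sq_eq_hWV hv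
  have e : ∀ x, ‖v x‖ₑ = 1 := fun x => by rw [← ofReal_norm, h1, ENNReal.ofReal_one]
  simp only [e, one_pow, lintegral_one, circMeasure_univ] at h
  have hp : ENNReal.ofReal (2 * π) ≠ 0 := by
    rw [Ne, ENNReal.ofReal_eq_zero, not_le]
    positivity
  exact ((ENNReal.mul_right_inj hp ENNReal.ofReal_ne_top).1 ((mul_one _).trans h)).symm

lemma hSob_const_lt_top {c : E n} (hc : ‖c‖ = 1) : hSob 1 (fun _ => c) < ⊤ := by
  have hb : ∀ i, BddPer fun _ => c i := fun i => (finEnergy_const (c i)).toBddPer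
  have h1 := hWV_one_eq hb fun _ => hc
  have h2 : hWV (fun k => (k : ℝ) ^ 2) (fun _ => c) ≤ hWV (fun _ => 1) fun _ => c := by
    refine hWV_le (fun _ => sq_nonneg _) (fun i k => ?_) fun _ => zero_le_one
    rw [fcR_const]
    split_ifs with hk <;> simp [hk, sq_nonneg]
  rw [hSob_one_eq_hWV]
  exact ENNReal.add_lt_top.2 ⟨h1 ▸ ENNReal.one_lt_top, (h1 ▸ h2).trans_lt ENNReal.one_lt_top⟩

end

section

variable {n : ℕ} {u₀ : ℝ → E n} {u w : ℝ → ℝ → E n} {ε : ℝ}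

lemma IsEnergySolAux.ae_hWV_sq_le (h : IsEnergySolAux n u₀ u w) {e : E n} (he : ‖e‖ = 1)
    (hε : 0 ≤ ε) (h₀ : hHalf u₀ ≤ ENNReal.ofReal (ε ^ 2)) (hd : EnergyDecay u₀ u) :
    ∀ᵐ t ∂(volume.restrict (Set.Ioi (0 : ℝ))), u t =ᵐ[circMeasure] toSphere e u t ∧
      ∀ δ, 0 ≤ δ → ∫⁻ x in circ, ‖w t x‖ₑ ^ 2 ≤ ENNReal.ofReal (δ ^ 2) →
        6 * √(384 * π ^ 4 * n) * ε + 2 * √(48 * π * n) * δ ≤ 2 * π ^ 2 →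
        hWV (fun k => (k : ℝ) ^ 2) (toSphere e u t)
          ≤ ENNReal.ofReal ((δ + √(192 * π ^ 3 * n) * δ ^ 2) ^ 2) := by
  filter_upwards [h.ae_eq_toSphere e, h.ae_sliceSol he, hd] with t h1 h2 h3
  refine ⟨h1, fun δ hδ hw hA => h2.hWV_sq_le hε hδ ?_ hw hA⟩
  rw [gag_eq_hWV h2.fin, ENNReal.ofReal_mul (p := 4 * π ^ 2) (by positivity), ← hWV_congr h1, ← hHalf_eq_hWV]
  gcongr
  exact h3.trans h₀

/-- Small-energy solutions have time slices along which the `H¹` energy tends to zero. -/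
lemma exists_tseq (h : IsEnergySolAux n u₀ u w) {e : E n} (he : ‖e‖ = 1)
    (hε : 0 < ε) (hA : (6 * √(384 * π ^ 4 * n) + 2 * √(48 * π * n)) * ε ≤ 2 * π ^ 2)
    (h₀ : hHalf u₀ ≤ ENNReal.ofReal (ε ^ 2)) (hd : EnergyDecay u₀ u) :
    ∃ t : ℕ → ℝ, Tendsto t atTop atTop ∧ (∀ j, u (t j) =ᵐ[circMeasure] toSphere e u (t j)) ∧
      Tendsto (fun j => hWV (fun k => (k : ℝ) ^ 2) (toSphere e u (t j))) atTop (𝓝 0) ∧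
      ∃ M : ℝ≥0∞, M < ⊤ ∧ ∀ j, hWV (fun k => (k : ℝ) ^ 2) (toSphere e u (t j)) ≤ M := by
  have hae := h.ae_hWV_sq_le he hε.le h₀ hd
  have hδ : ∀ j : ℕ, 0 < ε / (j + 1) := fun j => by positivity
  choose t ht hP hw using fun j : ℕ => h.exists_time hae (Nat.cast_nonneg j) (hδ j)
  have hδε : ∀ j : ℕ, ε / (j + 1) ≤ ε := fun j =>
    div_le_self hε.le (le_add_of_nonneg_left (Nat.cast_nonneg j))
  have hH := fun j => (hP j).2 _ (hδ j).le (hw j) ((by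
    rw [add_mul] at hA
    exact (add_le_add_right (mul_le_mul_of_nonneg_left (hδε j) (by positivity)) _).trans hA))
  have hδ0 : Tendsto (fun j : ℕ => ε / ((j : ℝ) + 1)) atTop (𝓝 0) := by
    simpa [div_eq_mul_inv] using (tendsto_one_div_add_atTop_nhds_zero_nat (𝕜 := ℝ)).const_mul ε
  refine ⟨t, tendsto_atTop_mono (fun j => (ht j).le) tendsto_natCast_atTop_atTop,
    fun j => (hP j).1, ?_, ENNReal.ofReal ((ε + √(192 * π ^ 3 * n) * ε ^ 2) ^ 2),
    ENNReal.ofReal_lt_top, fun j => (hH j).trans (ENNReal.ofReal_le_ofReal ?_)⟩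
  · refine tendsto_of_tendsto_of_tendsto_of_le_of_le tendsto_const_nhds ?_ (fun _ => zero_le) hH
    have hl := ENNReal.tendsto_ofReal
      ((hδ0.add ((hδ0.pow 2).const_mul √(192 * π ^ 3 * n))).pow 2)
    simpa using hl
  · have := (hδ j).le
    have := hδε j
    gcongr

end

/-- Convergence at infinity: for a small-energy energy-class
solution with nonincreasing energy, along a suitable sequence `t_k → ∞` the maps
`u(t_k,·)` converge (in `L²`, with uniformly bounded `H¹`-norms) to a weakly
half-harmonic map `u_∞` into `S^{n-1}`. -/
theorem convergence_at_infinity (n : ℕ) (hn : 2 ≤ n) :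
    ∃ ε : ℝ, 0 < ε ∧
      ∀ u₀ : ℝ → E n, Measurable u₀ → Function.Periodic u₀ (2 * π) →
        (∀ x, ‖u₀ x‖ = 1) → hHalf u₀ ≤ ENNReal.ofReal (ε ^ 2) →
        ∀ u : ℝ → ℝ → E n, IsEnergySol n u₀ u → EnergyDecay u₀ u →
          ∃ tseq : ℕ → ℝ, Tendsto tseq atTop atTop ∧
            ∃ uinf : ℝ → E n,
              Measurable uinf ∧ Function.Periodic uinf (2 * π) ∧
              (∀ᵐ x ∂(volume.restrict circ), ‖uinf x‖ = 1) ∧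
              hSob 1 uinf < ⊤ ∧
              Tendsto (fun k => ∫⁻ x in circ, (‖u (tseq k) x - uinf x‖₊ : ℝ≥0∞) ^ 2)
                atTop (nhds 0) ∧
              (∃ M : ℝ≥0∞, M < ⊤ ∧ ∀ k, hSob 1 (u (tseq k)) ≤ M) ∧
              (∀ φ : ℝ → E n, ContDiff ℝ (⊤ : ℕ∞) φ → Function.Periodic φ (2 * π) →
                pairing uinf φ = ∫ x in circ, gagl uinf x * ∑ i, uinf x i * φ x i) := by
  have hn0 : (0 : ℝ) < n := Nat.cast_pos.2 (by omega)
  have hκ : 0 < 6 * √(384 * π ^ 4 * n) + 2 * √(48 * π * n) := by positivity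
  refine ⟨2 * π ^ 2 / (6 * √(384 * π ^ 4 * n) + 2 * √(48 * π * n)), by positivity, ?_⟩
  intro u₀ _ _ _ h₀ u hu hd
  obtain ⟨w, h⟩ := hu
  have he : ‖(EuclideanSpace.single ⟨0, by omega⟩ 1 : E n)‖ = 1 := by simp
  generalize (EuclideanSpace.single ⟨0, by omega⟩ 1 : E n) = e at he
  obtain ⟨t, ht, htu, hlim, M, hM, hMt⟩ :=
    exists_tseq h he (by positivity) (mul_div_cancel₀ _ hκ.ne').le h₀ hd
  have hb := bddPer_toSphere he h.meas h.periodic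
  have hv1 := norm_toSphere he u
  generalize toSphere e u = v at *
  choose c hc1 hc using fun j => exists_unit_lintegral_sub_le (hb (t j)) (hv1 (t j))
  obtain ⟨a, ha, φ, hφ, hca⟩ := (isCompact_sphere (0 : E n) 1).tendsto_subseq
    fun j => mem_sphere_zero_iff_norm.2 (hc1 j)
  rw [mem_sphere_zero_iff_norm] at ha
  refine ⟨fun j => t (φ j), ht.comp hφ.tendsto_atTop, fun _ => a, measurable_const, fun _ => rfl,
    ae_of_all _ fun _ => ha, hSob_const_lt_top ha, ?_, ⟨1 + M, ?_, fun j => ?_⟩, ?_⟩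
  · have hle : ∀ j, ∫⁻ x in circ, (‖u (t (φ j)) x - a‖₊ : ℝ≥0∞) ^ 2
        ≤ 2 * (4 * ENNReal.ofReal (2 * π) * hWV (fun k => (k : ℝ) ^ 2) (v (t (φ j))))
          + 2 * ENNReal.ofReal (2 * π) * ‖c (φ j) - a‖ₑ ^ 2 := by
      intro j
      have e1 : ∫⁻ x in circ, (‖u (t (φ j)) x - a‖₊ : ℝ≥0∞) ^ 2
          = ∫⁻ x in circ, ‖v (t (φ j)) x - a‖ₑ ^ 2 :=
        lintegral_congr_ae ((htu (φ j)).mono fun x hx => by simp only [hx]; rfl)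
      rw [e1]
      refine (lintegral_sub_sq_le (measurable_of_apply fun i => (hb _ i).meas) (c (φ j)) a).trans ?_
      gcongr
      exact hc _
    refine tendsto_of_tendsto_of_tendsto_of_le_of_le tendsto_const_nhds ?_ (fun _ => zero_le) hle
    have l1 := ENNReal.Tendsto.const_mul (a := 2) (ENNReal.Tendsto.const_mul
      (a := 4 * ENNReal.ofReal (2 * π)) (hlim.comp hφ.tendsto_atTop)
      (Or.inr (ENNReal.mul_ne_top (by simp) ENNReal.ofReal_ne_top))) (Or.inr (by simp))
    have l2 : Tendsto (fun j => ‖c (φ j) - a‖ₑ ^ 2) atTop (𝓝 0) := by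
      have := ENNReal.Tendsto.pow (n := 2) (hca.sub_const a).enorm
      simpa using this
    have l3 := ENNReal.Tendsto.const_mul (a := 2 * ENNReal.ofReal (2 * π)) l2
      (Or.inr (ENNReal.mul_ne_top (by simp) ENNReal.ofReal_ne_top))
    simpa only [Function.comp_def, mul_zero, add_zero] using l1.add l3
  · exact ENNReal.add_lt_top.2 ⟨ENNReal.one_lt_top, hM⟩
  · rw [hSob_one_eq_hWV, hWV_congr (htu _), hWV_congr (htu _), hWV_one_eq (hb _) (hv1 _)]
    gcongr
    exact hMt _
  · intro ψ _ _
    simp [pairing, gagl]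
end
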